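/- Let u_0 be the pointwise infimum of all non-continuous minimax L_H-supersolutions of (TVP), and let (u_0)^* and (u_0)_* be its upper and lower semicontinuous envelopes with respect to d_∞, i.e. (u_0)^*(t_0,x_0) = inf_{δ>0} sup{u_0(t,x) : d_∞((t_0,x_0),(t,x)) < δ} and (u_0)_*(t_0,x_0) = sup_{δ>0} inf{u_0(t,x) : d_∞((t_0,x_0),(t,x)) < δ}. Then (u_0)^* and (u_0)_* are real-valued, (u_0)^* is a minimax L_H-subsolution of (TVP), and (u_0)_* is a minimax L_H-supersolution of (TVP). -/

import Mathlib

open MeasureTheory Set Filter Topology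
open scoped InnerProductSpace

noncomputable section

namespace PHJ

/-- The Euclidean state space `ℝ^d`. -/
abbrev E (d : ℕ) := EuclideanSpace ℝ (Fin d)

/-- A path; only its values on `[0, T]` are relevant. -/
abbrev Path (d : ℕ) := ℝ → E d

/-- The set `Ω = D([0,T], ℝ^d)` of paths that are right-continuous on `[0,T)` and have
left limits on `(0,T]`. -/
def Cadlag (T : ℝ) (d : ℕ) : Set (Path d) :=
  {x | (∀ t ∈ Ico (0 : ℝ) T, ContinuousWithinAt x (Ici t) t) ∧
       (∀ t ∈ Ioc (0 : ℝ) T, ∃ l : E d, Tendsto x (nhdsWithin t (Iio t)) (nhds l))}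

/-- The running supremum `sup_{0 ≤ s ≤ t} |x(s)|`. -/
def runSup (d : ℕ) (x : Path d) (t : ℝ) : ℝ :=
  sSup ((fun s => ‖x s‖) '' Icc 0 t)

/-- The supremum distance `sup_{0 ≤ s ≤ T} |x(s) − y(s)|`. -/
def supDist (T : ℝ) (d : ℕ) (x y : Path d) : ℝ :=
  sSup ((fun s => ‖x s - y s‖) '' Icc 0 T)

/-- The stopped supremum distance `sup_{0 ≤ r ≤ T} |x(r ∧ t) − y(r ∧ s)|`. -/
def stopDist (T : ℝ) (d : ℕ) (t : ℝ) (x : Path d) (s : ℝ) (y : Path d) : ℝ :=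
  sSup ((fun r => ‖x (min r t) - y (min r s)‖) '' Icc 0 T)

/-- The pseudometric `d_∞` on `[0,T] × Ω`. -/
def dInf (T : ℝ) (d : ℕ) (p q : ℝ × Path d) : ℝ :=
  |p.1 - q.1| + stopDist T d p.1 p.2 q.1 q.2

/-- `g` is an integrable a.e.-derivative of `x` on `[s₀, T]` (so that `x` is absolutely
continuous there) satisfying the growth bound `|x′(t)| ≤ L (1 + sup_{s ≤ t} |x(s)|)` a.e. -/
def XDeriv (T : ℝ) (d : ℕ) (L s₀ : ℝ) (x g : Path d) : Prop :=
  IntegrableOn g (Icc s₀ T) volume ∧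
  (∀ t ∈ Icc s₀ T, x t = x s₀ + ∫ s in s₀..t, g s) ∧
  (∀ᵐ t ∂(volume.restrict (Ioo s₀ T)), ‖g t‖ ≤ L * (1 + runSup d x t))

/-- The set `X^L(s₀, x₀)` of "Lipschitz-like" paths. -/
def XSet (T : ℝ) (d : ℕ) (L s₀ : ℝ) (x₀ : Path d) : Set (Path d) :=
  {x | x ∈ Cadlag T d ∧ (∀ t ∈ Icc 0 s₀, x t = x₀ t) ∧ ∃ g, XDeriv T d L s₀ x g}

/-- Type of Hamiltonians `H(t, x, y, z)`. -/
abbrev Ham (d : ℕ) := ℝ → Path d → ℝ → E d → ℝ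

/-- The set `Y^L(s₀, x₀, y₀, z)` of characteristic pairs `(x, y)`. -/
def YSet (T : ℝ) (d : ℕ) (H : Ham d) (L s₀ : ℝ) (x₀ : Path d) (y₀ : ℝ) (z : E d) :
    Set (Path d × (ℝ → ℝ)) :=
  {p | p.1 ∈ Cadlag T d ∧ (∀ t ∈ Icc 0 s₀, p.1 t = x₀ t) ∧
       ContinuousOn p.2 (Icc s₀ T) ∧
       ∃ g, XDeriv T d L s₀ p.1 g ∧
         IntegrableOn (fun s => ⟪g s, z⟫_ℝ - H s p.1 (p.2 s) z) (Icc s₀ T) volume ∧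
         ∀ t ∈ Icc s₀ T, p.2 t = y₀ + ∫ s in s₀..t, (⟪g s, z⟫_ℝ - H s p.1 (p.2 s) z)}

/-- Assumption (i): for a.e. `t`, `(x, y, z) ↦ H(t, x, y, z)` is continuous. -/
def HamCont (T : ℝ) (d : ℕ) (H : Ham d) : Prop :=
  ∀ᵐ t ∂(volume.restrict (Ioo (0 : ℝ) T)),
    ∀ x ∈ Cadlag T d, ∀ (y : ℝ) (z : E d), ∀ ε > (0 : ℝ), ∃ δ > (0 : ℝ),
      ∀ x' ∈ Cadlag T d, ∀ (y' : ℝ) (z' : E d),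
        supDist T d x x' < δ → |y - y'| < δ → ‖z - z'‖ < δ →
        |H t x y z - H t x' y' z'| < ε

/-- Assumption (ii): `t ↦ H(t, x, y, z)` is Borel measurable. -/
def HamMeas (d : ℕ) (H : Ham d) : Prop :=
  ∀ (x : Path d) (y : ℝ) (z : E d), Measurable fun t => H t x y z

/-- Assumption (iii): Lipschitz continuity in `z` with constant `L_H (1 + sup_{s≤t} |x(s)|)`. -/
def HamLipZ (T : ℝ) (d : ℕ) (H : Ham d) (LH : ℝ) : Prop :=
  0 ≤ LH ∧ ∀ᵐ t ∂(volume.restrict (Ioo (0 : ℝ) T)),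
    ∀ x ∈ Cadlag T d, ∀ (y : ℝ) (z z' : E d),
      |H t x y z - H t x y z'| ≤ LH * (1 + runSup d x t) * ‖z - z'‖

/-- Assumption (iv): local Lipschitz continuity in `x` along `X^L`-paths,
with constant `M L`. -/
def HamLipX (T : ℝ) (d : ℕ) (H : Ham d) (M : ℝ → ℝ) : Prop :=
  ∀ L ≥ (0 : ℝ), 0 ≤ M L ∧
    ∀ t₀ ∈ Ico (0 : ℝ) T, ∀ x₀ ∈ Cadlag T d,
      ∀ x ∈ XSet T d L t₀ x₀, ∀ x' ∈ XSet T d L t₀ x₀, ∀ (y : ℝ) (z : E d),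
        ∀ᵐ t ∂(volume.restrict (Ioo t₀ T)),
          |H t x y z - H t x' y z| ≤
            M L * (1 + |y| + ‖z‖) * sSup ((fun s => ‖x s - x' s‖) '' Icc 0 t)

/-- Assumption (v): `y ↦ H(t, x, y, z)` is non-increasing. -/
def HamMono (T : ℝ) (d : ℕ) (H : Ham d) : Prop :=
  ∀ᵐ t ∂(volume.restrict (Ioo (0 : ℝ) T)),
    ∀ x ∈ Cadlag T d, ∀ (z : E d) (y y' : ℝ), y ≤ y' → H t x y' z ≤ H t x y z

/-- Assumption (vi): growth bound `|H(t, x, y, 0)| ≤ C_H (1 + sup_{s≤t}|x(s)| + |y|)`. -/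
def HamBound (T : ℝ) (d : ℕ) (H : Ham d) (CH : ℝ) : Prop :=
  0 ≤ CH ∧ ∀ᵐ t ∂(volume.restrict (Ioo (0 : ℝ) T)),
    ∀ x ∈ Cadlag T d, ∀ y : ℝ, |H t x y 0| ≤ CH * (1 + runSup d x t + |y|)

/-- Lower semicontinuity on `[0,T] × Ω` with respect to `d_∞`. -/
def LscOn (T : ℝ) (d : ℕ) (u : ℝ → Path d → ℝ) : Prop :=
  ∀ t₀ ∈ Icc (0 : ℝ) T, ∀ x₀ ∈ Cadlag T d, ∀ c : ℝ, c < u t₀ x₀ →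
    ∃ δ > (0 : ℝ), ∀ t ∈ Icc (0 : ℝ) T, ∀ x ∈ Cadlag T d,
      dInf T d (t₀, x₀) (t, x) < δ → c < u t x

/-- Upper semicontinuity on `[0,T] × Ω` with respect to `d_∞`. -/
def UscOn (T : ℝ) (d : ℕ) (u : ℝ → Path d → ℝ) : Prop :=
  ∀ t₀ ∈ Icc (0 : ℝ) T, ∀ x₀ ∈ Cadlag T d, ∀ c : ℝ, u t₀ x₀ < c →
    ∃ δ > (0 : ℝ), ∀ t ∈ Icc (0 : ℝ) T, ∀ x ∈ Cadlag T d,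
      dInf T d (t₀, x₀) (t, x) < δ → u t x < c

/-- Continuity of the terminal condition `h` with respect to the sup norm. -/
def TermCont (T : ℝ) (d : ℕ) (h : Path d → ℝ) : Prop :=
  ∀ x ∈ Cadlag T d, ∀ ε > (0 : ℝ), ∃ δ > (0 : ℝ), ∀ x' ∈ Cadlag T d,
    supDist T d x x' < δ → |h x' - h x| < ε

/-- `u` is a minimax `L`-supersolution of the terminal-value problem (TVP). -/
def MinimaxSuper (T : ℝ) (d : ℕ) (H : Ham d) (h : Path d → ℝ) (L : ℝ)
    (u : ℝ → Path d → ℝ) : Prop :=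
  LscOn T d u ∧ (∀ x ∈ Cadlag T d, h x ≤ u T x) ∧
  ∀ s₀ ∈ Ico (0 : ℝ) T, ∀ x₀ ∈ Cadlag T d, ∀ (z : E d) (y₀ : ℝ), u s₀ x₀ ≤ y₀ →
    ∃ p ∈ YSet T d H L s₀ x₀ y₀ z, ∀ t ∈ Icc s₀ T, u t p.1 ≤ p.2 t

/-- `u` is a minimax `L`-subsolution of the terminal-value problem (TVP). -/
def MinimaxSub (T : ℝ) (d : ℕ) (H : Ham d) (h : Path d → ℝ) (L : ℝ)
    (u : ℝ → Path d → ℝ) : Prop :=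
  UscOn T d u ∧ (∀ x ∈ Cadlag T d, u T x ≤ h x) ∧
  ∀ s₀ ∈ Ico (0 : ℝ) T, ∀ x₀ ∈ Cadlag T d, ∀ (z : E d) (y₀ : ℝ), y₀ ≤ u s₀ x₀ →
    ∃ p ∈ YSet T d H L s₀ x₀ y₀ z, ∀ t ∈ Icc s₀ T, p.2 t ≤ u t p.1

/-- `u` is a minimax `L`-solution of the terminal-value problem (TVP). -/
def MinimaxSol (T : ℝ) (d : ℕ) (H : Ham d) (h : Path d → ℝ) (L : ℝ)
    (u : ℝ → Path d → ℝ) : Prop :=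
  MinimaxSuper T d H h L u ∧ MinimaxSub T d H h L u

/-- Embedding of a path into the space of functions on `[0,T]` with the topology of
uniform convergence (i.e. the sup-norm topology). -/
def toUnif (T : ℝ) (d : ℕ) (x : Path d) : UniformFun (Icc (0 : ℝ) T) (E d) :=
  UniformFun.ofFun fun s => x s.1

/-- Embedding of a real-valued function into the space of functions on `[s₀,T]` with the
topology of uniform convergence. -/
def toUnifR (T s₀ : ℝ) (y : ℝ → ℝ) : UniformFun (Icc s₀ T) ℝ :=
  UniformFun.ofFun fun s => y s.1


/-- Continuity on `[0,T] × Ω` with respect to `d_∞`. -/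
def Cont2 (T : ℝ) (d : ℕ) (u : ℝ → Path d → ℝ) : Prop :=
  ∀ t₀ ∈ Icc (0 : ℝ) T, ∀ x₀ ∈ Cadlag T d, ∀ ε > (0 : ℝ), ∃ δ > (0 : ℝ),
    ∀ t ∈ Icc (0 : ℝ) T, ∀ x ∈ Cadlag T d,
      dInf T d (t₀, x₀) (t, x) < δ → |u t x - u t₀ x₀| < ε

/-- `u : [0,T] × Ω → [−∞,∞]` is a non-continuous minimax `L`-supersolution of (TVP). -/
def NCSuper (T : ℝ) (d : ℕ) (H : Ham d) (h : Path d → ℝ) (L : ℝ)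
    (u : ℝ → Path d → EReal) : Prop :=
  (∀ x ∈ Cadlag T d, u T x = ((h x : ℝ) : EReal)) ∧
  ∀ t₀ ∈ Ico (0 : ℝ) T, ∀ x₀ ∈ Cadlag T d, ∀ (z : E d) (y₀ : ℝ),
    u t₀ x₀ < ((y₀ : ℝ) : EReal) → ∀ T₀ ∈ Ioc t₀ T,
      sInf ((fun p : Path d × (ℝ → ℝ) => u T₀ p.1 - ((p.2 T₀ : ℝ) : EReal)) ''
        YSet T d H L t₀ x₀ y₀ z) ≤ 0

/-- `u : [0,T] × Ω → [−∞,∞]` is a non-continuous minimax `L`-subsolution of (TVP). -/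
def NCSub (T : ℝ) (d : ℕ) (H : Ham d) (h : Path d → ℝ) (L : ℝ)
    (u : ℝ → Path d → EReal) : Prop :=
  (∀ x ∈ Cadlag T d, u T x = ((h x : ℝ) : EReal)) ∧
  ∀ t₀ ∈ Ico (0 : ℝ) T, ∀ x₀ ∈ Cadlag T d, ∀ (z : E d) (y₀ : ℝ),
    ((y₀ : ℝ) : EReal) < u t₀ x₀ → ∀ T₀ ∈ Ioc t₀ T,
      0 ≤ sSup ((fun p : Path d × (ℝ → ℝ) => u T₀ p.1 - ((p.2 T₀ : ℝ) : EReal)) ''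
        YSet T d H L t₀ x₀ y₀ z)

/-- The function `μ^z_+(t₀, x₀, y₀) = sup{ h(x) − y(T) : (x,y) ∈ Y^{L_H}(t₀,x₀,y₀,z) }`. -/
def muPlus (T : ℝ) (d : ℕ) (H : Ham d) (h : Path d → ℝ) (LH : ℝ) (z : E d)
    (t₀ : ℝ) (x₀ : Path d) (y₀ : ℝ) : EReal :=
  sSup ((fun p : Path d × (ℝ → ℝ) => ((h p.1 - p.2 T : ℝ) : EReal)) ''
    YSet T d H LH t₀ x₀ y₀ z)

/-- The function `u^z_+` given by `u^z_+(t₀,x₀) = sup{ r ∈ ℝ : μ^z_+(t₀,x₀,r) ≥ 0 }`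
(with `sup ∅ = −∞`) for `t₀ < T`, and `u^z_+(T,·) = h`. -/
def uPlus (T : ℝ) (d : ℕ) (H : Ham d) (h : Path d → ℝ) (LH : ℝ) (z : E d)
    (t₀ : ℝ) (x₀ : Path d) : EReal :=
  if t₀ = T then ((h x₀ : ℝ) : EReal)
  else sSup {v : EReal | ∃ r : ℝ, v = ((r : ℝ) : EReal) ∧ 0 ≤ muPlus T d H h LH z t₀ x₀ r}

/-- The Perron-type function `u₀`, the pointwise infimum of all non-continuous minimax
`L_H`-supersolutions of (TVP). -/
def uZero (T : ℝ) (d : ℕ) (H : Ham d) (h : Path d → ℝ) (LH : ℝ)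
    (t : ℝ) (x : Path d) : EReal :=
  sInf {v : EReal | ∃ u : ℝ → Path d → EReal, NCSuper T d H h LH u ∧ v = u t x}

/-- The upper semicontinuous envelope with respect to `d_∞` of an extended-real-valued
function on `[0,T] × Ω`. -/
def uscEnv (T : ℝ) (d : ℕ) (u : ℝ → Path d → EReal) (t₀ : ℝ) (x₀ : Path d) : EReal :=
  ⨅ δ ∈ Ioi (0 : ℝ),
    sSup {v : EReal | ∃ t ∈ Icc (0 : ℝ) T, ∃ x ∈ Cadlag T d,
      dInf T d (t₀, x₀) (t, x) < δ ∧ v = u t x}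

/-- The lower semicontinuous envelope with respect to `d_∞` of an extended-real-valued
function on `[0,T] × Ω`. -/
def lscEnv (T : ℝ) (d : ℕ) (u : ℝ → Path d → EReal) (t₀ : ℝ) (x₀ : Path d) : EReal :=
  ⨆ δ ∈ Ioi (0 : ℝ),
    sInf {v : EReal | ∃ t ∈ Icc (0 : ℝ) T, ∃ x ∈ Cadlag T d,
      dInf T d (t₀, x₀) (t, x) < δ ∧ v = u t x}

section

variable {T : ℝ} {d : ℕ}

/-! ### Càdlàg paths, running suprema and distances -/

theorem Cadlag.exists_bound {x : Path d} (hx : x ∈ Cadlag T d) :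
    ∃ R, 0 ≤ R ∧ ∀ t ∈ Icc 0 T, ‖x t‖ ≤ R := by
  suffices h : ∃ R, ∀ t ∈ Icc 0 T, ‖x t‖ ≤ R by
    obtain ⟨R, hR⟩ := h
    exact ⟨max R 0, le_max_right _ _, fun t ht => (hR t ht).trans (le_max_left _ _)⟩
  refine isCompact_Icc.induction_on (p := fun s => ∃ R, ∀ t ∈ s, ‖x t‖ ≤ R) ⟨0, by simp⟩ ?_ ?_ ?_
  · rintro s t hst ⟨R, hR⟩
    exact ⟨R, fun r hr => hR r (hst hr)⟩
  · rintro s t ⟨R, hR⟩ ⟨R', hR'⟩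
    refine ⟨max R R', ?_⟩
    rintro r (hr | hr)
    · exact (hR r hr).trans (le_max_left _ _)
    · exact (hR' r hr).trans (le_max_right _ _)
  · intro t ht
    have hright : ∃ R, ∀ᶠ s in 𝓝[≥] t, s ≤ T → ‖x s‖ ≤ R := by
      rcases ht.2.lt_or_eq with h | h
      · have := (hx.1 t ⟨ht.1, h⟩).norm
        refine ⟨‖x t‖ + 1, ?_⟩
        filter_upwards [this.eventually (gt_mem_nhds (lt_add_one _))] with s hs _ using hs.le
      · refine ⟨‖x t‖, ?_⟩
        filter_upwards [self_mem_nhdsWithin] with s hs hsT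
        rw [le_antisymm (hsT.trans h.ge) hs]
    have hleft : ∃ R, ∀ᶠ s in 𝓝[<] t, 0 ≤ s → ‖x s‖ ≤ R := by
      rcases ht.1.lt_or_eq with h | h
      · obtain ⟨l, hl⟩ := hx.2 t ⟨h, ht.2⟩
        refine ⟨‖l‖ + 1, ?_⟩
        filter_upwards [hl.norm.eventually (gt_mem_nhds (lt_add_one _))] with s hs _ using hs.le
      · refine ⟨0, ?_⟩
        filter_upwards [self_mem_nhdsWithin] with s hs hs0
        exact absurd hs (not_lt.2 (h ▸ hs0))
    obtain ⟨R, hR⟩ := hright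
    obtain ⟨R', hR'⟩ := hleft
    have hev : ∀ᶠ s in 𝓝 t, s ∈ Icc 0 T → ‖x s‖ ≤ max R R' := by
      rw [← nhdsLT_sup_nhdsGE, eventually_sup]
      refine ⟨hR'.mono fun s hs h => (hs h.1).trans (le_max_right _ _),
        hR.mono fun s hs h => (hs h.2).trans (le_max_left _ _)⟩
    exact ⟨{s | s ∈ Icc 0 T → ‖x s‖ ≤ max R R'} ∩ Icc 0 T,
      inter_mem (mem_nhdsWithin_of_mem_nhds hev) self_mem_nhdsWithin,
      ⟨max R R', fun s hs => hs.1 hs.2⟩⟩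

theorem sSup_image_Icc_le {f : ℝ → ℝ} {t c : ℝ} (hc : 0 ≤ c) (h : ∀ s ∈ Icc 0 t, f s ≤ c) :
    sSup (f '' Icc 0 t) ≤ c := by
  refine Real.sSup_le ?_ hc
  rintro _ ⟨s, hs, rfl⟩
  exact h s hs

theorem le_sSup_image_Icc {f : ℝ → ℝ} {t c : ℝ} (h : ∀ s ∈ Icc 0 t, f s ≤ c) {s : ℝ}
    (hs : s ∈ Icc 0 t) : f s ≤ sSup (f '' Icc 0 t) := by
  refine le_csSup ⟨c, ?_⟩ ⟨s, hs, rfl⟩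
  rintro _ ⟨s, hs, rfl⟩
  exact h s hs

theorem sSup_image_norm_nonneg {F : Type*} [NormedAddCommGroup F] (f : ℝ → F) (s : Set ℝ) :
    0 ≤ sSup ((fun r => ‖f r‖) '' s) := by
  refine Real.sSup_nonneg ?_
  rintro _ ⟨s, hs, rfl⟩
  exact norm_nonneg _

theorem runSup_nonneg (x : Path d) (t : ℝ) : 0 ≤ runSup d x t := sSup_image_norm_nonneg _ _

theorem supDist_nonneg (x y : Path d) : 0 ≤ supDist T d x y := sSup_image_norm_nonneg _ _

theorem stopDist_nonneg (t : ℝ) (x : Path d) (s : ℝ) (y : Path d) : 0 ≤ stopDist T d t x s y :=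
  sSup_image_norm_nonneg _ _

theorem runSup_le {x : Path d} {t c : ℝ} (hc : 0 ≤ c) (h : ∀ s ∈ Icc 0 t, ‖x s‖ ≤ c) :
    runSup d x t ≤ c := sSup_image_Icc_le hc h

theorem supDist_le {x y : Path d} {c : ℝ} (hc : 0 ≤ c) (h : ∀ s ∈ Icc 0 T, ‖x s - y s‖ ≤ c) :
    supDist T d x y ≤ c := sSup_image_Icc_le hc h

theorem norm_le_runSup {x : Path d} (hx : x ∈ Cadlag T d) {s t : ℝ} (hs : 0 ≤ s) (hst : s ≤ t)
    (ht : t ≤ T) : ‖x s‖ ≤ runSup d x t := by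
  obtain ⟨R, -, hR⟩ := Cadlag.exists_bound hx
  exact le_sSup_image_Icc (f := fun s => ‖x s‖) (fun s hs => hR s ⟨hs.1, hs.2.trans ht⟩) ⟨hs, hst⟩

theorem runSup_mono {x : Path d} (hx : x ∈ Cadlag T d) {s t : ℝ} (hst : s ≤ t)
    (ht : t ≤ T) : runSup d x s ≤ runSup d x t :=
  runSup_le (runSup_nonneg _ _) fun _ hr => norm_le_runSup hx hr.1 (hr.2.trans hst) ht

theorem runSup_congr {x y : Path d} {t : ℝ} (h : ∀ s ∈ Icc 0 t, x s = y s) :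
    runSup d x t = runSup d y t := by
  unfold runSup
  congr 1
  exact image_congr fun s hs => by rw [h s hs]

theorem norm_sub_le_supDist {x y : Path d} (hx : x ∈ Cadlag T d) (hy : y ∈ Cadlag T d) {s : ℝ}
    (hs : s ∈ Icc 0 T) : ‖x s - y s‖ ≤ supDist T d x y := by
  obtain ⟨R, -, hR⟩ := Cadlag.exists_bound hx
  obtain ⟨R', -, hR'⟩ := Cadlag.exists_bound hy
  exact le_sSup_image_Icc (f := fun s => ‖x s - y s‖) (c := R + R')
    (fun s hs => (norm_sub_le _ _).trans (add_le_add (hR s hs) (hR' s hs))) hs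

theorem runSup_le_add_supDist {x y : Path d} (hx : x ∈ Cadlag T d) (hy : y ∈ Cadlag T d) {t : ℝ}
    (ht : t ≤ T) : runSup d x t ≤ runSup d y t + supDist T d x y := by
  refine runSup_le (add_nonneg (runSup_nonneg _ _) (supDist_nonneg _ _)) fun s hs => ?_
  have h1 := norm_sub_le_supDist hx hy ⟨hs.1, hs.2.trans ht⟩
  have h2 := norm_le_runSup hy hs.1 hs.2 ht
  have h3 : ‖x s‖ ≤ ‖y s‖ + ‖x s - y s‖ := by
    simpa using norm_add_le (y s) (x s - y s)
  linarith

theorem supDist_comm (x y : Path d) : supDist T d x y = supDist T d y x := by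
  simp only [supDist, norm_sub_rev]

theorem min_mem_Icc {r t : ℝ} (hr : r ∈ Icc 0 T) (ht : t ∈ Icc 0 T) : min r t ∈ Icc 0 T :=
  ⟨le_min hr.1 ht.1, (min_le_left _ _).trans hr.2⟩

theorem norm_sub_le_stopDist {x y : Path d} (hx : x ∈ Cadlag T d) (hy : y ∈ Cadlag T d) {t s r : ℝ}
    (ht : t ∈ Icc 0 T) (hs : s ∈ Icc 0 T) (hr : r ∈ Icc 0 T) :
    ‖x (min r t) - y (min r s)‖ ≤ stopDist T d t x s y := by
  obtain ⟨R, -, hR⟩ := Cadlag.exists_bound hx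
  obtain ⟨R', -, hR'⟩ := Cadlag.exists_bound hy
  exact le_sSup_image_Icc (f := fun r => ‖x (min r t) - y (min r s)‖) (c := R + R')
    (fun r hr => (norm_sub_le _ _).trans
      (add_le_add (hR _ (min_mem_Icc hr ht)) (hR' _ (min_mem_Icc hr hs)))) hr

theorem stopDist_le {x y : Path d} {t s c : ℝ} (hc : 0 ≤ c)
    (h : ∀ r ∈ Icc 0 T, ‖x (min r t) - y (min r s)‖ ≤ c) : stopDist T d t x s y ≤ c :=
  sSup_image_Icc_le hc h

theorem dInf_nonneg (p q : ℝ × Path d) : 0 ≤ dInf T d p q :=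
  add_nonneg (abs_nonneg _) (stopDist_nonneg _ _ _ _)

theorem dInf_triangle {x y w : Path d} (hx : x ∈ Cadlag T d) (hy : y ∈ Cadlag T d)
    (hw : w ∈ Cadlag T d) {t s r : ℝ} (ht : t ∈ Icc 0 T) (hs : s ∈ Icc 0 T) (hr : r ∈ Icc 0 T) :
    dInf T d (t, x) (r, w) ≤ dInf T d (t, x) (s, y) + dInf T d (s, y) (r, w) := by
  have h1 : stopDist T d t x r w ≤ stopDist T d t x s y + stopDist T d s y r w := by
    refine stopDist_le (add_nonneg (stopDist_nonneg _ _ _ _) (stopDist_nonneg _ _ _ _))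
      fun q hq => ?_
    have h := norm_sub_le_norm_sub_add_norm_sub (x (min q t)) (y (min q s)) (w (min q r))
    exact h.trans (add_le_add (norm_sub_le_stopDist hx hy ht hs hq)
      (norm_sub_le_stopDist hy hw hs hr hq))
  have h2 := abs_sub_le t s r
  simp only [dInf]
  linarith

theorem dInf_congr_left {x y : Path d} {t : ℝ} (ht : t ∈ Icc 0 T) (h : ∀ s ∈ Icc 0 t, x s = y s)
    (q : ℝ × Path d) : dInf T d (t, x) q = dInf T d (t, y) q := by
  simp only [dInf, stopDist]
  congr 2
  exact image_congr fun r hr => by rw [h _ ⟨le_min hr.1 ht.1, min_le_right _ _⟩]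

theorem dInf_self (t : ℝ) (x : Path d) : dInf T d (t, x) (t, x) = 0 := by
  have : stopDist T d t x t x ≤ 0 := stopDist_le le_rfl fun r _ => by simp
  have h := stopDist_nonneg (T := T) t x t x
  simp [dInf, le_antisymm this h]

/-- Gluing a càdlàg path with a continuous continuation yields a càdlàg path. -/
theorem Cadlag.of_glue {x x₀ : Path d} {s₀ : ℝ} (hx₀ : x₀ ∈ Cadlag T d)
    (h : ∀ t ∈ Icc 0 s₀, x t = x₀ t) (hc : ContinuousOn x (Icc s₀ T)) : x ∈ Cadlag T d := by
  refine ⟨fun t ht => ?_, fun t ht => ?_⟩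
  · rcases lt_or_ge t s₀ with hts | hts
    · refine (hx₀.1 t ht).congr_of_eventuallyEq ?_ (h t ⟨ht.1, hts.le⟩)
      filter_upwards [self_mem_nhdsWithin, mem_nhdsWithin_of_mem_nhds (Iio_mem_nhds hts)]
        with s hs hs'
      exact h s ⟨ht.1.trans hs, hs'.le⟩
    · refine (hc t ⟨hts, ht.2.le⟩).mono_of_mem_nhdsWithin ?_
      filter_upwards [self_mem_nhdsWithin, mem_nhdsWithin_of_mem_nhds (Iio_mem_nhds ht.2)]
        with s hs hs'
      exact ⟨hts.trans hs, hs'.le⟩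
  · rcases le_or_gt t s₀ with hts | hts
    · obtain ⟨l, hl⟩ := hx₀.2 t ht
      refine ⟨l, hl.congr' ?_⟩
      filter_upwards [self_mem_nhdsWithin, mem_nhdsWithin_of_mem_nhds (Ioi_mem_nhds ht.1)]
        with s hs hs'
      exact (h s ⟨le_of_lt hs', (le_of_lt hs).trans hts⟩).symm
    · refine ⟨x t, (hc t ⟨hts.le, ht.2⟩).mono_of_mem_nhdsWithin ?_⟩
      filter_upwards [self_mem_nhdsWithin, mem_nhdsWithin_of_mem_nhds (Ioi_mem_nhds hts)]
        with s hs hs'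
      exact ⟨le_of_lt hs', (mem_Iio.1 hs).le.trans ht.2⟩

/-! ### Paths with controlled growth -/

/-- The integrated form of the growth bound `|x′(t)| ≤ L (1 + sup_{s ≤ t} |x(s)|)` on `[s₀, T]`. -/
def GrowthLip (T : ℝ) (d : ℕ) (L s₀ : ℝ) (x : Path d) : Prop :=
  ∀ s t, s₀ ≤ s → s ≤ t → t ≤ T → ‖x t - x s‖ ≤ L * (1 + runSup d x t) * (t - s)

theorem GrowthLip.norm_sub_le {L s₀ R : ℝ} {x : Path d} (hL : 0 ≤ L)
    (h : GrowthLip T d L s₀ x) (hR : ∀ t ≤ T, runSup d x t ≤ R) {s t : ℝ}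
    (hs : s ∈ Icc s₀ T) (ht : t ∈ Icc s₀ T) : ‖x t - x s‖ ≤ L * (1 + R) * |t - s| := by
  rcases le_total s t with hst | hst
  · rw [abs_of_nonneg (sub_nonneg.2 hst)]
    refine (h s t hs.1 hst ht.2).trans ?_
    have := hR t ht.2
    have := sub_nonneg.2 hst
    gcongr
  · rw [abs_sub_comm, abs_of_nonneg (sub_nonneg.2 hst), norm_sub_rev]
    refine (h t s ht.1 hst hs.2).trans ?_
    have := hR s hs.2
    have := sub_nonneg.2 hst
    gcongr

theorem exists_runSup_le {x : Path d} (hx : x ∈ Cadlag T d) :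
    ∃ R, 0 ≤ R ∧ ∀ t ≤ T, runSup d x t ≤ R :=
  ⟨runSup d x T, runSup_nonneg _ _, fun _ ht => runSup_mono hx ht le_rfl⟩

theorem continuousOn_of_norm_sub_le {F : Type*} [NormedAddCommGroup F] {f : ℝ → F} {K : ℝ}
    {S : Set ℝ} (hK : 0 ≤ K) (h : ∀ s ∈ S, ∀ t ∈ S, ‖f t - f s‖ ≤ K * |t - s|) :
    ContinuousOn f S := by
  have : LipschitzOnWith K.toNNReal f S := LipschitzOnWith.of_dist_le_mul fun x hx y hy => by
    rw [Real.coe_toNNReal _ hK, dist_eq_norm, Real.dist_eq]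
    exact h y hy x hx
  exact this.continuousOn

theorem GrowthLip.continuousOn {L s₀ : ℝ} {x : Path d} (hL : 0 ≤ L) (h : GrowthLip T d L s₀ x)
    (hx : x ∈ Cadlag T d) : ContinuousOn x (Icc s₀ T) := by
  obtain ⟨R, hR0, hR⟩ := exists_runSup_le hx
  exact continuousOn_of_norm_sub_le (K := L * (1 + R)) (by positivity)
    fun s hs t ht => h.norm_sub_le hL hR hs ht

theorem GrowthLip.runSup_le_add {L s₀ : ℝ} {x : Path d} (hL : 0 ≤ L) (h : GrowthLip T d L s₀ x)
    (hx : x ∈ Cadlag T d) (hs₀ : 0 ≤ s₀) {s t : ℝ} (hs : s₀ ≤ s) (hst : s ≤ t) (ht : t ≤ T) :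
    runSup d x t ≤ runSup d x s + L * (1 + runSup d x t) * (t - s) := by
  have h0 : 0 ≤ L * (1 + runSup d x t) * (t - s) := by
    have := runSup_nonneg x t
    have := sub_nonneg.2 hst
    positivity
  refine runSup_le (add_nonneg (runSup_nonneg _ _) h0) fun r hr => ?_
  rcases le_total r s with hrs | hrs
  · linarith [norm_le_runSup hx hr.1 hrs (hst.trans ht)]
  · have h1 := h s r hs hrs (hr.2.trans ht)
    have h2 := norm_le_runSup hx (hs₀.trans hs) le_rfl (hst.trans ht)
    have h3 : ‖x r‖ ≤ ‖x s‖ + ‖x r - x s‖ := by simpa using norm_add_le (x s) (x r - x s)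
    have h4 : L * (1 + runSup d x r) * (r - s) ≤ L * (1 + runSup d x t) * (t - s) := by
      have := runSup_nonneg x r
      have := runSup_mono hx hr.2 ht
      have := sub_nonneg.2 hrs
      have : 0 ≤ 1 + runSup d x t := by linarith [runSup_nonneg x t]
      have := mul_nonneg hL this
      gcongr
      exact hr.2
    linarith

theorem GrowthLip.continuousOn_runSup {L s₀ : ℝ} {x : Path d} (hL : 0 ≤ L)
    (h : GrowthLip T d L s₀ x) (hx : x ∈ Cadlag T d) (hs₀ : 0 ≤ s₀) :
    ContinuousOn (runSup d x) (Icc s₀ T) := by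
  obtain ⟨R, hR0, hR⟩ := exists_runSup_le hx
  have key : ∀ s t, s₀ ≤ s → s ≤ t → t ≤ T →
      |runSup d x t - runSup d x s| ≤ L * (1 + R) * |t - s| := by
    intro s t hs hst ht
    have h1 := h.runSup_le_add hL hx hs₀ hs hst ht
    have h2 := runSup_mono hx hst ht
    have h3 : L * (1 + runSup d x t) * (t - s) ≤ L * (1 + R) * (t - s) := by
      have := hR t ht
      have := sub_nonneg.2 hst
      gcongr
    rw [abs_of_nonneg (sub_nonneg.2 h2), abs_of_nonneg (sub_nonneg.2 hst)]
    linarith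
  refine continuousOn_of_norm_sub_le (K := L * (1 + R)) (by positivity) fun s hs t ht => ?_
  rw [Real.norm_eq_abs]
  rcases le_total s t with hst | hst
  · exact key s t hs.1 hst ht.2
  · rw [abs_sub_comm, abs_sub_comm t]
    exact key t s ht.1 hst hs.2

theorem GrowthLip.runSup_le_gronwall {L s₀ : ℝ} {x : Path d} (hL : 0 ≤ L)
    (h : GrowthLip T d L s₀ x) (hx : x ∈ Cadlag T d) (hs₀ : 0 ≤ s₀) {t : ℝ} (ht : t ∈ Icc s₀ T) :
    runSup d x t ≤ (1 + runSup d x s₀) * Real.exp (L * T) := by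
  have hc := h.continuousOn_runSup hL hx hs₀
  have := le_gronwallBound_of_liminf_deriv_right_le (f := fun t => 1 + runSup d x t)
    (f' := fun t => L * (1 + runSup d x t)) (δ := 1 + runSup d x s₀) (K := L) (ε := 0) (a := s₀)
    (b := T) (hc.const_add 1) ?_ le_rfl (fun _ _ => by simp) t ht
  · rw [gronwallBound_ε0] at this
    have h1 : Real.exp (L * (t - s₀)) ≤ Real.exp (L * T) :=
      Real.exp_le_exp.2 (mul_le_mul_of_nonneg_left (by linarith [ht.2]) hL)
    have h2 : (1 + runSup d x s₀) * Real.exp (L * (t - s₀)) ≤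
        (1 + runSup d x s₀) * Real.exp (L * T) :=
      mul_le_mul_of_nonneg_left h1 (by linarith [runSup_nonneg x s₀])
    linarith
  · intro s hs r hr
    refine Eventually.frequently ?_
    have hcs : ContinuousWithinAt (fun t => L * (1 + runSup d x t)) (Ioi s) s := by
      refine ((continuousOn_const.mul (hc.const_add 1)) s ⟨hs.1, hs.2.le⟩).mono_of_mem_nhdsWithin ?_
      filter_upwards [self_mem_nhdsWithin, mem_nhdsWithin_of_mem_nhds (Iio_mem_nhds hs.2)]
        with q hq hq'
      exact ⟨hs.1.trans (le_of_lt hq), le_of_lt hq'⟩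
    filter_upwards [hcs.eventually (gt_mem_nhds hr), self_mem_nhdsWithin,
      mem_nhdsWithin_of_mem_nhds (Iio_mem_nhds hs.2)] with q hq hsq hqT
    have hpos : 0 < q - s := sub_pos.2 hsq
    have h1 := h.runSup_le_add hL hx hs₀ hs.1 (le_of_lt hsq) (le_of_lt hqT)
    refine lt_of_le_of_lt ?_ hq
    rw [inv_mul_le_iff₀ hpos]
    linarith

end

section

variable {T : ℝ} {d : ℕ}

/-! ### Lipschitz functions and their derivatives -/

/-- The projection of `ℝ` onto `[a, b]`. -/
def clamp (a b t : ℝ) : ℝ := max a (min b t)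

theorem clamp_mem {a b : ℝ} (hab : a ≤ b) (t : ℝ) : clamp a b t ∈ Icc a b :=
  ⟨le_max_left _ _, max_le hab (min_le_left _ _)⟩

theorem clamp_of_mem {a b t : ℝ} (ht : t ∈ Icc a b) : clamp a b t = t := by
  simp [clamp, ht.1, ht.2]

theorem abs_clamp_sub_clamp_le (a b s t : ℝ) : |clamp a b t - clamp a b s| ≤ |t - s| := by
  have h1 := abs_max_sub_max_le_abs (min b t) (min b s) a
  have h2 := abs_min_sub_min_le_max b t b s
  simp only [sub_self, abs_zero, abs_nonneg, max_eq_right] at h2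
  rw [max_comm, max_comm _ a] at h1
  exact h1.trans h2

theorem continuous_clamp (a b : ℝ) : Continuous (clamp a b) := by
  unfold clamp
  fun_prop

theorem lipschitzWith_comp_clamp {F : Type*} [NormedAddCommGroup F] {f : ℝ → F} {a b K : ℝ}
    (hab : a ≤ b) (hK : 0 ≤ K)
    (hf : ∀ s ∈ Icc a b, ∀ t ∈ Icc a b, ‖f t - f s‖ ≤ K * |t - s|) :
    LipschitzWith K.toNNReal (fun t => f (clamp a b t)) :=
  LipschitzWith.of_dist_le_mul fun x y => by
    rw [Real.coe_toNNReal _ hK, dist_eq_norm, Real.dist_eq]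
    exact (hf _ (clamp_mem hab y) _ (clamp_mem hab x)).trans
      (mul_le_mul_of_nonneg_left (abs_clamp_sub_clamp_le _ _ _ _) hK)

theorem exists_deriv_of_norm_sub_le {f : Path d} {a b K : ℝ} (hab : a ≤ b) (hK : 0 ≤ K)
    (hf : ∀ s ∈ Icc a b, ∀ t ∈ Icc a b, ‖f t - f s‖ ≤ K * |t - s|) :
    ∃ g : Path d, IntegrableOn g (Icc a b) volume ∧
      (∀ t ∈ Icc a b, f t = f a + ∫ s in a..t, g s) ∧
      ∀ᵐ s ∂(volume.restrict (Ioo a b)), HasDerivAt f (g s) s := by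
  set F : Path d := fun t => f (clamp a b t) with hF
  have hLip : LipschitzWith K.toNNReal F := lipschitzWith_comp_clamp hab hK hf
  have hdiff : ∀ᵐ s, DifferentiableAt ℝ F s := hLip.ae_differentiableAt_real
  have hfint : ∀ t, IntegrableOn (deriv F) (Icc a t) volume := by
    intro t
    refine Measure.integrableOn_of_bounded (M := K) (by simp)
      (stronglyMeasurable_deriv F).aestronglyMeasurable (Eventually.of_forall fun s => ?_)
    have := norm_deriv_le_of_lipschitz (x₀ := s) hLip
    rwa [Real.coe_toNNReal _ hK] at this
  refine ⟨deriv F, hfint b, fun t ht => ?_, ?_⟩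
  · have hII : IntervalIntegrable (deriv F) volume a t :=
      (intervalIntegrable_iff_integrableOn_Icc_of_le ht.1).2 (hfint t)
    have h1 : ∀ i, (∫ s in a..t, deriv F s) i = F t i - F a i := by
      intro i
      have e1 := (EuclideanSpace.proj (ι := Fin d) (𝕜 := ℝ)
        i).intervalIntegral_comp_comm hII
      simp only [EuclideanSpace.coe_proj] at e1
      rw [← e1]
      have hLi : LipschitzOnWith K.toNNReal (fun s => F s i) (uIcc a t) :=
        LipschitzOnWith.of_dist_le_mul fun x _ y _ =>
          le_trans (by simpa [dist_eq_norm] using PiLp.norm_apply_le (F x - F y) i)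
            (hLip.dist_le_mul x y)
      rw [← hLi.absolutelyContinuousOnInterval.integral_deriv_eq_sub]
      refine intervalIntegral.integral_congr_ae ?_
      filter_upwards [hdiff] with s hs _
      have := (EuclideanSpace.proj (ι := Fin d) (𝕜 := ℝ) i).hasFDerivAt.comp_hasDerivAt
        s hs.hasDerivAt
      exact this.deriv.symm
    have h2 : ∫ s in a..t, deriv F s = F t - F a := by
      ext i
      simp [h1]
    rw [h2, hF]
    simp only [clamp_of_mem ht, clamp_of_mem (left_mem_Icc.2 hab)]
    abel
  · filter_upwards [ae_restrict_of_ae hdiff, ae_restrict_mem measurableSet_Ioo] with s hs hmem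
    refine hs.hasDerivAt.congr_of_eventuallyEq ?_
    filter_upwards [Icc_mem_nhds hmem.1 hmem.2] with r hr
    simp [hF, clamp_of_mem hr]

theorem GrowthLip.exists_xDeriv {L s₀ : ℝ} {x : Path d} (hL : 0 ≤ L) (h : GrowthLip T d L s₀ x)
    (hx : x ∈ Cadlag T d) (hs₀ : 0 ≤ s₀) (hsT : s₀ ≤ T) : ∃ g, XDeriv T d L s₀ x g := by
  obtain ⟨R, hR0, hR⟩ := exists_runSup_le hx
  obtain ⟨g, hg1, hg2, hg3⟩ := exists_deriv_of_norm_sub_le hsT (K := L * (1 + R)) (by positivity)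
    fun s hs t ht => h.norm_sub_le hL hR hs ht
  refine ⟨g, hg1, hg2, ?_⟩
  filter_upwards [hg3, ae_restrict_mem measurableSet_Ioo] with s hs hmem
  have h1 := (hs.tendsto_slope.mono_left (nhdsGT_le_nhdsNE s)).norm
  have h2 : Tendsto (fun t => L * (1 + runSup d x t)) (𝓝[>] s) (𝓝 (L * (1 + runSup d x s))) := by
    have hc := h.continuousOn_runSup hL hx hs₀
    refine ((continuousOn_const.mul (hc.const_add 1)) s ⟨hmem.1.le, hmem.2.le⟩).mono_left ?_
    refine nhdsWithin_le_of_mem ?_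
    filter_upwards [self_mem_nhdsWithin, mem_nhdsWithin_of_mem_nhds (Iio_mem_nhds hmem.2)]
      with q hq hq'
    exact ⟨hmem.1.le.trans (le_of_lt hq), le_of_lt hq'⟩
  refine le_of_tendsto_of_tendsto h1 h2 ?_
  filter_upwards [self_mem_nhdsWithin, mem_nhdsWithin_of_mem_nhds (Iio_mem_nhds hmem.2)]
    with q hq hq'
  have hpos : 0 < q - s := sub_pos.2 hq
  rw [slope_def_module, norm_smul, norm_inv, Real.norm_of_nonneg hpos.le, inv_mul_le_iff₀ hpos,
    mul_comm]
  exact h s q hmem.1.le (le_of_lt hq) (le_of_lt hq')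

theorem XDeriv.growthLip {L s₀ : ℝ} {x g : Path d} (hL : 0 ≤ L) (h : XDeriv T d L s₀ x g)
    (hx : x ∈ Cadlag T d) : GrowthLip T d L s₀ x := by
  intro s t hs hst ht
  have hsub : ∀ q ∈ Icc s₀ T, IntervalIntegrable g volume s₀ q := fun q hq =>
    (intervalIntegrable_iff_integrableOn_Icc_of_le hq.1).2
      (h.1.mono_set (Icc_subset_Icc_right hq.2))
  have hs' : s ∈ Icc s₀ T := ⟨hs, hst.trans ht⟩
  have ht' : t ∈ Icc s₀ T := ⟨hs.trans hst, ht⟩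
  have e : x t - x s = ∫ r in s..t, g r := by
    rw [h.2.1 t ht', h.2.1 s hs', add_sub_add_left_eq_sub,
      intervalIntegral.integral_interval_sub_left (hsub t ht') (hsub s hs')]
  rw [e]
  refine (intervalIntegral.norm_integral_le_of_norm_le_const_ae
    (C := L * (1 + runSup d x t)) ?_).trans_eq (by rw [abs_of_nonneg (sub_nonneg.2 hst)])
  have h3 := h.2.2
  rw [ae_restrict_iff' measurableSet_Ioo] at h3
  filter_upwards [h3, (Set.countable_singleton t).ae_notMem volume] with r hr hrt hmem
  rw [uIoc_of_le hst] at hmem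
  have hlt : r < t := lt_of_le_of_ne hmem.2 hrt
  refine (hr ⟨hs.trans_lt hmem.1, hlt.trans_le ht⟩).trans ?_
  have := runSup_mono hx hmem.2 ht
  gcongr

theorem mem_XSet_iff {L s₀ : ℝ} {x x₀ : Path d} (hL : 0 ≤ L) (hs₀ : 0 ≤ s₀) (hsT : s₀ ≤ T) :
    x ∈ XSet T d L s₀ x₀ ↔
      x ∈ Cadlag T d ∧ (∀ t ∈ Icc 0 s₀, x t = x₀ t) ∧ GrowthLip T d L s₀ x := by
  constructor
  · rintro ⟨h1, h2, g, hg⟩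
    exact ⟨h1, h2, hg.growthLip hL h1⟩
  · rintro ⟨h1, h2, h3⟩
    exact ⟨h1, h2, h3.exists_xDeriv hL h1 hs₀ hsT⟩

end

section

variable {T : ℝ} {d : ℕ}

/-! ### The standing assumptions and the equation for the second component -/

/-- The standing assumptions on the Hamiltonian. -/
structure HamHyp (T : ℝ) (d : ℕ) (H : Ham d) (LH CH : ℝ) (M : ℝ → ℝ) : Prop where
  pos : 0 < T
  cont : HamCont T d H
  meas : HamMeas d H
  lipZ : HamLipZ T d H LH
  lipX : HamLipX T d H M
  mono : HamMono T d H
  bound : HamBound T d H CH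

variable {H : Ham d} {LH CH : ℝ} {M : ℝ → ℝ}

theorem ae_Ioo_mono {P : ℝ → Prop} {a b a' b' : ℝ} (h : ∀ᵐ s ∂(volume.restrict (Ioo a b)), P s)
    (ha : a ≤ a') (hb : b' ≤ b) : ∀ᵐ s ∂(volume.restrict (Ioo a' b')), P s :=
  ae_restrict_of_ae_restrict_of_subset (Ioo_subset_Ioo ha hb) h

theorem ae_Ioc_of_ae_Ioo {P : ℝ → Prop} {a b a' b' : ℝ}
    (h : ∀ᵐ s ∂(volume.restrict (Ioo a b)), P s) (ha : a ≤ a') (hb : b' ≤ b) :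
    ∀ᵐ s, s ∈ Ioc a' b' → P s := by
  rw [← ae_restrict_iff' measurableSet_Ioc, ← Measure.restrict_congr_set Ioo_ae_eq_Ioc]
  exact ae_Ioo_mono h ha hb

theorem HamHyp.abs_le (hH : HamHyp T d H LH CH M) :
    ∀ᵐ t ∂(volume.restrict (Ioo 0 T)), ∀ x ∈ Cadlag T d, ∀ (y : ℝ) (z : E d),
      |H t x y z| ≤ CH * (1 + runSup d x t + |y|) + LH * (1 + runSup d x t) * ‖z‖ := by
  filter_upwards [hH.lipZ.2, hH.bound.2] with t h1 h2 x hx y z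
  have h3 := h1 x hx y z 0
  rw [sub_zero] at h3
  have h4 := h2 x hx y
  have h5 := abs_sub_abs_le_abs_sub (H t x y z) (H t x y 0)
  linarith

theorem HamHyp.continuous_y (hH : HamHyp T d H LH CH M) :
    ∀ᵐ t ∂(volume.restrict (Ioo 0 T)), ∀ x ∈ Cadlag T d, ∀ (z : E d),
      Continuous fun y => H t x y z := by
  filter_upwards [hH.cont] with t h x hx z
  refine Metric.continuous_iff.2 fun y ε hε => ?_
  obtain ⟨δ, hδ, hδ'⟩ := h x hx y z ε hε
  refine ⟨δ, hδ, fun y' hy' => ?_⟩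
  rw [dist_comm, Real.dist_eq] at hy' ⊢
  refine hδ' x hx y' z ?_ hy' (by simpa using hδ)
  exact (supDist_le le_rfl (by simp)).trans_lt hδ

theorem HamHyp.aestronglyMeasurable (hH : HamHyp T d H LH CH M) {x : Path d} (hx : x ∈ Cadlag T d)
    {a b : ℝ} (ha : 0 ≤ a) (hb : b ≤ T) {v : ℝ → ℝ} (hv : ContinuousOn v (Icc a b)) (z : E d) :
    AEStronglyMeasurable (fun s => H s x (v s) z) (volume.restrict (Ioo a b)) := by
  rcases le_or_gt a b with hab | hab
  swap
  · simp [Ioo_eq_empty (not_lt.2 hab.le)]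
  have hc := ae_Ioo_mono hH.continuous_y ha hb
  obtain ⟨N, hN, hNm, hN0⟩ := exists_measurable_superset_of_null (ae_iff.1 hc)
  let G : ℝ → ℝ → ℝ := fun y => Nᶜ.indicator (fun t => H t x y z)
  have hG : StronglyMeasurable (Function.uncurry G) := by
    refine stronglyMeasurable_uncurry_of_continuous_of_stronglyMeasurable (fun t => ?_) fun y => ?_
    · by_cases ht : t ∈ N
      · simp [G, ht, continuous_const]
      · have : ∀ x ∈ Cadlag T d, ∀ (z : E d), Continuous fun y => H t x y z := by
          by_contra hcon
          exact ht (hN hcon)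
        simpa [G, ht] using this x hx z
    · exact ((hH.meas x y z).indicator hNm.compl).stronglyMeasurable
  have hv' : Continuous fun s => v (clamp a b s) :=
    hv.comp_continuous (continuous_clamp a b) (clamp_mem hab)
  have hm : Measurable fun s => (v (clamp a b s), s) := (hv'.prodMk continuous_id).measurable
  refine ⟨fun s => G (v (clamp a b s)) s, hG.comp_measurable hm, ?_⟩
  have hN' : ∀ᵐ s ∂(volume.restrict (Ioo a b)), s ∉ N := measure_eq_zero_iff_ae_notMem.1 hN0
  filter_upwards [hN', ae_restrict_mem measurableSet_Ioo] with s hs hmem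
  simp [G, hs, clamp_of_mem (Ioo_subset_Icc_self hmem)]

theorem HamHyp.integrableOn (hH : HamHyp T d H LH CH M) {x : Path d} (hx : x ∈ Cadlag T d)
    {a b : ℝ} (ha : 0 ≤ a) (hb : b ≤ T) {v : ℝ → ℝ} (hv : ContinuousOn v (Icc a b)) (z : E d) :
    IntegrableOn (fun s => H s x (v s) z) (Icc a b) volume := by
  rw [integrableOn_Icc_iff_integrableOn_Ioo]
  obtain ⟨B, hB⟩ := isCompact_Icc.exists_bound_of_continuousOn hv
  obtain ⟨R, hR0, hR⟩ := exists_runSup_le hx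
  refine Integrable.of_bound (hH.aestronglyMeasurable hx ha hb hv z)
    (CH * (1 + R + B) + LH * (1 + R) * ‖z‖) ?_
  filter_upwards [ae_Ioo_mono hH.abs_le ha hb, ae_restrict_mem measurableSet_Ioo] with s hs hmem
  refine (hs x hx _ _).trans ?_
  have h1 := hR s (hmem.2.le.trans hb)
  have h2 := hB s (Ioo_subset_Icc_self hmem)
  rw [Real.norm_eq_abs] at h2
  have := hH.lipZ.1
  have := hH.bound.1
  gcongr

/-- Characteristic pairs, described without reference to the derivative of `x`. -/
structure IsChar (T : ℝ) (d : ℕ) (H : Ham d) (LH s₀ : ℝ) (x₀ : Path d) (y₀ : ℝ) (z : E d)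
    (x : Path d) (y : ℝ → ℝ) : Prop where
  cadlag : x ∈ Cadlag T d
  init : ∀ t ∈ Icc 0 s₀, x t = x₀ t
  growth : GrowthLip T d LH s₀ x
  cont : ContinuousOn y (Icc s₀ T)
  eq : ∀ t ∈ Icc s₀ T, y t = y₀ + ⟪x t - x s₀, z⟫_ℝ - ∫ s in s₀..t, H s x (y s) z

theorem intervalIntegrable_of_Icc {f : ℝ → ℝ} {a b s t : ℝ} (hf : IntegrableOn f (Icc a b) volume)
    (hs : s ∈ Icc a b) (ht : t ∈ Icc a b) : IntervalIntegrable f volume s t := by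
  refine (intervalIntegrable_iff).2 (hf.mono_set ?_)
  exact uIoc_subset_uIcc.trans (uIcc_subset_Icc hs ht)

theorem mem_YSet_iff (hH : HamHyp T d H LH CH M) {s₀ y₀ : ℝ} (hs₀ : s₀ ∈ Icc 0 T) {x₀ : Path d}
    {z : E d} {p : Path d × (ℝ → ℝ)} :
    p ∈ YSet T d H LH s₀ x₀ y₀ z ↔ IsChar T d H LH s₀ x₀ y₀ z p.1 p.2 := by
  have key : ∀ {g : Path d}, p.1 ∈ Cadlag T d → ContinuousOn p.2 (Icc s₀ T) →
      XDeriv T d LH s₀ p.1 g →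
      IntegrableOn (fun s => ⟪g s, z⟫_ℝ - H s p.1 (p.2 s) z) (Icc s₀ T) volume ∧
      ∀ t ∈ Icc s₀ T, y₀ + ∫ s in s₀..t, (⟪g s, z⟫_ℝ - H s p.1 (p.2 s) z) =
        y₀ + ⟪p.1 t - p.1 s₀, z⟫_ℝ - ∫ s in s₀..t, H s p.1 (p.2 s) z := by
    intro g hx hy hg
    have i1 := hH.integrableOn hx hs₀.1 le_rfl hy z
    have i2 : IntegrableOn (fun s => ⟪g s, z⟫_ℝ) (Icc s₀ T) volume := Integrable.inner_const hg.1 z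
    refine ⟨i2.sub i1, fun t ht => ?_⟩
    have hl := left_mem_Icc.2 hs₀.2
    rw [intervalIntegral.integral_sub (intervalIntegrable_of_Icc i2 hl ht)
      (intervalIntegrable_of_Icc i1 hl ht), ← add_sub_assoc]
    congr 2
    have hgi : IntervalIntegrable g volume s₀ t :=
      (intervalIntegrable_iff_integrableOn_Icc_of_le ht.1).2
        (hg.1.mono_set (Icc_subset_Icc_right ht.2))
    have e := (innerSL ℝ z).intervalIntegral_comp_comm hgi
    simp only [innerSL_apply_apply] at e
    rw [hg.2.1 t ht, add_sub_cancel_left, real_inner_comm, ← e]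
    simp only [real_inner_comm]
  constructor
  · rintro ⟨h1, h2, h3, g, hg, -, hy⟩
    exact ⟨h1, h2, hg.growthLip hH.lipZ.1 h1, h3, fun t ht => by
      rw [hy t ht, (key h1 h3 hg).2 t ht]⟩
  · intro h
    obtain ⟨g, hg⟩ := h.growth.exists_xDeriv hH.lipZ.1 h.cadlag hs₀.1 hs₀.2
    obtain ⟨k1, k2⟩ := key h.cadlag h.cont hg
    exact ⟨h.cadlag, h.init, h.cont, g, hg, k1, fun t ht => by rw [h.eq t ht, k2 t ht]⟩

/-! ### Integral Gronwall estimates -/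

theorem le_exp_of_le_integral {φ : ℝ → ℝ} {a b c C T : ℝ} (hφ : ContinuousOn φ (Icc a b))
    (hc : 0 ≤ c) (hC : 0 ≤ C) (hT : b - a ≤ T)
    (h : ∀ t ∈ Icc a b, φ t ≤ c + C * ∫ s in a..t, φ s) {t : ℝ} (ht : t ∈ Icc a b) :
    φ t ≤ c * Real.exp (C * T) := by
  have hab := ht.1.trans ht.2
  set ψ : ℝ → ℝ := fun s => φ (clamp a b s) with hψ
  have hψc : Continuous ψ := hφ.comp_continuous (continuous_clamp a b) (clamp_mem hab)
  have hfint : ∀ t ∈ Icc a b, ∫ s in a..t, φ s = ∫ s in a..t, ψ s := by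
    intro t ht
    refine intervalIntegral.integral_congr fun s hs => ?_
    rw [uIcc_of_le ht.1] at hs
    simp only [hψ, clamp_of_mem ⟨hs.1, hs.2.trans ht.2⟩]
  have hd : ∀ s, HasDerivAt (fun t => c + C * ∫ s in a..t, ψ s) (C * ψ s) s := fun s =>
    ((hψc.integral_hasStrictDerivAt a s).hasDerivAt.const_mul C).const_add c
  have hg := le_gronwallBound_of_liminf_deriv_right_le (a := a) (b := b)
    (f := fun t => c + C * ∫ s in a..t, ψ s)
    (f' := fun s => C * ψ s) (δ := c) (K := C) (ε := 0)
    (fun s _ => (hd s).continuousAt.continuousWithinAt)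
    (fun s _ r hr => (hd s).hasDerivWithinAt.liminf_right_slope_le hr) (by simp)
    (fun s hs => by
      have hs' := Ico_subset_Icc_self hs
      have := h s hs'
      rw [hfint s hs'] at this
      simp only [hψ, clamp_of_mem hs'] at this ⊢
      rw [add_zero]
      exact mul_le_mul_of_nonneg_left this hC) t ht
  rw [gronwallBound_ε0] at hg
  refine (h t ht).trans ?_
  rw [hfint t ht]
  refine hg.trans (mul_le_mul_of_nonneg_left (Real.exp_le_exp.2 ?_) hc)
  exact mul_le_mul_of_nonneg_left (by linarith [ht.2]) hC

theorem abs_le_exp_of_increment_le {y : ℝ → ℝ} {a b c C T : ℝ} (hy : ContinuousOn y (Icc a b))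
    (hc : 0 ≤ c) (hC : 0 ≤ C) (hT : b - a ≤ T)
    (h : ∀ s t, a ≤ s → s ≤ t → t ≤ b → |y t - y s| ≤ c + C * ∫ r in s..t, |y r|) {t : ℝ}
    (ht : t ∈ Icc a b) :
    |y t| ≤ (|y a| + c) * Real.exp (C * T) ∧ |y t| ≤ (|y b| + c) * Real.exp (C * T) := by
  constructor
  · refine le_exp_of_le_integral hy.abs (by positivity) hC hT (fun s hs => ?_) ht
    have h1 := h a s le_rfl hs.1 hs.2
    have h2 := abs_sub_abs_le_abs_sub (y s) (y a)
    linarith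
  · have hmaps : MapsTo (fun r => b - r) (Icc 0 (b - a)) (Icc a b) := fun r hr =>
      ⟨by linarith [hr.2], by linarith [hr.1]⟩
    have := le_exp_of_le_integral (φ := fun r => |y (b - r)|) (a := 0) (b := b - a) (c := |y b| + c)
      (C := C) (T := T) (hy.abs.comp (by fun_prop) hmaps) (by positivity) hC (by linarith)
      (fun s hs => by
        have h1 := h (b - s) b (hmaps hs).1 (by linarith [hs.1]) le_rfl
        have h2 := abs_sub_abs_le_abs_sub (y (b - s)) (y b)
        rw [abs_sub_comm] at h2
        have h3 := intervalIntegral.integral_comp_sub_left (a := 0) (b := s) (fun r => |y r|) b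
        rw [sub_zero] at h3
        rw [h3]
        linarith) (t := b - t) ⟨by linarith [ht.2], by linarith [ht.1]⟩
    simpa using this

theorem abs_increment_le {x : Path d} {y a : ℝ → ℝ} {y₀ s₀ τ R A C : ℝ} {z : E d}
    (hR : ∀ t ∈ Icc s₀ τ, ‖x t‖ ≤ R) (hτ : τ - s₀ ≤ T) (hA : 0 ≤ A)
    (hy : ContinuousOn y (Icc s₀ τ)) (ha : IntegrableOn a (Icc s₀ τ) volume)
    (hab : ∀ᵐ s ∂(volume.restrict (Ioo s₀ τ)), |a s| ≤ A + C * |y s|)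
    (heq : ∀ t ∈ Icc s₀ τ, y t = y₀ + ⟪x t - x s₀, z⟫_ℝ - ∫ s in s₀..t, a s) {s t : ℝ}
    (hs : s₀ ≤ s) (hst : s ≤ t) (ht : t ≤ τ) :
    |y t - y s| ≤ (2 * R * ‖z‖ + A * T) + C * ∫ r in s..t, |y r| := by
  have hs' : s ∈ Icc s₀ τ := ⟨hs, hst.trans ht⟩
  have ht' : t ∈ Icc s₀ τ := ⟨hs.trans hst, ht⟩
  have hl : s₀ ∈ Icc s₀ τ := ⟨le_rfl, hs.trans (hst.trans ht)⟩
  have e : y t - y s = ⟪x t - x s, z⟫_ℝ - ∫ r in s..t, a r := by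
    rw [heq t ht', heq s hs', ← intervalIntegral.integral_interval_sub_left
      (intervalIntegrable_of_Icc ha hl ht') (intervalIntegrable_of_Icc ha hl hs')]
    have : x t - x s = (x t - x s₀) - (x s - x s₀) := by abel
    rw [this, inner_sub_left (x t - x s₀) (x s - x s₀)]
    ring
  have h1 : |⟪x t - x s, z⟫_ℝ| ≤ 2 * R * ‖z‖ := by
    refine (abs_real_inner_le_norm _ _).trans (mul_le_mul_of_nonneg_right ?_ (norm_nonneg _))
    have := norm_sub_le (x t) (x s)
    linarith [hR t ht', hR s hs']
  have hyi : IntervalIntegrable (fun r => |y r|) volume s t :=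
    intervalIntegrable_of_Icc hy.abs.integrableOn_Icc hs' ht'
  have h2 : |∫ r in s..t, a r| ≤ ∫ r in s..t, (A + C * |y r|) := by
    rw [← Real.norm_eq_abs]
    refine intervalIntegral.norm_integral_le_of_norm_le hst (ae_Ioc_of_ae_Ioo hab hs ht) ?_
    exact (intervalIntegrable_const).add (hyi.const_mul C)
  rw [intervalIntegral.integral_add intervalIntegrable_const (hyi.const_mul C),
    intervalIntegral.integral_const, intervalIntegral.integral_const_mul, smul_eq_mul] at h2
  have h3 : (t - s) * A ≤ A * T := by
    rw [mul_comm]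
    exact mul_le_mul_of_nonneg_left (by linarith) hA
  rw [e]
  have h4 := abs_sub (⟪x t - x s, z⟫_ℝ) (∫ r in s..t, a r)
  linarith

end

section

variable {T : ℝ} {d : ℕ} {H : Ham d} {LH CH : ℝ} {M : ℝ → ℝ}

/-! ### Non-anticipativity and concatenation -/

theorem HamHyp.ae_congr (hH : HamHyp T d H LH CH M) {t₀ τ : ℝ} (ht₀ : t₀ ∈ Ico 0 T) (hτ : τ ≤ T)
    {x x' : Path d} (hx : x ∈ Cadlag T d) (hx' : x' ∈ Cadlag T d)
    (hgx : GrowthLip T d LH t₀ x) (hgx' : GrowthLip T d LH t₀ x')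
    (h : ∀ t ∈ Icc 0 τ, x t = x' t) (z : E d) :
    ∀ᵐ s ∂(volume.restrict (Ioo t₀ τ)), ∀ y, H s x y z = H s x' y z := by
  rcases le_or_gt τ t₀ with hτ0 | hτ0
  · simp [Ioo_eq_empty (not_lt.2 hτ0)]
  have hL := hH.lipZ.1
  have m1 : x ∈ XSet T d LH t₀ x' := (mem_XSet_iff hL ht₀.1 ht₀.2.le).2
    ⟨hx, fun t ht => h t ⟨ht.1, ht.2.trans hτ0.le⟩, hgx⟩
  have m2 : x' ∈ XSet T d LH t₀ x' := (mem_XSet_iff hL ht₀.1 ht₀.2.le).2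
    ⟨hx', fun t _ => rfl, hgx'⟩
  have key : ∀ q : ℚ, ∀ᵐ s ∂(volume.restrict (Ioo t₀ τ)), H s x q z = H s x' q z := by
    intro q
    have := ae_Ioo_mono ((hH.lipX LH hL).2 t₀ ht₀ x' hx' x m1 x' m2 q z) le_rfl hτ
    filter_upwards [this, ae_restrict_mem measurableSet_Ioo] with s hs hmem
    have h0 : sSup ((fun r => ‖x r - x' r‖) '' Icc 0 s) ≤ 0 :=
      sSup_image_Icc_le le_rfl fun r hr => by simp [h r ⟨hr.1, hr.2.trans hmem.2.le⟩]
    have h1 : 0 ≤ M LH * (1 + |(q : ℝ)| + ‖z‖) := by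
      have := (hH.lipX LH hL).1
      positivity
    have h2 := hs.trans (mul_nonpos_of_nonneg_of_nonpos h1 h0)
    exact sub_eq_zero.1 (abs_nonpos_iff.1 h2)
  filter_upwards [ae_all_iff.2 key, ae_Ioo_mono hH.continuous_y ht₀.1 hτ] with s hs hc y
  exact congrFun (Continuous.ext_on Rat.denseRange_cast (hc x hx z) (hc x' hx' z)
    (by rintro _ ⟨q, rfl⟩; exact hs q)) y

theorem GrowthLip.concat {L t₀ τ : ℝ} {x x' : Path d} (hL : 0 ≤ L) (hx' : x' ∈ Cadlag T d)
    (h : ∀ t ∈ Icc 0 τ, x' t = x t) (ht₀ : 0 ≤ t₀) (hgx : GrowthLip T d L t₀ x)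
    (hgx' : GrowthLip T d L τ x') : GrowthLip T d L t₀ x' := by
  intro s t hs hst ht
  have hpre : ∀ s t, t₀ ≤ s → s ≤ t → t ≤ T → t ≤ τ →
      ‖x' t - x' s‖ ≤ L * (1 + runSup d x' t) * (t - s) := by
    intro s t hs hst ht htτ
    have h0 : 0 ≤ t := by linarith
    rw [h t ⟨h0, htτ⟩, h s ⟨by linarith, hst.trans htτ⟩,
      runSup_congr (y := x) fun r hr => h r ⟨hr.1, hr.2.trans htτ⟩]
    exact hgx s t hs hst ht
  rcases le_total t τ with htτ | htτ
  · exact hpre s t hs hst ht htτ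
  rcases le_total τ s with hsτ | hsτ
  · exact hgx' s t hsτ hst ht
  have h1 := hpre s τ hs hsτ (htτ.trans ht) le_rfl
  have h2 := hgx' τ t le_rfl htτ ht
  have h3 := runSup_mono hx' htτ ht
  have h4 : L * (1 + runSup d x' τ) * (τ - s) ≤ L * (1 + runSup d x' t) * (τ - s) := by
    have := sub_nonneg.2 hsτ
    gcongr
  have h5 := norm_sub_le_norm_sub_add_norm_sub (x' t) (x' τ) (x' s)
  linarith

theorem IsChar.left {s₀ y₀ : ℝ} {x₀ x : Path d} {y : ℝ → ℝ} {z : E d} (hs₀ : s₀ ≤ T)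
    (h : IsChar T d H LH s₀ x₀ y₀ z x y) : y s₀ = y₀ := by
  simpa using h.eq s₀ ⟨le_rfl, hs₀⟩

theorem IsChar.concat (hH : HamHyp T d H LH CH M) {t₀ τ y₀ : ℝ} {x₀ x x' : Path d} {y y' : ℝ → ℝ}
    {z : E d} (ht₀ : t₀ ∈ Ico 0 T) (hτ : τ ∈ Icc t₀ T) (h : IsChar T d H LH t₀ x₀ y₀ z x y)
    (h' : IsChar T d H LH τ x (y τ) z x' y') :
    IsChar T d H LH t₀ x₀ y₀ z x' (fun t => if t ≤ τ then y t else y' t) := by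
  set w : ℝ → ℝ := fun t => if t ≤ τ then y t else y' t with hw
  have hw1 : ∀ t ≤ τ, w t = y t := fun t ht => by simp [hw, ht]
  have hw2 : ∀ t, τ ≤ t → w t = y' t := fun t ht => by
    rcases ht.eq_or_lt with rfl | ht
    · rw [hw1 _ le_rfl, h'.left hτ.2]
    · simp [hw, not_le.2 ht]
  have hg := GrowthLip.concat hH.lipZ.1 h'.cadlag h'.init ht₀.1 h.growth h'.growth
  have hwc : ContinuousOn w (Icc t₀ T) := by
    rw [← Icc_union_Icc_eq_Icc hτ.1 hτ.2]
    exact ((h.cont.mono (Icc_subset_Icc_right hτ.2)).congr fun t ht => hw1 t ht.2).union_of_isClosed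
      (h'.cont.congr fun t ht => hw2 t ht.1) isClosed_Icc isClosed_Icc
  have e1 : ∀ t ∈ Icc t₀ τ, w t = y₀ + ⟪x' t - x' t₀, z⟫_ℝ - ∫ s in t₀..t, H s x' (w s) z := by
    intro t ht
    rw [hw1 t ht.2, h.eq t ⟨ht.1, ht.2.trans hτ.2⟩, h'.init t ⟨ht₀.1.trans ht.1, ht.2⟩,
      h'.init t₀ ⟨ht₀.1, hτ.1⟩]
    congr 1
    refine intervalIntegral.integral_congr_ae ?_
    rw [uIoc_of_le ht.1]
    have := ae_Ioc_of_ae_Ioo (hH.ae_congr ht₀ hτ.2 h'.cadlag h.cadlag hg h.growth h'.init z)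
      le_rfl ht.2
    filter_upwards [this] with s hs hs'
    rw [hs hs', hw1 s (hs'.2.trans ht.2)]
  have hfint := hH.integrableOn h'.cadlag ht₀.1 le_rfl hwc z
  refine ⟨h'.cadlag, fun t ht => ?_, hg, hwc, fun t ht => ?_⟩
  · rw [h'.init t ⟨ht.1, ht.2.trans hτ.1⟩, h.init t ht]
  · rcases le_total t τ with htτ | htτ
    · exact e1 t ⟨ht.1, htτ⟩
    · have e2 := h'.eq t ⟨htτ, ht.2⟩
      rw [← hw1 τ le_rfl, e1 τ ⟨hτ.1, le_rfl⟩] at e2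
      have e3 : ∫ s in τ..t, H s x' (y' s) z = ∫ s in τ..t, H s x' (w s) z :=
        intervalIntegral.integral_congr fun s hs => by
          rw [uIcc_of_le htτ] at hs
          simp only [hw2 s hs.1]
      have e4 := intervalIntegral.integral_add_adjacent_intervals
        (intervalIntegrable_of_Icc hfint (left_mem_Icc.2 (ht.1.trans ht.2)) hτ)
        (intervalIntegrable_of_Icc hfint hτ ht)
      rw [hw2 t htτ, e2, e3, ← e4]
      have : x' t - x' t₀ = (x' τ - x' t₀) + (x' t - x' τ) := by abel
      rw [this, inner_add_left]
      ring

end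

section

variable {T : ℝ} {d : ℕ} {H : Ham d} {LH CH : ℝ} {M : ℝ → ℝ}

/-! ### Comparison of characteristics with different initial values -/

/-- The Picard operator of the equation for the second component. -/
def picard (d : ℕ) (H : Ham d) (t₀ r : ℝ) (x : Path d) (z : E d) (v : ℝ → ℝ) (t : ℝ) : ℝ :=
  r + ⟪x t - x t₀, z⟫_ℝ - ∫ s in t₀..t, H s x (v s) z

theorem HamHyp.affine_bound (hH : HamHyp T d H LH CH M) {x : Path d} (hx : x ∈ Cadlag T d)
    {R : ℝ} (hR : ∀ t ≤ T, runSup d x t ≤ R) (z : E d) :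
    ∀ᵐ s ∂(volume.restrict (Ioo 0 T)), ∀ y,
      |H s x y z| ≤ (CH * (1 + R) + LH * (1 + R) * ‖z‖) + CH * |y| := by
  have h1 := hH.lipZ.1
  have h2 := hH.bound.1
  filter_upwards [hH.abs_le, ae_restrict_mem measurableSet_Ioo] with s hs hmem y
  have h3 := hR s hmem.2.le
  calc |H s x y z| ≤ CH * (1 + runSup d x s + |y|) + LH * (1 + runSup d x s) * ‖z‖ := hs x hx y z
    _ ≤ CH * (1 + R + |y|) + LH * (1 + R) * ‖z‖ := by gcongr
    _ = _ := by ring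

theorem HamHyp.exists_affine_bound (hH : HamHyp T d H LH CH M) {x : Path d} (hx : x ∈ Cadlag T d)
    (z : E d) : ∃ K, 0 ≤ K ∧
      ∀ᵐ s ∂(volume.restrict (Ioo 0 T)), ∀ y, |H s x y z| ≤ K + CH * |y| := by
  obtain ⟨R, hR0, hR⟩ := exists_runSup_le hx
  have h1 := hH.lipZ.1
  have h2 := hH.bound.1
  exact ⟨CH * (1 + R) + LH * (1 + R) * ‖z‖, by positivity, hH.affine_bound hx hR z⟩

theorem continuousOn_sub_primitive {x : Path d} {f : ℝ → ℝ} {t₀ r : ℝ} {z : E d} (ht₀ : t₀ ≤ T)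
    (hx : ContinuousOn x (Icc t₀ T)) (hf : IntegrableOn f (Icc t₀ T) volume) :
    ContinuousOn (fun t => r + ⟪x t - x t₀, z⟫_ℝ - ∫ s in t₀..t, f s) (Icc t₀ T) := by
  refine ContinuousOn.sub ?_ ?_
  · exact continuousOn_const.add ((hx.sub continuousOn_const).inner continuousOn_const)
  · have := intervalIntegral.continuousOn_primitive_interval (a := t₀) (b := T) (f := f)
      (μ := volume) (by rwa [uIcc_of_le ht₀])
    rwa [uIcc_of_le ht₀] at this

theorem picard_le_picard (hH : HamHyp T d H LH CH M) {t₀ r r' : ℝ} (ht₀ : 0 ≤ t₀) {x : Path d}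
    (hx : x ∈ Cadlag T d) (z : E d) {v w : ℝ → ℝ} (hr : r ≤ r') (hv : ContinuousOn v (Icc t₀ T))
    (hw : ContinuousOn w (Icc t₀ T)) (hvw : ∀ t ∈ Icc t₀ T, v t ≤ w t) {t : ℝ}
    (ht : t ∈ Icc t₀ T) : picard d H t₀ r x z v t ≤ picard d H t₀ r' x z w t := by
  have hl : t₀ ∈ Icc t₀ T := left_mem_Icc.2 (ht.1.trans ht.2)
  have : ∫ s in t₀..t, H s x (w s) z ≤ ∫ s in t₀..t, H s x (v s) z := by
    refine intervalIntegral.integral_mono_ae_restrict ht.1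
      (intervalIntegrable_of_Icc (hH.integrableOn hx ht₀ le_rfl hw z) hl ht)
      (intervalIntegrable_of_Icc (hH.integrableOn hx ht₀ le_rfl hv z) hl ht) ?_
    rw [← Measure.restrict_congr_set Ioo_ae_eq_Icc]
    filter_upwards [ae_Ioo_mono hH.mono ht₀ ht.2, ae_restrict_mem measurableSet_Ioo] with s hs hmem
    exact hs x hx z _ _ (hvw s ⟨hmem.1.le, hmem.2.le.trans ht.2⟩)
  unfold picard
  linarith

theorem picard_bound {t₀ r K C B Q : ℝ} (hC : 0 ≤ C) (hK : 0 ≤ K) {x : Path d} {z : E d}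
    {v : ℝ → ℝ} (hQ : ∀ t ∈ Icc t₀ T, |⟪x t - x t₀, z⟫_ℝ| ≤ Q)
    (hB : |r| + Q + K * (T - t₀) ≤ B)
    (hb : ∀ᵐ s ∂(volume.restrict (Ioo t₀ T)), ∀ y, |H s x y z| ≤ K + C * |y|)
    (hv : ∀ t ∈ Icc t₀ T, |v t| ≤ B * Real.exp (C * (t - t₀))) {t : ℝ} (ht : t ∈ Icc t₀ T) :
    |picard d H t₀ r x z v t| ≤ B * Real.exp (C * (t - t₀)) := by
  have e : ∫ s in t₀..t, C * (B * Real.exp (C * (s - t₀))) =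
      B * Real.exp (C * (t - t₀)) - B * Real.exp (C * (t₀ - t₀)) := by
    refine intervalIntegral.integral_eq_sub_of_hasDerivAt
      (f := fun s => B * Real.exp (C * (s - t₀))) (fun s _ => ?_)
      (Continuous.intervalIntegrable (by fun_prop) _ _)
    have := ((((hasDerivAt_id s).sub_const t₀).const_mul C).exp).const_mul B
    refine this.congr_deriv ?_
    simp only [id]
    ring
  have h2 : |∫ s in t₀..t, H s x (v s) z| ≤
      ∫ s in t₀..t, (K + C * (B * Real.exp (C * (s - t₀)))) := by
    rw [← Real.norm_eq_abs]
    refine intervalIntegral.norm_integral_le_of_norm_le ht.1 ?_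
      (Continuous.intervalIntegrable (by fun_prop) _ _)
    filter_upwards [ae_Ioc_of_ae_Ioo hb le_rfl ht.2] with s hs hmem
    refine (hs hmem (v s)).trans ?_
    have := mul_le_mul_of_nonneg_left (hv s ⟨hmem.1.le, hmem.2.trans ht.2⟩) hC
    linarith
  rw [intervalIntegral.integral_add intervalIntegrable_const
    (Continuous.intervalIntegrable (by fun_prop) _ _), e, intervalIntegral.integral_const,
    smul_eq_mul, sub_self, mul_zero, Real.exp_zero, mul_one] at h2
  have h3 := hQ t ht
  have h4 : (t - t₀) * K ≤ K * (T - t₀) := by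
    rw [mul_comm]
    exact mul_le_mul_of_nonneg_left (by linarith [ht.2]) hK
  unfold picard
  have h5 := abs_sub (r + ⟪x t - x t₀, z⟫_ℝ) (∫ s in t₀..t, H s x (v s) z)
  have h6 := abs_add_le r (⟪x t - x t₀, z⟫_ℝ)
  linarith

theorem IsChar.exists_le (hH : HamHyp T d H LH CH M) {t₀ r r' : ℝ} {x₀ x : Path d} {y : ℝ → ℝ}
    {z : E d} (ht₀ : t₀ ∈ Icc 0 T) (h : IsChar T d H LH t₀ x₀ r z x y) (hr : r' ≤ r) :
    ∃ y', IsChar T d H LH t₀ x₀ r' z x y' ∧ ∀ t ∈ Icc t₀ T, y' t ≤ y t := by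
  have hx := h.cadlag
  have hC := hH.bound.1
  have hxc := h.growth.continuousOn hH.lipZ.1 hx
  have hl : t₀ ∈ Icc t₀ T := left_mem_Icc.2 ht₀.2
  obtain ⟨K, hK0, hK⟩ := hH.exists_affine_bound hx z
  replace hK := ae_Ioo_mono hK ht₀.1 (le_refl T)
  obtain ⟨Y, hY⟩ := isCompact_Icc.exists_bound_of_continuousOn h.cont
  obtain ⟨Q, hQ⟩ := isCompact_Icc.exists_bound_of_continuousOn
    ((hxc.sub continuousOn_const).inner (𝕜 := ℝ) (continuousOn_const (c := z)) :
      ContinuousOn (fun t => ⟪x t - x t₀, z⟫_ℝ) (Icc t₀ T))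
  have hQ0 : 0 ≤ Q := (norm_nonneg _).trans (hQ t₀ hl)
  have hY0 : 0 ≤ Y := (norm_nonneg _).trans (hY t₀ hl)
  have hKT : 0 ≤ K * (T - t₀) := mul_nonneg hK0 (by linarith [ht₀.2])
  set B := |r'| + Q + K * (T - t₀) + Y with hB
  have hB0 : 0 ≤ B := by positivity
  let v : ℕ → ℝ → ℝ := fun k => (picard d H t₀ r' x z)^[k] y
  have hvs : ∀ k, v (k + 1) = picard d H t₀ r' x z (v k) := fun k =>
    Function.iterate_succ_apply' _ _ _
  have hvc : ∀ k, ContinuousOn (v k) (Icc t₀ T) := by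
    intro k
    induction k with
    | zero => exact h.cont
    | succ k ih =>
      rw [hvs]
      exact continuousOn_sub_primitive ht₀.2 hxc (hH.integrableOn hx ht₀.1 le_rfl ih z)
  have hvb : ∀ k, ∀ t ∈ Icc t₀ T, |v k t| ≤ B * Real.exp (CH * (t - t₀)) := by
    intro k
    induction k with
    | zero =>
      intro t ht
      have h1 := hY t ht
      have h2 : 1 ≤ Real.exp (CH * (t - t₀)) :=
        Real.one_le_exp (mul_nonneg hC (sub_nonneg.2 ht.1))
      have h3 := le_mul_of_one_le_right hB0 h2
      have h4 : Y ≤ B := by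
        have := abs_nonneg r'
        linarith
      exact h1.trans (h4.trans h3)
    | succ k ih =>
      intro t ht
      rw [hvs]
      exact picard_bound hC hK0 hQ (by linarith) hK ih ht
  have hanti : ∀ k, ∀ t ∈ Icc t₀ T, v (k + 1) t ≤ v k t := by
    intro k
    induction k with
    | zero =>
      intro t ht
      rw [hvs]
      refine (picard_le_picard hH ht₀.1 hx z hr h.cont h.cont (fun _ _ => le_rfl) ht).trans ?_
      exact (h.eq t ht).ge
    | succ k ih =>
      intro t ht
      have := picard_le_picard hH ht₀.1 hx z (le_refl r') (hvc _) (hvc _) ih ht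
      rwa [← hvs, ← hvs] at this
  have hv0 : v 0 = y := rfl
  set w : ℝ → ℝ := fun t => ⨅ k, v k t with hw
  have hlim : ∀ t ∈ Icc t₀ T, Tendsto (fun k => v k t) atTop (𝓝 (w t)) := fun t ht =>
    tendsto_atTop_ciInf (antitone_nat_of_succ_le fun k => hanti k t ht)
      ⟨-(B * Real.exp (CH * (t - t₀))), by
        rintro _ ⟨k, rfl⟩
        exact (abs_le.1 (hvb k t ht)).1⟩
  have hbd : ∀ k, ∀ᵐ s ∂(volume.restrict (Ioo t₀ T)),
      ‖H s x (v k s) z‖ ≤ K + CH * (B * Real.exp (CH * T)) := by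
    intro k
    filter_upwards [hK, ae_restrict_mem measurableSet_Ioo] with s hs hmem
    refine (hs (v k s)).trans ?_
    have h1 := hvb k s (Ioo_subset_Icc_self hmem)
    have h2 : Real.exp (CH * (s - t₀)) ≤ Real.exp (CH * T) :=
      Real.exp_le_exp.2 (mul_le_mul_of_nonneg_left (by linarith [hmem.2, ht₀.1]) hC)
    have h3 := mul_le_mul_of_nonneg_left (h1.trans (mul_le_mul_of_nonneg_left h2 hB0)) hC
    linarith
  have hHlim : ∀ᵐ s ∂(volume.restrict (Ioo t₀ T)),
      Tendsto (fun k => H s x (v k s) z) atTop (𝓝 (H s x (w s) z)) := by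
    filter_upwards [ae_Ioo_mono hH.continuous_y ht₀.1 (le_refl T),
      ae_restrict_mem measurableSet_Ioo] with s hs hmem
    exact ((hs x hx z).tendsto _).comp (hlim s (Ioo_subset_Icc_self hmem))
  have hmeas : ∀ k, AEStronglyMeasurable (fun s => H s x (v k s) z) (volume.restrict (Ioo t₀ T)) :=
    fun k => hH.aestronglyMeasurable hx ht₀.1 le_rfl (hvc k) z
  have hwint : IntegrableOn (fun s => H s x (w s) z) (Icc t₀ T) volume := by
    rw [integrableOn_Icc_iff_integrableOn_Ioo]
    refine Integrable.of_bound (aestronglyMeasurable_of_tendsto_ae atTop hmeas hHlim)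
      (K + CH * (B * Real.exp (CH * T))) ?_
    filter_upwards [hHlim, ae_all_iff.2 hbd] with s hs hs'
    exact le_of_tendsto hs.norm (Eventually.of_forall hs')
  have heq : ∀ t ∈ Icc t₀ T, w t = r' + ⟪x t - x t₀, z⟫_ℝ - ∫ s in t₀..t, H s x (w s) z := by
    intro t ht
    have h1 := (tendsto_add_atTop_iff_nat 1).2 (hlim t ht)
    simp only [hvs] at h1
    refine tendsto_nhds_unique h1 ?_
    refine tendsto_const_nhds.sub ?_
    refine intervalIntegral.tendsto_integral_filter_of_dominated_convergence
      (fun _ => K + CH * (B * Real.exp (CH * T))) (Eventually.of_forall fun k => ?_)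
      (Eventually.of_forall fun k => ?_) intervalIntegrable_const ?_
    · rw [uIoc_of_le ht.1, ← Measure.restrict_congr_set Ioo_ae_eq_Ioc]
      exact (hmeas k).mono_set (Ioo_subset_Ioo le_rfl ht.2)
    · rw [uIoc_of_le ht.1]
      exact ae_Ioc_of_ae_Ioo (hbd k) le_rfl ht.2
    · rw [uIoc_of_le ht.1]
      exact ae_Ioc_of_ae_Ioo hHlim le_rfl ht.2
  refine ⟨w, ⟨hx, h.init, h.growth, ?_, heq⟩, fun t ht => ?_⟩
  · exact (continuousOn_sub_primitive ht₀.2 hxc hwint).congr heq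
  · rw [← hv0]
    exact ciInf_le ⟨-(B * Real.exp (CH * (t - t₀))), by
        rintro _ ⟨k, rfl⟩
        exact (abs_le.1 (hvb k t ht)).1⟩ 0

end

section

variable {T : ℝ} {d : ℕ}

/-! ### Extraction of convergent subsequences of paths -/

theorem exists_subseq_uniform {F : Type*} [NormedAddCommGroup F] [ProperSpace F] {a b K R : ℝ}
    (hab : a ≤ b) (hK : 0 ≤ K) {f : ℕ → ℝ → F} (hR : ∀ n, ∀ t ∈ Icc a b, ‖f n t‖ ≤ R)
    (hf : ∀ n, ∀ s ∈ Icc a b, ∀ t ∈ Icc a b, ‖f n t - f n s‖ ≤ K * |t - s|) :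
    ∃ (g : ℝ → F) (φ : ℕ → ℕ) (e : ℕ → ℝ), StrictMono φ ∧ Tendsto e atTop (𝓝 0) ∧
      (∀ s ∈ Icc a b, ∀ t ∈ Icc a b, ‖g t - g s‖ ≤ K * |t - s|) ∧
      ∀ n, ∀ t ∈ Icc a b, ‖f (φ n) t - g t‖ ≤ e n := by
  let G : ℕ → BoundedContinuousFunction (Icc a b) F := fun n =>
    BoundedContinuousFunction.mkOfCompact
      ⟨fun t => f n t, (continuousOn_of_norm_sub_le hK (hf n)).domRestrict⟩
  have hGv : ∀ n (t : Icc a b), G n t = f n t := fun _ _ => rfl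
  have hcomp : IsCompact (closure (range G)) := by
    refine BoundedContinuousFunction.arzela_ascoli (Metric.closedBall (0 : F) R)
      (isCompact_closedBall 0 R) (range G) ?_ ?_
    · rintro _ t ⟨n, rfl⟩
      simpa [hGv] using hR n t t.2
    · intro t
      refine Metric.equicontinuousAt_iff.2 fun ε hε => ?_
      refine ⟨ε / (K + 1), by positivity, fun s hs => ?_⟩
      rintro ⟨_, n, rfl⟩
      have h1 := hf n s s.2 t t.2
      rw [dist_comm, Subtype.dist_eq, Real.dist_eq, lt_div_iff₀ (by positivity)] at hs
      simp only [hGv, dist_eq_norm]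
      have := abs_nonneg ((t : ℝ) - s)
      nlinarith
  obtain ⟨g, -, φ, hφ, hlim⟩ := hcomp.tendsto_subseq (fun n => subset_closure (mem_range_self n))
  have hd : ∀ n, ∀ t ∈ Icc a b, ‖f (φ n) t - g ⟨clamp a b t, clamp_mem hab t⟩‖ ≤
      dist (G (φ n)) g := by
    intro n t ht
    have := BoundedContinuousFunction.dist_coe_le_dist (f := G (φ n)) (g := g) ⟨t, ht⟩
    rw [dist_eq_norm, hGv] at this
    simpa only [clamp_of_mem ht] using this
  have hlim' : Tendsto (fun n => dist (G (φ n)) g) atTop (𝓝 0) :=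
    tendsto_iff_dist_tendsto_zero.1 hlim
  have hpt : ∀ t ∈ Icc a b,
      Tendsto (fun n => f (φ n) t) atTop (𝓝 (g ⟨clamp a b t, clamp_mem hab t⟩)) := fun t ht =>
    tendsto_iff_norm_sub_tendsto_zero.2
      (squeeze_zero (fun _ => norm_nonneg _) (fun n => hd n t ht) hlim')
  exact ⟨fun t => g ⟨clamp a b t, clamp_mem hab t⟩, φ, fun n => dist (G (φ n)) g, hφ, hlim',
    fun s hs t ht => le_of_tendsto ((hpt t ht).sub (hpt s hs)).norm
      (Eventually.of_forall fun n => hf (φ n) s hs t ht), hd⟩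

theorem GrowthLip.norm_sub_clamp_le {L t₀ : ℝ} {x : Path d} (hL : 0 ≤ L)
    (h : GrowthLip T d L t₀ x) {s t : ℝ} (hst : s ≤ t) (ht : t ≤ T) :
    ‖x (clamp t₀ T t) - x (clamp t₀ T s)‖ ≤ L * (1 + runSup d x t) * (t - s) := by
  have hs := hst.trans ht
  simp only [clamp, min_eq_right ht, min_eq_right hs]
  have h0 : 0 ≤ L * (1 + runSup d x t) := by
    have := runSup_nonneg x t
    positivity
  rcases le_total t t₀ with htt | htt
  · rw [max_eq_left htt, max_eq_left (hst.trans htt), sub_self, norm_zero]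
    exact mul_nonneg h0 (sub_nonneg.2 hst)
  · rw [max_eq_right htt]
    refine (h _ t (le_max_left _ _) (max_le htt hst) ht).trans ?_
    exact mul_le_mul_of_nonneg_left (sub_le_sub_left (le_max_right _ _) _) h0

theorem supDist_le_dInf {x y : Path d} (hx : x ∈ Cadlag T d) (hy : y ∈ Cadlag T d) (hT : 0 ≤ T) :
    supDist T d x y ≤ dInf T d (T, x) (T, y) := by
  refine supDist_le (dInf_nonneg _ _) fun r hr => ?_
  have hTT : T ∈ Icc 0 T := ⟨hT, le_rfl⟩
  have := norm_sub_le_stopDist hx hy hTT hTT hr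
  rw [min_eq_left hr.2] at this
  exact this.trans (le_add_of_nonneg_left (abs_nonneg _))

theorem runSup_le_of_dInf {x y : Path d} (hx : x ∈ Cadlag T d) (hy : y ∈ Cadlag T d) {t s : ℝ}
    (ht : t ∈ Icc 0 T) (hs : s ∈ Icc 0 T) :
    runSup d y s ≤ runSup d x t + dInf T d (t, x) (s, y) := by
  refine runSup_le (add_nonneg (runSup_nonneg _ _) (dInf_nonneg _ _)) fun r hr => ?_
  have hrT : r ∈ Icc 0 T := ⟨hr.1, hr.2.trans hs.2⟩
  have h1 := norm_sub_le_stopDist hx hy ht hs hrT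
  rw [min_eq_left hr.2] at h1
  have h2 := norm_le_runSup hx (le_min hrT.1 ht.1) (min_le_right r t) ht.2
  have h3 := norm_sub_norm_le (y r) (x (min r t))
  rw [norm_sub_rev] at h3
  have h4 : stopDist T d t x s y ≤ dInf T d (t, x) (s, y) :=
    le_add_of_nonneg_left (abs_nonneg _)
  linarith

theorem exists_runSup_bound {L : ℝ} (hL : 0 ≤ L) {t₀ : ℝ} {x₀ : Path d} (ht₀ : t₀ ∈ Icc 0 T)
    (hx₀ : x₀ ∈ Cadlag T d) {t : ℕ → ℝ} {x : ℕ → Path d} (ht : ∀ n, t n ∈ Icc 0 T)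
    (hx : ∀ n, x n ∈ Cadlag T d) (hg : ∀ n, GrowthLip T d L (t n) (x n))
    (hlim : Tendsto (fun n => dInf T d (t₀, x₀) (t n, x n)) atTop (𝓝 0)) :
    ∃ R, 0 ≤ R ∧ ∀ n, ∀ s ≤ T, runSup d (x n) s ≤ R := by
  obtain ⟨C, hC⟩ := hlim.bddAbove_range
  have hC' : ∀ n, dInf T d (t₀, x₀) (t n, x n) ≤ C := fun n => hC ⟨n, rfl⟩
  have hC0 : 0 ≤ C := (dInf_nonneg _ _).trans (hC' 0)
  have h0 := runSup_nonneg x₀ t₀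
  refine ⟨(1 + (runSup d x₀ t₀ + C)) * Real.exp (L * T), by positivity, fun n s hs => ?_⟩
  refine (runSup_mono (hx n) hs le_rfl).trans ?_
  refine ((hg n).runSup_le_gronwall hL (hx n) (ht n).1 ⟨(ht n).2, le_rfl⟩).trans ?_
  have := runSup_le_of_dInf hx₀ (hx n) ht₀ (ht n)
  have := hC' n
  gcongr
  linarith

theorem exists_subseq_path {L : ℝ} (hL : 0 ≤ L) {t₀ : ℝ} {x₀ : Path d} (ht₀ : t₀ ∈ Icc 0 T)
    (hx₀ : x₀ ∈ Cadlag T d) {t : ℕ → ℝ} {x : ℕ → Path d} (ht : ∀ n, t n ∈ Icc 0 T)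
    (hx : ∀ n, x n ∈ Cadlag T d) (hg : ∀ n, GrowthLip T d L (t n) (x n))
    (hlim : Tendsto (fun n => dInf T d (t₀, x₀) (t n, x n)) atTop (𝓝 0)) :
    ∃ (X : Path d) (φ : ℕ → ℕ), StrictMono φ ∧ X ∈ Cadlag T d ∧ (∀ r ∈ Icc 0 t₀, X r = x₀ r) ∧
      GrowthLip T d L t₀ X ∧
      ∀ (σ : ℕ → ℝ), ∀ τ ∈ Icc t₀ T, (∀ᶠ n in atTop, σ n ∈ Icc (t (φ n)) T) →
        Tendsto σ atTop (𝓝 τ) →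
        Tendsto (fun n => dInf T d (τ, X) (σ n, x (φ n))) atTop (𝓝 0) := by
  have hT0 : 0 ≤ T := ht₀.1.trans ht₀.2
  obtain ⟨R, hR0, hR⟩ := exists_runSup_bound hL ht₀ hx₀ ht hx hg hlim
  set K := L * (1 + R) with hK
  have hK0 : 0 ≤ K := by positivity
  let xb : ℕ → Path d := fun n r => x n (clamp (t n) T r)
  have hxbR : ∀ n, ∀ r ∈ Icc 0 T, ‖xb n r‖ ≤ R := by
    intro n r _
    have hc := clamp_mem (ht n).2 r
    exact (norm_le_runSup (hx n) ((ht n).1.trans hc.1) hc.2 le_rfl).trans (hR n T le_rfl)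
  have hxbK : ∀ n r s, ‖xb n r - xb n s‖ ≤ K * |r - s| := by
    intro n r s
    refine ((hg n).norm_sub_le hL (hR n) (clamp_mem (ht n).2 s) (clamp_mem (ht n).2 r)).trans ?_
    exact mul_le_mul_of_nonneg_left (abs_clamp_sub_clamp_le _ _ _ _) hK0
  obtain ⟨g, φ, e, hφ, he, hgK, hge⟩ :=
    exists_subseq_uniform hT0 hK0 hxbR fun n s _ r _ => hxbK n r s
  have hgpt : ∀ r ∈ Icc 0 T, Tendsto (fun n => xb (φ n) r) atTop (𝓝 (g r)) := fun r hr =>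
    tendsto_iff_norm_sub_tendsto_zero.2
      (squeeze_zero (fun _ => norm_nonneg _) (fun n => hge n r hr) he)
  set D : ℕ → ℝ := fun n => dInf T d (t₀, x₀) (t (φ n), x (φ n)) with hD
  have hDlim : Tendsto D atTop (𝓝 0) := hlim.comp hφ.tendsto_atTop
  have hDt : ∀ n, |t₀ - t (φ n)| ≤ D n := fun n => le_add_of_nonneg_right (stopDist_nonneg _ _ _ _)
  have hDx : ∀ n, ∀ r ∈ Icc 0 T, ‖x₀ (min r t₀) - x (φ n) (min r (t (φ n)))‖ ≤ D n := fun n r hr =>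
    (norm_sub_le_stopDist hx₀ (hx _) ht₀ (ht _) hr).trans (le_add_of_nonneg_left (abs_nonneg _))
  have hDT : ∀ n, ‖x₀ t₀ - x (φ n) (t (φ n))‖ ≤ D n := fun n => by
    have := hDx n T ⟨hT0, le_rfl⟩
    rwa [min_eq_right ht₀.2, min_eq_right (ht _).2] at this
  have hginit : ∀ r ∈ Icc 0 t₀, g r = x₀ t₀ := by
    intro r hr
    refine tendsto_nhds_unique (hgpt r ⟨hr.1, hr.2.trans ht₀.2⟩) ?_
    refine tendsto_iff_norm_sub_tendsto_zero.2 (squeeze_zero (g := fun n => (K + 1) * D n)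
      (fun _ => norm_nonneg _) (fun n => ?_) (by simpa using hDlim.const_mul (K + 1)))
    have h1 := norm_sub_le_norm_sub_add_norm_sub (xb (φ n) r) (x (φ n) (t (φ n))) (x₀ t₀)
    have h2 : ‖xb (φ n) r - x (φ n) (t (φ n))‖ ≤ K * D n := by
      refine ((hg (φ n)).norm_sub_le hL (hR (φ n)) (left_mem_Icc.2 (ht (φ n)).2)
        (clamp_mem (ht (φ n)).2 r)).trans (mul_le_mul_of_nonneg_left ?_ hK0)
      have h3 : clamp (t (φ n)) T r = max (t (φ n)) r := by
        rw [clamp, min_eq_right (hr.2.trans ht₀.2)]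
      rw [h3, abs_of_nonneg (sub_nonneg.2 (le_max_left _ _)), sub_le_iff_le_add]
      have h4 := (abs_le.1 (hDt n)).2
      have h5 : 0 ≤ D n := dInf_nonneg _ _
      exact max_le (by linarith) (by linarith [hr.2])
    have h3 := hDT n
    rw [norm_sub_rev] at h3
    linarith
  let X : Path d := fun r => x₀ (min r t₀) + g r - x₀ t₀
  have hX1 : ∀ r ∈ Icc 0 t₀, X r = x₀ r := fun r hr => by
    simp [X, hginit r hr, min_eq_left hr.2]
  have hX2 : ∀ r, t₀ ≤ r → X r = g r := fun r hr => by
    simp [X, min_eq_right hr]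
  have hXc : X ∈ Cadlag T d := by
    refine Cadlag.of_glue hx₀ hX1 ?_
    refine ContinuousOn.congr ?_ fun r hr => hX2 r hr.1
    exact (continuousOn_of_norm_sub_le hK0 hgK).mono (Icc_subset_Icc_left ht₀.1)
  have hconv : ∀ (σ : ℕ → ℝ), ∀ τ ∈ Icc t₀ T, (∀ᶠ n in atTop, σ n ∈ Icc (t (φ n)) T) →
      Tendsto σ atTop (𝓝 τ) →
      Tendsto (fun n => dInf T d (τ, X) (σ n, x (φ n))) atTop (𝓝 0) := by
    intro σ τ hτ hσ hστ
    have hlim2 : Tendsto (fun n => |τ - σ n| + (2 * D n + e n + K * |τ - σ n|)) atTop (𝓝 0) := by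
      have h1 : Tendsto (fun n => |τ - σ n|) atTop (𝓝 0) := by
        simpa using ((tendsto_const_nhds (x := τ)).sub hστ).abs
      simpa using h1.add (((hDlim.const_mul 2).add he).add (h1.const_mul K))
    refine squeeze_zero' (Eventually.of_forall fun n => dInf_nonneg _ _) ?_ hlim2
    filter_upwards [hσ] with n hn
    have hDn : 0 ≤ D n := dInf_nonneg _ _
    have hen : 0 ≤ e n := (norm_nonneg _).trans (hge n 0 ⟨le_rfl, hT0⟩)
    refine add_le_add le_rfl (stopDist_le (by positivity) fun r hr => ?_)
    have hxn : x (φ n) (min r (σ n)) = x (φ n) (min r (t (φ n))) + xb (φ n) (min r (σ n))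
        - x (φ n) (t (φ n)) := by
      have hc : clamp (t (φ n)) T (min r (σ n)) = max (t (φ n)) (min r (σ n)) := by
        rw [clamp, min_eq_right ((min_le_right _ _).trans hn.2)]
      simp only [xb, hc]
      rcases le_total r (t (φ n)) with h | h
      · rw [min_eq_left h, min_eq_left (h.trans hn.1), max_eq_left h]
        abel
      · rw [min_eq_right h, max_eq_right (le_min h hn.1)]
        abel
    have hxτ : X (min r τ) = x₀ (min r t₀) + g (min r τ) - x₀ t₀ := by
      simp only [X, min_assoc, min_eq_right hτ.1]
    have hr1 : min r τ ∈ Icc 0 T := ⟨le_min hr.1 (ht₀.1.trans hτ.1), (min_le_left _ _).trans hr.2⟩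
    have hr2 : min r (σ n) ∈ Icc 0 T :=
      ⟨le_min hr.1 ((ht _).1.trans hn.1), (min_le_left _ _).trans hr.2⟩
    have hmin : |min r τ - min r (σ n)| ≤ |τ - σ n| := by
      have := abs_min_sub_min_le_max r τ r (σ n)
      simpa using this
    have e1 : X (min r τ) - x (φ n) (min r (σ n)) =
        (x₀ (min r t₀) - x (φ n) (min r (t (φ n)))) - (xb (φ n) (min r (σ n)) - g (min r (σ n)))
          + (g (min r τ) - g (min r (σ n))) - (x₀ t₀ - x (φ n) (t (φ n))) := by
      rw [hxn, hxτ]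
      abel
    rw [e1]
    have n1 := hDx n r hr
    have n2 := hge n _ hr2
    have n3 := (hgK _ hr2 _ hr1).trans (mul_le_mul_of_nonneg_left hmin hK0)
    have n4 := hDT n
    refine (norm_sub_le _ _).trans ?_
    have a1 := norm_add_le ((x₀ (min r t₀) - x (φ n) (min r (t (φ n)))) -
      (xb (φ n) (min r (σ n)) - g (min r (σ n)))) (g (min r τ) - g (min r (σ n)))
    have a2 := norm_sub_le (x₀ (min r t₀) - x (φ n) (min r (t (φ n))))
      (xb (φ n) (min r (σ n)) - g (min r (σ n)))
    linarith
  refine ⟨X, φ, hφ, hXc, hX1, fun s r hs hsr hr => ?_, hconv⟩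
  have hsup := hconv (fun _ => T) T ⟨ht₀.2, le_rfl⟩
    (Eventually.of_forall fun n => ⟨(ht _).2, le_rfl⟩) tendsto_const_nhds
  have h0s : 0 ≤ s := ht₀.1.trans hs
  rw [hX2 s hs, hX2 r (hs.trans hsr)]
  refine le_of_tendsto_of_tendsto
    ((hgpt r ⟨h0s.trans hsr, hr⟩).sub (hgpt s ⟨h0s, hsr.trans hr⟩)).norm
    (g := fun n => L * (1 + (runSup d X r + dInf T d (T, X) (T, x (φ n)))) * (r - s)) ?_
    (Eventually.of_forall fun n => ?_)
  · simpa using (((hsup.const_add (runSup d X r)).const_add 1).const_mul L).mul_const (r - s)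
  · refine ((hg (φ n)).norm_sub_clamp_le hL hsr hr).trans ?_
    have h1 := runSup_le_add_supDist (hx (φ n)) hXc hr
    rw [supDist_comm] at h1
    have h2 := supDist_le_dInf hXc (hx (φ n)) hT0
    refine mul_le_mul_of_nonneg_right (mul_le_mul_of_nonneg_left ?_ hL) (sub_nonneg.2 hsr)
    linarith

end

section

variable {T : ℝ} {d : ℕ} {H : Ham d} {LH CH : ℝ} {M : ℝ → ℝ}

/-! ### Limits of approximate characteristics -/

/-- The equation for the second component of a characteristic, up to an error `ε`. -/
structure ApproxEq (T : ℝ) (d : ℕ) (H : Ham d) (s₀ y₀ : ℝ) (z : E d) (x : Path d)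
    (y a η : ℝ → ℝ) (ε : ℝ) : Prop where
  nonneg : 0 ≤ ε
  le_one : ε ≤ 1
  int : IntegrableOn a (Icc s₀ T) volume
  eq : ∀ t ∈ Icc s₀ T, y t = y₀ + ⟪x t - x s₀, z⟫_ℝ - ∫ s in s₀..t, a s
  ham : ∀ᵐ s ∂(volume.restrict (Ioo s₀ T)), |a s - H s x (η s) z| ≤ ε ∧ |η s - y s| ≤ ε

theorem ApproxEq.abs_le (hH : HamHyp T d H LH CH M) {s₀ y₀ R ε : ℝ} {z : E d} {x : Path d}
    {y a η : ℝ → ℝ} (h : ApproxEq T d H s₀ y₀ z x y a η ε) (hs₀ : s₀ ∈ Icc 0 T)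
    (hx : x ∈ Cadlag T d) (hR : ∀ t ≤ T, runSup d x t ≤ R) :
    ∀ᵐ s ∂(volume.restrict (Ioo s₀ T)),
      |a s| ≤ (1 + (CH * (1 + R) + LH * (1 + R) * ‖z‖) + CH) + CH * |y s| := by
  filter_upwards [h.ham, ae_Ioo_mono (hH.affine_bound hx hR z) hs₀.1 le_rfl] with s hs hs'
  have h1 := hs' (η s)
  have h2 := abs_sub_abs_le_abs_sub (a s) (H s x (η s) z)
  have h3 := abs_sub_abs_le_abs_sub (η s) (y s)
  have h4 := mul_le_mul_of_nonneg_left (show |η s| ≤ 1 + |y s| by linarith [h.le_one]) hH.bound.1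
  linarith [h.le_one, hs.1, hs.2]

theorem ApproxEq.bound (hH : HamHyp T d H LH CH M) {s₀ y₀ R ε : ℝ} {z : E d} {x : Path d}
    {y a η : ℝ → ℝ} (h : ApproxEq T d H s₀ y₀ z x y a η ε) (hs₀ : s₀ ∈ Icc 0 T)
    (hx : x ∈ Cadlag T d) (hg : GrowthLip T d LH s₀ x) (hR0 : 0 ≤ R)
    (hR : ∀ t ≤ T, runSup d x t ≤ R) {t : ℝ} (ht : t ∈ Icc s₀ T) :
    |y t| ≤ (|y₀| + (2 * R * ‖z‖ + (1 + (CH * (1 + R) + LH * (1 + R) * ‖z‖) + CH) * T))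
      * Real.exp (CH * T) ∧
    |y t| ≤ (|y T| + (2 * R * ‖z‖ + (1 + (CH * (1 + R) + LH * (1 + R) * ‖z‖) + CH) * T))
      * Real.exp (CH * T) := by
  have hL := hH.lipZ.1
  have hC := hH.bound.1
  have hT := hH.pos.le
  have hyc : ContinuousOn y (Icc s₀ T) :=
    (continuousOn_sub_primitive hs₀.2 (hg.continuousOn hL hx) h.int).congr h.eq
  have hy0 : y s₀ = y₀ := by simpa using h.eq s₀ ⟨le_rfl, hs₀.2⟩
  have := abs_le_exp_of_increment_le hyc (T := T)
    (c := 2 * R * ‖z‖ + (1 + (CH * (1 + R) + LH * (1 + R) * ‖z‖) + CH) * T) (by positivity) hC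
    (by linarith [hs₀.1])
    (fun s t hs hst ht => abs_increment_le (T := T)
      (fun r hr => (norm_le_runSup hx (hs₀.1.trans hr.1) hr.2 le_rfl).trans (hR T le_rfl))
      (by linarith [hs₀.1]) (by positivity) hyc h.int (h.abs_le hH hs₀ hx hR) h.eq hs hst ht) ht
  rwa [hy0] at this

theorem ApproxEq.norm_sub_le (hH : HamHyp T d H LH CH M) {s₀ y₀ R B ε : ℝ} {z : E d} {x : Path d}
    {y a η : ℝ → ℝ} (h : ApproxEq T d H s₀ y₀ z x y a η ε) (hs₀ : s₀ ∈ Icc 0 T)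
    (hx : x ∈ Cadlag T d) (hg : GrowthLip T d LH s₀ x)
    (hR : ∀ t ≤ T, runSup d x t ≤ R) (hB : ∀ t ∈ Icc s₀ T, |y t| ≤ B) {s t : ℝ}
    (hs : s ∈ Icc s₀ T) (ht : t ∈ Icc s₀ T) :
    ‖y t - y s‖ ≤ (LH * (1 + R) * ‖z‖ +
      (1 + (CH * (1 + R) + LH * (1 + R) * ‖z‖) + CH + CH * B)) * |t - s| := by
  have hl : s₀ ∈ Icc s₀ T := left_mem_Icc.2 hs₀.2
  have e : y t - y s = ⟪x t - x s, z⟫_ℝ - ∫ r in s..t, a r := by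
    rw [h.eq t ht, h.eq s hs, ← intervalIntegral.integral_interval_sub_left
      (intervalIntegrable_of_Icc h.int hl ht) (intervalIntegrable_of_Icc h.int hl hs)]
    have : x t - x s = (x t - x s₀) - (x s - x s₀) := by abel
    rw [this, inner_sub_left (x t - x s₀) (x s - x s₀)]
    ring
  have h1 : |⟪x t - x s, z⟫_ℝ| ≤ LH * (1 + R) * |t - s| * ‖z‖ :=
    (abs_real_inner_le_norm _ _).trans (mul_le_mul_of_nonneg_right
      (hg.norm_sub_le hH.lipZ.1 hR hs ht) (norm_nonneg _))
  have h2 : ‖∫ r in s..t, a r‖ ≤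
      (1 + (CH * (1 + R) + LH * (1 + R) * ‖z‖) + CH + CH * B) * |t - s| := by
    refine intervalIntegral.norm_integral_le_of_norm_le_const_ae ?_
    filter_upwards [ae_Ioc_of_ae_Ioo (h.abs_le hH hs₀ hx hR) le_rfl le_rfl] with r hr hmem
    have hm : r ∈ Ioc s₀ T := ⟨(le_min hs.1 ht.1).trans_lt hmem.1, hmem.2.trans (max_le hs.2 ht.2)⟩
    refine (hr hm).trans ?_
    have := mul_le_mul_of_nonneg_left (hB r ⟨hm.1.le, hm.2⟩) hH.bound.1
    linarith
  rw [Real.norm_eq_abs] at h2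
  rw [e, Real.norm_eq_abs]
  have h4 := abs_sub (⟪x t - x s, z⟫_ℝ) (∫ r in s..t, a r)
  linarith

end

section

variable {T : ℝ} {d : ℕ} {H : Ham d} {LH CH : ℝ} {M : ℝ → ℝ}

/-- `x n`, started at time `t n`, converges to `X`, started at time `t₀`. -/
structure PathConv (T : ℝ) (d : ℕ) (L t₀ : ℝ) (X : Path d) (t : ℕ → ℝ) (x : ℕ → Path d) :
    Prop where
  mem : t₀ ∈ Icc 0 T
  cadlag : X ∈ Cadlag T d
  growth : GrowthLip T d L t₀ X
  mem' : ∀ n, t n ∈ Icc 0 T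
  cadlag' : ∀ n, x n ∈ Cadlag T d
  growth' : ∀ n, GrowthLip T d L (t n) (x n)
  lim : Tendsto t atTop (𝓝 t₀)
  conv : ∀ (σ : ℕ → ℝ), ∀ τ ∈ Icc t₀ T, (∀ᶠ n in atTop, σ n ∈ Icc (t n) T) →
    Tendsto σ atTop (𝓝 τ) → Tendsto (fun n => dInf T d (τ, X) (σ n, x n)) atTop (𝓝 0)

theorem PathConv.comp {L t₀ : ℝ} {X : Path d} {t : ℕ → ℝ} {x : ℕ → Path d}
    (h : PathConv T d L t₀ X t x) {φ : ℕ → ℕ} (hφ : StrictMono φ) :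
    PathConv T d L t₀ X (t ∘ φ) (x ∘ φ) := by
  refine ⟨h.mem, h.cadlag, h.growth, fun n => h.mem' _, fun n => h.cadlag' _, fun n => h.growth' _,
    h.lim.comp hφ.tendsto_atTop, fun σ τ hτ hσ hlim => ?_⟩
  have hd : Tendsto (fun n => |t₀ - t (φ n)|) atTop (𝓝 0) := by
    simpa using ((tendsto_const_nhds (x := t₀)).sub (h.lim.comp hφ.tendsto_atTop)).abs
  let σ' : ℕ → ℝ := Function.extend φ σ (fun n => max τ (t n))
  have hφi := hφ.injective
  have e : ∀ n, σ' (φ n) = σ n := fun n => hφi.extend_apply _ _ _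
  have hmax : Tendsto (fun n => max τ (t n)) atTop (𝓝 τ) := by
    have := (tendsto_const_nhds (x := τ)).max h.lim
    rwa [max_eq_left hτ.1] at this
  have hcases : ∀ n, (∃ k, φ k = n ∧ σ' n = σ k) ∨ σ' n = max τ (t n) := by
    intro n
    by_cases hn : ∃ k, φ k = n
    · obtain ⟨k, rfl⟩ := hn
      exact Or.inl ⟨k, rfl, e k⟩
    · exact Or.inr (Function.extend_apply' _ _ _ hn)
  have h1 : ∀ᶠ n in atTop, σ' n ∈ Icc (t n) T := by
    obtain ⟨N, hN⟩ := eventually_atTop.1 hσ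
    filter_upwards [eventually_ge_atTop (φ N)] with n hn
    rcases hcases n with ⟨k, rfl, hk⟩ | hk
    · rw [hk]
      exact hN k (hφ.le_iff_le.1 hn)
    · rw [hk]
      exact ⟨le_max_right _ _, max_le hτ.2 (h.mem' n).2⟩
  have h2 : Tendsto σ' atTop (𝓝 τ) := by
    rw [Metric.tendsto_atTop] at hlim hmax ⊢
    intro ε hε
    obtain ⟨N, hN⟩ := hlim ε hε
    obtain ⟨N', hN'⟩ := hmax ε hε
    refine ⟨max (φ N) N', fun n hn => ?_⟩
    rcases hcases n with ⟨k, rfl, hk⟩ | hk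
    · rw [hk]
      exact hN k (hφ.le_iff_le.1 ((le_max_left _ _).trans hn))
    · rw [hk]
      exact hN' n ((le_max_right _ _).trans hn)
  have := (h.conv σ' τ hτ h1 h2).comp hφ.tendsto_atTop
  simpa only [Function.comp_def, e] using this

theorem PathConv.tendsto_supDist {L t₀ : ℝ} {X : Path d} {t : ℕ → ℝ} {x : ℕ → Path d}
    (h : PathConv T d L t₀ X t x) : Tendsto (fun n => supDist T d X (x n)) atTop (𝓝 0) :=
  squeeze_zero (fun _ => supDist_nonneg _ _)
    (fun n => supDist_le_dInf h.cadlag (h.cadlag' n) (h.mem.1.trans h.mem.2))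
    (h.conv (fun _ => T) T ⟨h.mem.2, le_rfl⟩ (Eventually.of_forall fun n => ⟨(h.mem' n).2, le_rfl⟩)
      tendsto_const_nhds)

theorem PathConv.tendsto_apply {L t₀ : ℝ} {X : Path d} {t : ℕ → ℝ} {x : ℕ → Path d}
    (h : PathConv T d L t₀ X t x) {σ : ℕ → ℝ} {τ : ℝ} (hτ : τ ∈ Icc t₀ T)
    (hσ : ∀ n, σ n ∈ Icc (t n) T) (hlim : Tendsto σ atTop (𝓝 τ)) :
    Tendsto (fun n => x n (σ n)) atTop (𝓝 (X τ)) := by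
  refine tendsto_iff_norm_sub_tendsto_zero.2 (squeeze_zero (fun _ => norm_nonneg _) (fun n => ?_)
    (h.conv σ τ hτ (Eventually.of_forall hσ) hlim))
  have h0 : 0 ≤ T := h.mem.1.trans h.mem.2
  have := norm_sub_le_stopDist h.cadlag (h.cadlag' n) ⟨h.mem.1.trans hτ.1, hτ.2⟩
    ⟨(h.mem' n).1.trans (hσ n).1, (hσ n).2⟩ (r := T) ⟨h0, le_rfl⟩
  rw [min_eq_right hτ.2, min_eq_right (hσ n).2, norm_sub_rev] at this
  exact this.trans (le_add_of_nonneg_left (abs_nonneg _))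

theorem PathConv.exists_runSup_bound {L t₀ : ℝ} {X : Path d} {t : ℕ → ℝ} {x : ℕ → Path d}
    (h : PathConv T d L t₀ X t x) : ∃ R, 0 ≤ R ∧ ∀ n, ∀ s ≤ T, runSup d (x n) s ≤ R := by
  obtain ⟨C, hC⟩ := h.tendsto_supDist.bddAbove_range
  have hC' : ∀ n, supDist T d X (x n) ≤ C := fun n => hC ⟨n, rfl⟩
  have hC0 : 0 ≤ C := (supDist_nonneg _ _).trans (hC' 0)
  obtain ⟨R, hR0, hR⟩ := exists_runSup_le h.cadlag
  refine ⟨R + C, by positivity, fun n s hs => ?_⟩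
  have h1 := runSup_le_add_supDist (h.cadlag' n) h.cadlag hs
  rw [supDist_comm] at h1
  linarith [hR s hs, hC' n]

theorem exists_pathConv {L : ℝ} (hL : 0 ≤ L) {t₀ : ℝ} {x₀ : Path d} (ht₀ : t₀ ∈ Icc 0 T)
    (hx₀ : x₀ ∈ Cadlag T d) {t : ℕ → ℝ} {x : ℕ → Path d} (ht : ∀ n, t n ∈ Icc 0 T)
    (hx : ∀ n, x n ∈ Cadlag T d) (hg : ∀ n, GrowthLip T d L (t n) (x n))
    (hlim : Tendsto (fun n => dInf T d (t₀, x₀) (t n, x n)) atTop (𝓝 0)) :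
    ∃ (X : Path d) (φ : ℕ → ℕ), StrictMono φ ∧ (∀ r ∈ Icc 0 t₀, X r = x₀ r) ∧
      PathConv T d L t₀ X (t ∘ φ) (x ∘ φ) := by
  obtain ⟨X, φ, hφ, hX, hinit, hgX, hconv⟩ := exists_subseq_path hL ht₀ hx₀ ht hx hg hlim
  refine ⟨X, φ, hφ, hinit, ht₀, hX, hgX, fun n => ht _, fun n => hx _, fun n => hg _, ?_, hconv⟩
  refine Tendsto.comp (g := t) (y := atTop) ?_ hφ.tendsto_atTop
  refine tendsto_iff_norm_sub_tendsto_zero.2 (squeeze_zero (fun _ => norm_nonneg _) (fun n => ?_)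
    hlim)
  rw [norm_sub_rev, Real.norm_eq_abs]
  exact le_add_of_nonneg_right (stopDist_nonneg _ _ _ _)

theorem PathConv.tendsto_ham (hH : HamHyp T d H LH CH M) {t₀ : ℝ} {X : Path d} {t : ℕ → ℝ}
    {x : ℕ → Path d} (h : PathConv T d LH t₀ X t x) (z : E d) :
    ∀ᵐ s ∂(volume.restrict (Ioo 0 T)), ∀ (η : ℕ → ℝ) (y : ℝ), Tendsto η atTop (𝓝 y) →
      Tendsto (fun n => H s (x n) (η n) z) atTop (𝓝 (H s X y z)) := by
  filter_upwards [hH.cont] with s hs η y hη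
  rw [Metric.tendsto_atTop] at hη ⊢
  have hd := Metric.tendsto_atTop.1 h.tendsto_supDist
  intro ε hε
  obtain ⟨δ, hδ, hδ'⟩ := hs X h.cadlag y z ε hε
  obtain ⟨N, hN⟩ := hη δ hδ
  obtain ⟨N', hN'⟩ := hd δ hδ
  refine ⟨max N N', fun n hn => ?_⟩
  have h1 := hN n ((le_max_left _ _).trans hn)
  have h2 := hN' n ((le_max_right _ _).trans hn)
  rw [dist_comm, Real.dist_eq] at h1 ⊢
  rw [Real.dist_eq, sub_zero, abs_of_nonneg (supDist_nonneg _ _)] at h2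
  exact hδ' (x n) (h.cadlag' n) (η n) z h2 h1 (by simpa using hδ)

theorem intervalIntegral_eq_setIntegral_indicator (f : ℝ → ℝ) {a b : ℝ} (ha : 0 ≤ a) (hab : a ≤ b)
    (hb : b ≤ T) : ∫ s in a..b, f s = ∫ s in Ioo 0 T, (Ioc a b).indicator f s := by
  have h : Ioc a b ⊆ Ioc 0 T := Ioc_subset_Ioc ha hb
  rw [intervalIntegral.integral_of_le hab, ← integral_Ioc_eq_integral_Ioo,
    setIntegral_indicator measurableSet_Ioc, inter_eq_self_of_subset_right h]

theorem PathConv.exists_subseq_eq (hH : HamHyp T d H LH CH M) {t₀ : ℝ} {X : Path d} {t : ℕ → ℝ}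
    {x : ℕ → Path d} (h : PathConv T d LH t₀ X t x) {z : E d} {y₀ : ℝ} {r ε : ℕ → ℝ}
    {y a η : ℕ → ℝ → ℝ} (hr : Tendsto r atTop (𝓝 y₀)) (hε : Tendsto ε atTop (𝓝 0))
    (happ : ∀ n, ApproxEq T d H (t n) (r n) z (x n) (y n) (a n) (η n) (ε n)) :
    ∃ (Y : ℝ → ℝ) (φ : ℕ → ℕ), StrictMono φ ∧ IsChar T d H LH t₀ X y₀ z X Y ∧
      ∀ (σ : ℕ → ℝ), ∀ τ ∈ Icc t₀ T, (∀ᶠ n in atTop, σ n ∈ Icc (t (φ n)) T) →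
        Tendsto σ atTop (𝓝 τ) → Tendsto (fun n => y (φ n) (σ n)) atTop (𝓝 (Y τ)) := by
  have hL := hH.lipZ.1
  have hC := hH.bound.1
  have hT := hH.pos.le
  obtain ⟨R, hR0, hR⟩ := h.exists_runSup_bound
  obtain ⟨ρ, hρ⟩ := hr.abs.bddAbove_range
  have hρ' : ∀ n, |r n| ≤ ρ := fun n => hρ ⟨n, rfl⟩
  have hρ0 : 0 ≤ ρ := (abs_nonneg _).trans (hρ' 0)
  set A := 1 + (CH * (1 + R) + LH * (1 + R) * ‖z‖) + CH with hA
  have hA0 : 0 ≤ A := by positivity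
  set B := (ρ + (2 * R * ‖z‖ + A * T)) * Real.exp (CH * T) with hB
  have hB0 : 0 ≤ B := by positivity
  have hyB : ∀ n, ∀ s ∈ Icc (t n) T, |y n s| ≤ B := by
    intro n s hs
    refine (((happ n).bound hH (h.mem' n) (h.cadlag' n) (h.growth' n) hR0 (hR n) hs).1).trans ?_
    have := hρ' n
    rw [hB]
    gcongr
  set K := LH * (1 + R) * ‖z‖ + (A + CH * B) with hK
  have hK0 : 0 ≤ K := by positivity
  have hyK : ∀ n, ∀ s ∈ Icc (t n) T, ∀ q ∈ Icc (t n) T, ‖y n q - y n s‖ ≤ K * |q - s| :=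
    fun n s hs q hq =>
      (happ n).norm_sub_le hH (h.mem' n) (h.cadlag' n) (h.growth' n) (hR n) (hyB n) hs hq
  let yb : ℕ → ℝ → ℝ := fun n s => y n (clamp (t n) T s)
  have hybK : ∀ n q s, ‖yb n q - yb n s‖ ≤ K * |q - s| := fun n q s =>
    (hyK n _ (clamp_mem (h.mem' n).2 s) _ (clamp_mem (h.mem' n).2 q)).trans
      (mul_le_mul_of_nonneg_left (abs_clamp_sub_clamp_le _ _ _ _) hK0)
  obtain ⟨Y, φ, e, hφ, he, hYK, hYe⟩ := exists_subseq_uniform hT hK0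
    (fun n s _ => hyB n _ (clamp_mem (h.mem' n).2 s)) (f := yb) (fun n s _ q _ => hybK n q s)
  have hconv : ∀ (σ : ℕ → ℝ), ∀ τ ∈ Icc t₀ T, (∀ᶠ n in atTop, σ n ∈ Icc (t (φ n)) T) →
      Tendsto σ atTop (𝓝 τ) → Tendsto (fun n => y (φ n) (σ n)) atTop (𝓝 (Y τ)) := by
    intro σ τ hτ hσ hlim
    have h1 : Tendsto (fun n => |σ n - τ|) atTop (𝓝 0) := by
      simpa using (hlim.sub (tendsto_const_nhds (x := τ))).abs
    refine tendsto_iff_norm_sub_tendsto_zero.2 (squeeze_zero' (g := fun n => K * |σ n - τ| + e n)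
      (Eventually.of_forall fun _ => norm_nonneg _) ?_ (by simpa using (h1.const_mul K).add he))
    filter_upwards [hσ] with n hn
    have h2 := hYe n τ ⟨h.mem.1.trans hτ.1, hτ.2⟩
    have h3 := hybK (φ n) (σ n) τ
    have h4 : yb (φ n) (σ n) = y (φ n) (σ n) := by simp only [yb, clamp_of_mem hn]
    rw [h4] at h3
    have h5 := norm_sub_le_norm_sub_add_norm_sub (y (φ n) (σ n)) (yb (φ n) τ) (Y τ)
    linarith
  have hYc : ContinuousOn Y (Icc t₀ T) :=
    (continuousOn_of_norm_sub_le hK0 hYK).mono (Icc_subset_Icc_left h.mem.1)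
  have hcomp := h.comp hφ
  have htφ : Tendsto (fun n => t (φ n)) atTop (𝓝 t₀) := hcomp.lim
  refine ⟨Y, φ, hφ, ⟨h.cadlag, fun _ _ => rfl, h.growth, hYc, fun τ hτ => ?_⟩, hconv⟩
  set σ : ℕ → ℝ := fun n => max τ (t (φ n)) with hσ
  have hσlim : Tendsto σ atTop (𝓝 τ) := by
    have := (tendsto_const_nhds (x := τ)).max htφ
    rwa [max_eq_left hτ.1] at this
  have hσmem : ∀ n, σ n ∈ Icc (t (φ n)) T := fun n =>
    ⟨le_max_right _ _, max_le hτ.2 (h.mem' _).2⟩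
  have hlimY := hconv σ τ hτ (Eventually.of_forall hσmem) hσlim
  have hlimX := hcomp.tendsto_apply hτ hσmem hσlim
  have hlimX0 := hcomp.tendsto_apply (left_mem_Icc.2 h.mem.2)
    (fun n => left_mem_Icc.2 (h.mem' (φ n)).2) htφ
  refine tendsto_nhds_unique hlimY ?_
  simp only [fun n => (happ (φ n)).eq (σ n) (hσmem n)]
  refine ((hr.comp hφ.tendsto_atTop).add ((hlimX.sub hlimX0).inner tendsto_const_nhds)).sub ?_
  simp only [fun n => intervalIntegral_eq_setIntegral_indicator (a (φ n)) (h.mem' (φ n)).1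
    (hσmem n).1 (hσmem n).2, intervalIntegral_eq_setIntegral_indicator _ h.mem.1 hτ.1 hτ.2]
  refine tendsto_integral_of_dominated_convergence (fun _ => A + CH * B) (fun n => ?_)
    (integrable_const _) (fun n => ?_) ?_
  · refine AEStronglyMeasurable.restrict ?_
    rw [aestronglyMeasurable_indicator_iff measurableSet_Ioc]
    exact ((happ (φ n)).int.mono_set
      (Ioc_subset_Icc_self.trans (Icc_subset_Icc_right (hσmem n).2))).aestronglyMeasurable
  · have := ae_Ioc_of_ae_Ioo ((happ (φ n)).abs_le hH (h.mem' _) (h.cadlag' _) (hR _)) le_rfl le_rfl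
    refine ae_restrict_of_ae ?_
    filter_upwards [this] with s hs
    by_cases hm : s ∈ Ioc (t (φ n)) (σ n)
    · rw [indicator_of_mem hm]
      have hm' : s ∈ Ioc (t (φ n)) T := ⟨hm.1, hm.2.trans (hσmem n).2⟩
      refine (hs hm').trans ?_
      have := mul_le_mul_of_nonneg_left (hyB (φ n) s ⟨hm'.1.le, hm'.2⟩) hC
      linarith
    · rw [indicator_of_notMem hm, norm_zero]
      positivity
  · have hham : ∀ᵐ s, ∀ n, s ∈ Ioc (t (φ n)) T → |a (φ n) s - H s (x (φ n)) (η (φ n) s) z| ≤ ε (φ n)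
        ∧ |η (φ n) s - y (φ n) s| ≤ ε (φ n) :=
      ae_all_iff.2 fun n => ae_Ioc_of_ae_Ioo (happ (φ n)).ham le_rfl le_rfl
    have hne : ∀ᵐ s, s ≠ t₀ ∧ s ≠ τ :=
      (Measure.ae_ne volume t₀).and (Measure.ae_ne volume τ)
    filter_upwards [hcomp.tendsto_ham hH z, ae_restrict_of_ae hham, ae_restrict_of_ae hne,
      ae_restrict_mem measurableSet_Ioo] with s h1 h2 h3 hs
    rcases lt_or_gt_of_ne h3.1 with h4 | h4
    · rw [indicator_of_notMem fun hm => absurd hm.1 (not_lt.2 h4.le)]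
      refine tendsto_const_nhds.congr' ?_
      filter_upwards [htφ.eventually (lt_mem_nhds h4)] with n hn
      rw [indicator_of_notMem fun hm => absurd hm.1 (not_lt.2 hn.le)]
    rcases lt_or_gt_of_ne h3.2 with h5 | h5
    swap
    · rw [indicator_of_notMem fun hm => absurd hm.2 (not_le.2 h5)]
      refine tendsto_const_nhds.congr' ?_
      filter_upwards [hσlim.eventually (gt_mem_nhds h5)] with n hn
      rw [indicator_of_notMem fun hm => absurd hm.2 (not_le.2 hn)]
    rw [indicator_of_mem (show s ∈ Ioc t₀ τ from ⟨h4, h5.le⟩)]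
    have hts := htφ.eventually (gt_mem_nhds h4)
    have hεφ : Tendsto (fun n => ε (φ n)) atTop (𝓝 0) := hε.comp hφ.tendsto_atTop
    have hy : Tendsto (fun n => y (φ n) s) atTop (𝓝 (Y s)) :=
      hconv (fun _ => s) s ⟨h4.le, hs.2.le⟩
        (by filter_upwards [hts] with n hn using ⟨hn.le, hs.2.le⟩) tendsto_const_nhds
    have hη : Tendsto (fun n => η (φ n) s) atTop (𝓝 (Y s)) := by
      have h0 : Tendsto (fun n => η (φ n) s - y (φ n) s) atTop (𝓝 0) := by
        refine squeeze_zero_norm' ?_ hεφ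
        filter_upwards [hts] with n hn
        exact (h2 n ⟨hn, hs.2.le⟩).2
      simpa using h0.add hy
    have hHl := h1 (fun n => η (φ n) s) (Y s) hη
    have h0 : Tendsto (fun n => a (φ n) s - H s ((x ∘ φ) n) (η (φ n) s) z) atTop (𝓝 0) := by
      refine squeeze_zero_norm' ?_ hεφ
      filter_upwards [hts] with n hn
      exact (h2 n ⟨hn, hs.2.le⟩).1
    have h6 := h0.add hHl
    simp only [sub_add_cancel, zero_add] at h6
    refine h6.congr' ?_
    filter_upwards [hts, hσlim.eventually (lt_mem_nhds h5)] with n hn hn'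
    exact (indicator_of_mem (show s ∈ Ioc (t (φ n)) (σ n) from ⟨hn, hn'.le⟩) _).symm

theorem IsChar.approxEq {s₀ y₀ : ℝ} {x₀ x : Path d} {y : ℝ → ℝ} {z : E d}
    (hH : HamHyp T d H LH CH M) (hs₀ : 0 ≤ s₀)
    (h : IsChar T d H LH s₀ x₀ y₀ z x y) :
    ApproxEq T d H s₀ y₀ z x y (fun s => H s x (y s) z) y 0 where
  nonneg := le_rfl
  le_one := zero_le_one
  int := hH.integrableOn h.cadlag hs₀ le_rfl h.cont z
  eq := h.eq
  ham := by simp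

/-- Sequential compactness of the sets of characteristics. -/
theorem exists_subseq_isChar (hH : HamHyp T d H LH CH M) {t₀ y₀ : ℝ} {x₀ : Path d} {z : E d}
    (ht₀ : t₀ ∈ Icc 0 T) (hx₀ : x₀ ∈ Cadlag T d) {t r : ℕ → ℝ} {ξ x : ℕ → Path d} {y : ℕ → ℝ → ℝ}
    (ht : ∀ n, t n ∈ Icc 0 T) (hchar : ∀ n, IsChar T d H LH (t n) (ξ n) (r n) z (x n) (y n))
    (hlim : Tendsto (fun n => dInf T d (t₀, x₀) (t n, ξ n)) atTop (𝓝 0))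
    (hr : Tendsto r atTop (𝓝 y₀)) :
    ∃ (X : Path d) (Y : ℝ → ℝ) (φ : ℕ → ℕ), StrictMono φ ∧ IsChar T d H LH t₀ x₀ y₀ z X Y ∧
      ∀ (σ : ℕ → ℝ), ∀ τ ∈ Icc t₀ T, (∀ᶠ n in atTop, σ n ∈ Icc (t (φ n)) T) →
        Tendsto σ atTop (𝓝 τ) →
        Tendsto (fun n => dInf T d (τ, X) (σ n, x (φ n))) atTop (𝓝 0) ∧
        Tendsto (fun n => y (φ n) (σ n)) atTop (𝓝 (Y τ)) := by
  have hlim' : Tendsto (fun n => dInf T d (t₀, x₀) (t n, x n)) atTop (𝓝 0) := by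
    refine hlim.congr fun n => ?_
    simp only [dInf, stopDist]
    congr 2
    exact image_congr fun q hq => by
      rw [(hchar n).init _ ⟨le_min hq.1 (ht n).1, min_le_right _ _⟩]
  obtain ⟨X, φ, hφ, hinit, hconv⟩ := exists_pathConv hH.lipZ.1 ht₀ hx₀ ht
    (fun n => (hchar n).cadlag) (fun n => (hchar n).growth) hlim'
  obtain ⟨Y, ψ, hψ, hY, hconvY⟩ := hconv.exists_subseq_eq hH (hr.comp hφ.tendsto_atTop)
    (tendsto_const_nhds (x := (0 : ℝ))) fun n => (hchar (φ n)).approxEq hH (ht _).1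
  refine ⟨X, Y, φ ∘ ψ, hφ.comp hψ, ⟨hY.cadlag, hinit, hY.growth, hY.cont, hY.eq⟩,
    fun σ τ hτ hσ hστ => ⟨?_, hconvY σ τ hτ hσ hστ⟩⟩
  exact (hconv.comp hψ).conv σ τ hτ hσ hστ

end

section

variable {T : ℝ} {d : ℕ} {H : Ham d} {LH CH : ℝ} {M : ℝ → ℝ}

/-! ### An Euler scheme -/

/-- The equation for the second component of a characteristic, up to an error `ε`, for an
approximation that is stopped at time `τ`. -/
structure StoppedEq (T : ℝ) (d : ℕ) (H : Ham d) (t₀ τ y₀ : ℝ) (z : E d) (x : Path d)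
    (y a η : ℝ → ℝ) (ε : ℝ) : Prop where
  int : IntegrableOn a (Icc t₀ T) volume
  eq : ∀ t ∈ Icc t₀ T, y t = y₀ + ⟪x t - x t₀, z⟫_ℝ - ∫ s in t₀..t, a s
  zero : ∀ s, τ < s → a s = 0
  ham : ∀ᵐ s ∂(volume.restrict (Ioo t₀ τ)), |a s - H s x (η s) z| ≤ ε ∧ |η s - y s| ≤ ε

theorem StoppedEq.bound (hH : HamHyp T d H LH CH M) {t₀ τ y₀ R ε : ℝ} {z : E d} {x : Path d}
    {y a η : ℝ → ℝ} (h : StoppedEq T d H t₀ τ y₀ z x y a η ε) (hε : ε ≤ 1) (ht₀ : t₀ ∈ Icc 0 T)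
    (hx : x ∈ Cadlag T d) (hg : GrowthLip T d LH t₀ x) (hR0 : 0 ≤ R)
    (hR : ∀ t ≤ T, runSup d x t ≤ R) {t : ℝ} (ht : t ∈ Icc t₀ T) :
    |y t| ≤ (|y₀| + (2 * R * ‖z‖ + (1 + (CH * (1 + R) + LH * (1 + R) * ‖z‖) + CH) * T))
      * Real.exp (CH * T) := by
  have hL := hH.lipZ.1
  have hC := hH.bound.1
  have hT := hH.pos.le
  have hyc : ContinuousOn y (Icc t₀ T) :=
    (continuousOn_sub_primitive ht₀.2 (hg.continuousOn hL hx) h.int).congr h.eq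
  have hy0 : y t₀ = y₀ := by simpa using h.eq t₀ ⟨le_rfl, ht₀.2⟩
  have hab : ∀ᵐ s ∂(volume.restrict (Ioo t₀ T)),
      |a s| ≤ (1 + (CH * (1 + R) + LH * (1 + R) * ‖z‖) + CH) + CH * |y s| := by
    filter_upwards [ae_restrict_of_ae (ae_Ioc_of_ae_Ioo h.ham le_rfl le_rfl),
      ae_restrict_mem measurableSet_Ioo,
      ae_Ioo_mono (hH.affine_bound hx hR z) ht₀.1 le_rfl] with s hs hmem hs'
    rcases le_or_gt s τ with hsτ | hsτ
    · have hs := hs ⟨hmem.1, hsτ⟩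
      have h1 := hs' (η s)
      have h2 := abs_sub_abs_le_abs_sub (a s) (H s x (η s) z)
      have h3 := abs_sub_abs_le_abs_sub (η s) (y s)
      have h4 := mul_le_mul_of_nonneg_left (show |η s| ≤ 1 + |y s| by linarith [hs.2]) hC
      linarith [hs.1, hs.2]
    · rw [h.zero s hsτ, abs_zero]
      positivity
  have := (abs_le_exp_of_increment_le hyc (T := T)
    (c := 2 * R * ‖z‖ + (1 + (CH * (1 + R) + LH * (1 + R) * ‖z‖) + CH) * T) (by positivity) hC
    (by linarith [ht₀.1])
    (fun s t hs hst ht => abs_increment_le (T := T)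
      (fun r hr => (norm_le_runSup hx (ht₀.1.trans hr.1) hr.2 le_rfl).trans (hR T le_rfl))
      (by linarith [ht₀.1]) (by positivity) hyc h.int hab h.eq hs hst ht) ht).1
  rwa [hy0] at this

theorem intervalIntegral_indicator_Ioc_of_le {F : Type*} [NormedAddCommGroup F] [NormedSpace ℝ F]
    (f : ℝ → F) {a b s t : ℝ} (hs : s ≤ a) (ht : t ≤ a) :
    ∫ r in s..t, (Ioc a b).indicator f r = 0 := by
  refine intervalIntegral.integral_zero_ae (Eventually.of_forall fun r hr => ?_)
  exact indicator_of_notMem (fun hm => absurd hm.1 (not_lt.2 (hr.2.trans (max_le hs ht)))) f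

theorem HamHyp.integrableOn_const (hH : HamHyp T d H LH CH M) {x : Path d} (hx : x ∈ Cadlag T d)
    {t₀ : ℝ} (ht₀ : 0 ≤ t₀) (v : ℝ) (z : E d) :
    IntegrableOn (fun s => H s x v z) (Icc t₀ T) volume :=
  hH.integrableOn hx ht₀ le_rfl continuousOn_const z

theorem StoppedEq.const {t₀ τ y₀ ε : ℝ} {z : E d} {x : Path d} {y a η : ℝ → ℝ}
    (h : StoppedEq T d H t₀ τ y₀ z x y a η ε) (hτ : τ ∈ Icc t₀ T)
    (hst : ∀ t ∈ Icc τ T, x t = x τ) {t : ℝ} (ht : t ∈ Icc τ T) : y t = y τ := by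
  have hl : t₀ ∈ Icc t₀ T := ⟨le_rfl, hτ.1.trans hτ.2⟩
  have ht' : t ∈ Icc t₀ T := ⟨hτ.1.trans ht.1, ht.2⟩
  rw [h.eq t ht', h.eq τ hτ, hst t ht, ← intervalIntegral.integral_add_adjacent_intervals
    (intervalIntegrable_of_Icc h.int hl hτ) (intervalIntegrable_of_Icc h.int hτ ht')]
  have : ∫ s in τ..t, a s = 0 := by
    refine intervalIntegral.integral_zero_ae (Eventually.of_forall fun r hr => h.zero r ?_)
    rw [uIoc_of_le ht.1] at hr
    exact hr.1
  rw [this, add_zero]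

theorem StoppedEq.step (hH : HamHyp T d H LH CH M) {t₀ τ τ' y₀ R B ε : ℝ} {z : E d}
    {x x' : Path d} {y y' a η : ℝ → ℝ} (h : StoppedEq T d H t₀ τ y₀ z x y a η ε)
    (ht₀ : t₀ ∈ Ico 0 T) (hτ : τ ∈ Icc t₀ T) (hτ' : τ' ∈ Icc τ T)
    (hx : x ∈ Cadlag T d) (hx' : x' ∈ Cadlag T d)
    (hg : GrowthLip T d LH t₀ x) (hg' : GrowthLip T d LH t₀ x')
    (hxx : ∀ t ∈ Icc 0 τ, x t = x' t) (hst : ∀ t ∈ Icc τ T, x t = x τ) (hR0 : 0 ≤ R)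
    (hR : ∀ t ≤ T, runSup d x t ≤ R) (hR' : ∀ t ≤ T, runSup d x' t ≤ R)
    (hB : ∀ t ∈ Icc t₀ T, |y t| ≤ B)
    (hy' : ∀ t ∈ Icc t₀ T, y' t = y t + ⟪x' t - x t, z⟫_ℝ -
      ∫ s in τ..t, (Ioc τ τ').indicator (fun s => H s x (y τ) z) s)
    (hK₁ : (LH * (1 + R) * ‖z‖ + (CH * (1 + R) + LH * (1 + R) * ‖z‖ + CH * B)) * (τ' - τ) ≤ ε)
    (hK₂ : M LH * (1 + B + ‖z‖) * (LH * (1 + R) * (τ' - τ)) ≤ ε) :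
    StoppedEq T d H t₀ τ' y₀ z x' y'
      (fun s => a s + (Ioc τ τ').indicator (fun s => H s x (y τ) z) s)
      (fun s => if s ≤ τ then η s else y τ) ε := by
  have hL := hH.lipZ.1
  have hC := hH.bound.1
  have hl : t₀ ∈ Icc t₀ T := ⟨le_rfl, ht₀.2.le⟩
  have hB0 : 0 ≤ B := (abs_nonneg _).trans (hB t₀ hl)
  set f : ℝ → ℝ := (Ioc τ τ').indicator (fun s => H s x (y τ) z) with hf
  have hfint : IntegrableOn f (Icc t₀ T) volume :=
    (hH.integrableOn_const hx ht₀.1 (y τ) z).indicator measurableSet_Ioc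
  have hdiff : ∀ s ∈ Icc τ T, ‖x' s - x s‖ ≤ LH * (1 + R) * (s - τ) := by
    intro s hs
    rw [hst s hs, hxx τ ⟨ht₀.1.trans hτ.1, le_rfl⟩]
    refine (hg'.norm_sub_le hL hR' hτ ⟨hτ.1.trans hs.1, hs.2⟩).trans_eq ?_
    rw [abs_of_nonneg (sub_nonneg.2 hs.1)]
  refine ⟨h.int.add hfint, fun t ht => ?_, fun s hs => ?_, ?_⟩
  · rw [hy' t ht, h.eq t ht, ← hxx t₀ ⟨ht₀.1, hτ.1⟩, intervalIntegral.integral_add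
      (intervalIntegrable_of_Icc h.int hl ht) (intervalIntegrable_of_Icc hfint hl ht),
      ← intervalIntegral.integral_add_adjacent_intervals
      (intervalIntegrable_of_Icc hfint hl hτ) (intervalIntegrable_of_Icc hfint hτ ht),
      hf, intervalIntegral_indicator_Ioc_of_le _ hτ.1 le_rfl]
    have : x' t - x t₀ = (x t - x t₀) + (x' t - x t) := by abel
    rw [this, inner_add_left (x t - x t₀)]
    ring
  · rw [h.zero s (hτ'.1.trans_lt hs), zero_add, hf]
    exact indicator_of_notMem (fun hm => absurd hm.2 (not_le.2 hs)) _
  have hXx : x ∈ XSet T d LH t₀ x := (mem_XSet_iff hL ht₀.1 ht₀.2.le).2 ⟨hx, fun _ _ => rfl, hg⟩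
  have hXx' : x' ∈ XSet T d LH t₀ x := (mem_XSet_iff hL ht₀.1 ht₀.2.le).2
    ⟨hx', fun t ht => (hxx t ⟨ht.1, ht.2.trans hτ.1⟩).symm, hg'⟩
  rw [ae_restrict_iff' measurableSet_Ioo]
  have hlip := (hH.lipX LH hL).2 t₀ ht₀ x hx x hXx x' hXx' (y τ) z
  have hM := (hH.lipX LH hL).1
  have haff := hH.affine_bound hx hR z
  have hfb : ∀ᵐ s, s ∈ Ioc τ τ' →
      ‖f s‖ ≤ CH * (1 + R) + LH * (1 + R) * ‖z‖ + CH * B := by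
    filter_upwards [ae_Ioc_of_ae_Ioo haff (ht₀.1.trans hτ.1) hτ'.2] with s hs hmem
    rw [hf, indicator_of_mem hmem]
    have := mul_le_mul_of_nonneg_left (hB τ hτ) hC
    exact (hs hmem (y τ)).trans (by linarith)
  filter_upwards [ae_Ioc_of_ae_Ioo h.ham le_rfl le_rfl,
    ae_Ioc_of_ae_Ioo (hH.ae_congr ht₀ hτ.2 hx hx' hg hg' hxx z) le_rfl le_rfl,
    ae_Ioc_of_ae_Ioo hlip le_rfl hτ'.2] with s h1 h2 h3 hmem
  have hsT : s ∈ Icc t₀ T := ⟨hmem.1.le, hmem.2.le.trans hτ'.2⟩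
  rcases le_or_gt s τ with hsτ | hsτ
  · have e1 : y' s = y s := by
      rw [hy' s hsT, hf, intervalIntegral_indicator_Ioc_of_le _ le_rfl hsτ,
        hxx s ⟨ht₀.1.trans hsT.1, hsτ⟩]
      simp
    have e2 : f s = 0 := indicator_of_notMem (fun hm => absurd hm.1 (not_lt.2 hsτ)) _
    simp only [e1, e2, if_pos hsτ, add_zero, ← h2 ⟨hmem.1, hsτ⟩]
    exact h1 ⟨hmem.1, hsτ⟩
  · have hm : s ∈ Ioc τ τ' := ⟨hsτ, hmem.2.le⟩
    have hs1 : s ∈ Icc τ T := ⟨hsτ.le, hsT.2⟩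
    have e2 : f s = H s x (y τ) z := indicator_of_mem hm _
    have hsub : s - τ ≤ τ' - τ := by linarith [hm.2]
    have hsub0 : 0 ≤ s - τ := by linarith
    simp only [e2, h.zero s hsτ, if_neg (not_le.2 hsτ), zero_add]
    constructor
    · refine (h3 ⟨hmem.1, hm.2⟩).trans (le_trans ?_ hK₂)
      have h4 : sSup ((fun r => ‖x r - x' r‖) '' Icc 0 s) ≤ LH * (1 + R) * (τ' - τ) := by
        refine sSup_image_Icc_le (mul_nonneg (by positivity) (hsub0.trans hsub)) fun r hr => ?_
        rcases le_or_gt r τ with hrτ | hrτ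
        · rw [hxx r ⟨hr.1, hrτ⟩, sub_self, norm_zero]
          exact mul_nonneg (by positivity) (hsub0.trans hsub)
        · rw [norm_sub_rev]
          refine (hdiff r ⟨hrτ.le, hr.2.trans hsT.2⟩).trans ?_
          have : r - τ ≤ τ' - τ := by linarith [hr.2]
          gcongr
      have h5 : M LH * (1 + |y τ| + ‖z‖) ≤ M LH * (1 + B + ‖z‖) := by
        have := hB τ hτ
        gcongr
      exact mul_le_mul h5 h4 (sSup_image_norm_nonneg (fun r => x r - x' r) _) (by positivity)
    · rw [hy' s hsT, h.const hτ hst hs1]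
      have h4 : |⟪x' s - x s, z⟫_ℝ| ≤ LH * (1 + R) * (s - τ) * ‖z‖ :=
        (abs_real_inner_le_norm _ _).trans
          (mul_le_mul_of_nonneg_right (hdiff s hs1) (norm_nonneg _))
      have h5 : ‖∫ r in τ..s, f r‖ ≤
          (CH * (1 + R) + LH * (1 + R) * ‖z‖ + CH * B) * |s - τ| := by
        refine intervalIntegral.norm_integral_le_of_norm_le_const_ae ?_
        filter_upwards [hfb] with r hr hmem
        rw [uIoc_of_le hsτ.le] at hmem
        exact hr ⟨hmem.1, hmem.2.trans hm.2⟩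
      rw [abs_of_nonneg hsub0, Real.norm_eq_abs] at h5
      have h6 : |y τ - (y τ + ⟪x' s - x s, z⟫_ℝ - ∫ r in τ..s, f r)| ≤
          |⟪x' s - x s, z⟫_ℝ| + |∫ r in τ..s, f r| := by
        have e : y τ - (y τ + ⟪x' s - x s, z⟫_ℝ - ∫ r in τ..s, f r) =
          -(⟪x' s - x s, z⟫_ℝ - ∫ r in τ..s, f r) := by ring
        rw [e, abs_neg]
        exact abs_sub _ _
      refine h6.trans (le_trans ?_ hK₁)
      have h7 : (LH * (1 + R) * ‖z‖ + (CH * (1 + R) + LH * (1 + R) * ‖z‖ + CH * B)) * (s - τ) ≤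
          (LH * (1 + R) * ‖z‖ + (CH * (1 + R) + LH * (1 + R) * ‖z‖ + CH * B)) * (τ' - τ) := by
        gcongr
      linarith

end

section

variable {T : ℝ} {d : ℕ} {H : Ham d} {LH CH : ℝ} {M : ℝ → ℝ}

/-! ### Common characteristics -/

theorem exists_euler_path (hH : HamHyp T d H LH CH M) {t₀ τ τ' v : ℝ} {x : Path d} {z z' : E d}
    (ht₀ : t₀ ∈ Ico 0 T) (hτ : τ ∈ Icc t₀ T) (hτ' : τ' ∈ Icc τ T) (hx : x ∈ Cadlag T d)
    (hg : GrowthLip T d LH t₀ x) (hst : ∀ t ∈ Icc τ T, x t = x τ) :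
    ∃ x' ∈ Cadlag T d, GrowthLip T d LH t₀ x' ∧ (∀ t ∈ Icc 0 τ, x t = x' t) ∧
      (∀ t ∈ Icc τ' T, x' t = x' τ') ∧
      ∀ t ∈ Icc t₀ T, ⟪x' t - x t, z⟫_ℝ - ∫ s in τ..t, (Ioc τ τ').indicator (fun s => H s x v z) s
        = ⟪x' t - x t, z'⟫_ℝ - ∫ s in τ..t, (Ioc τ τ').indicator (fun s => H s x v z') s := by
  have hL := hH.lipZ.1
  have hτ0 : 0 ≤ τ := ht₀.1.trans hτ.1
  set c : ℝ → ℝ := fun s => (H s x v z - H s x v z') / ‖z - z'‖ ^ 2 with hc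
  set g : Path d := (Ioc τ τ').indicator (fun s => c s • (z - z')) with hgdef
  have hf := hH.integrableOn_const hx ht₀.1 v z
  have hf' := hH.integrableOn_const hx ht₀.1 v z'
  have hgint : IntegrableOn g (Icc t₀ T) volume :=
    (((hf.sub hf').div_const _).smul_const (z - z')).indicator measurableSet_Ioc
  have hii : ∀ t ∈ Icc t₀ T, IntervalIntegrable g volume τ t := fun t ht =>
    intervalIntegrable_iff.2 (hgint.mono_set
      (uIoc_subset_uIcc.trans (uIcc_subset_Icc hτ ht)))
  set x' : Path d := fun t => x t + ∫ s in τ..t, g s with hx'def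
  have hxx : ∀ t ≤ τ, x' t = x t := fun t ht => by
    simp only [hx'def, hgdef, intervalIntegral_indicator_Ioc_of_le _ le_rfl ht, add_zero]
  have hcont : ContinuousOn x' (Icc τ T) := by
    refine ((continuousOn_const (c := x τ)).congr hst).add ?_
    have := intervalIntegral.continuousOn_primitive_interval (μ := volume) (f := g) (a := τ)
      (b := T) (by
        rw [uIcc_of_le hτ.2]
        exact hgint.mono_set (Icc_subset_Icc_left hτ.1))
    rwa [uIcc_of_le hτ.2] at this
  have hx' : x' ∈ Cadlag T d := Cadlag.of_glue hx (fun t ht => hxx t ht.2) hcont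
  have hrun : ∀ s ≤ T, runSup d x s ≤ runSup d x' s := by
    intro s hs
    refine runSup_le (runSup_nonneg _ _) fun r hr => ?_
    rcases le_total r τ with hrτ | hrτ
    · rw [← hxx r hrτ]
      exact norm_le_runSup hx' hr.1 hr.2 hs
    · rw [hst r ⟨hrτ, hr.2.trans hs⟩, ← hxx τ le_rfl]
      exact norm_le_runSup hx' hτ0 (hrτ.trans hr.2) hs
  have hder : XDeriv T d LH τ x' g := by
    refine ⟨hgint.mono_set (Icc_subset_Icc_left hτ.1), fun t ht => ?_, ?_⟩
    · rw [hxx τ le_rfl, ← hst t ht]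
    · filter_upwards [ae_Ioo_mono hH.lipZ.2 hτ0 le_rfl, ae_restrict_mem measurableSet_Ioo]
        with s hs hmem
      have h0 := runSup_nonneg x' s
      by_cases hm : s ∈ Ioc τ τ'
      · rw [hgdef, indicator_of_mem hm, norm_smul]
        have h1 : ‖c s‖ * ‖z - z'‖ ≤ LH * (1 + runSup d x s) := by
          rcases eq_or_ne z z' with rfl | hne
          · have := runSup_nonneg x s
            simp only [sub_self, norm_zero, mul_zero]
            positivity
          · have hpos : 0 < ‖z - z'‖ := norm_pos_iff.2 (sub_ne_zero.2 hne)
            have e : ‖c s‖ * ‖z - z'‖ = |H s x v z - H s x v z'| / ‖z - z'‖ := by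
              rw [hc, Real.norm_eq_abs, abs_div, abs_of_pos (pow_pos hpos 2)]
              field_simp
            rw [e, div_le_iff₀ hpos]
            exact hs x hx v z z'
        have := hrun s hmem.2.le
        exact h1.trans (by gcongr)
      · rw [hgdef, indicator_of_notMem hm, norm_zero]
        positivity
  refine ⟨x', hx', GrowthLip.concat hL hx' (fun t ht => hxx t ht.2) ht₀.1 hg
    (hder.growthLip hL hx'), fun t ht => (hxx t ht.2).symm, fun t ht => ?_, fun t ht => ?_⟩
  · have ht1 : t ∈ Icc τ T := ⟨hτ'.1.trans ht.1, ht.2⟩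
    have e : ∫ s in τ'..t, g s = 0 := by
      refine intervalIntegral.integral_zero_ae (Eventually.of_forall fun r hr => ?_)
      rw [uIoc_of_le ht.1] at hr
      exact indicator_of_notMem (fun hm => absurd hm.2 (not_le.2 hr.1)) _
    have ht2 : t ∈ Icc t₀ T := ⟨hτ.1.trans ht1.1, ht.2⟩
    have hτ2 : τ' ∈ Icc t₀ T := ⟨hτ.1.trans hτ'.1, hτ'.2⟩
    have e2 := intervalIntegral.integral_interval_sub_left (hii t ht2) (hii τ' hτ2)
    rw [e, sub_eq_zero] at e2
    simp only [hx'def]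
    rw [hst t ht1, hst τ' hτ', e2]
  · have e1 : x' t - x t = ∫ s in τ..t, g s := by simp [hx'def]
    have hind : ∀ w : E d, IntervalIntegrable
        ((Ioc τ τ').indicator (fun s => H s x v w)) volume τ t := fun w =>
      intervalIntegrable_of_Icc
        ((hH.integrableOn_const hx ht₀.1 v w).indicator measurableSet_Ioc) hτ ht
    have e2 : ⟪x' t - x t, z - z'⟫_ℝ =
        (∫ s in τ..t, (Ioc τ τ').indicator (fun s => H s x v z) s) -
          ∫ s in τ..t, (Ioc τ τ').indicator (fun s => H s x v z') s := by
      rw [e1, ← intervalIntegral.integral_sub (hind z) (hind z'), real_inner_comm,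
        ← innerSL_apply_apply ℝ (z - z'),
        ← ContinuousLinearMap.intervalIntegral_comp_comm _ (hii t ht)]
      refine intervalIntegral.integral_congr fun s _ => ?_
      simp only [innerSL_apply_apply, hgdef]
      by_cases hm : s ∈ Ioc τ τ'
      · simp only [indicator_of_mem hm, inner_smul_right, real_inner_self_eq_norm_sq, hc]
        rcases eq_or_ne z z' with rfl | hne
        · simp
        · have hpos : ‖z - z'‖ ≠ 0 := norm_ne_zero_iff.2 (sub_ne_zero.2 hne)
          field_simp
      · simp [indicator_of_notMem hm]
    rw [inner_sub_right] at e2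
    linarith

/-- There is an approximate common characteristic for `z` and `z'` that is stopped at `τ`. -/
def EulerState (T : ℝ) (d : ℕ) (H : Ham d) (LH t₀ τ : ℝ) (x₀ : Path d) (y₀ : ℝ) (z z' : E d)
    (ε : ℝ) : Prop :=
  ∃ (x : Path d) (y a a' η : ℝ → ℝ), x ∈ Cadlag T d ∧ (∀ t ∈ Icc 0 t₀, x t = x₀ t) ∧
    GrowthLip T d LH t₀ x ∧ (∀ t ∈ Icc τ T, x t = x τ) ∧
    StoppedEq T d H t₀ τ y₀ z x y a η ε ∧ StoppedEq T d H t₀ τ y₀ z' x y a' η ε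

theorem EulerState.refl (hL : 0 ≤ LH) (t₀ : ℝ) {x₀ : Path d}
    (hx₀ : x₀ ∈ Cadlag T d) (y₀ : ℝ) (z z' : E d) (ε : ℝ) :
    EulerState T d H LH t₀ t₀ x₀ y₀ z z' ε := by
  have e : ∀ t ∈ Icc t₀ T, x₀ (min t t₀) = x₀ t₀ := fun t ht => by rw [min_eq_right ht.1]
  have heq : ∀ w : E d, StoppedEq T d H t₀ t₀ y₀ w (fun t => x₀ (min t t₀)) (fun _ => y₀)
      (fun _ => 0) (fun _ => 0) ε := fun w =>
    { int := integrableOn_zero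
      eq := fun t ht => by simp [e t ht]
      zero := fun _ _ => rfl
      ham := by simp }
  refine ⟨fun t => x₀ (min t t₀), fun _ => y₀, fun _ => 0, fun _ => 0, fun _ => 0,
    Cadlag.of_glue hx₀ (fun t ht => by rw [min_eq_left ht.2]) (continuousOn_const.congr e),
    fun t ht => by simp only [min_eq_left ht.2], fun s t hs hst ht => ?_,
    fun t ht => ?_, heq z, heq z'⟩
  · simp only [e t ⟨hs.trans hst, ht⟩, e s ⟨hs, hst.trans ht⟩, sub_self, norm_zero]
    have := sub_nonneg.2 hst
    have := runSup_nonneg (fun t => x₀ (min t t₀)) t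
    positivity
  · simp only [e t ht, min_self]

theorem EulerState.exists_step (hH : HamHyp T d H LH CH M) {t₀ : ℝ} (ht₀ : t₀ ∈ Ico 0 T)
    {x₀ : Path d} (y₀ : ℝ) (z z' : E d) :
    ∃ K, 0 ≤ K ∧ ∀ ε ≤ 1, ∀ τ ∈ Icc t₀ T, ∀ τ' ∈ Icc τ T, K * (τ' - τ) ≤ ε →
      EulerState T d H LH t₀ τ x₀ y₀ z z' ε → EulerState T d H LH t₀ τ' x₀ y₀ z z' ε := by
  have hL := hH.lipZ.1
  have hC := hH.bound.1
  have hM := (hH.lipX LH hL).1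
  have hT := hH.pos.le
  have h0 := runSup_nonneg x₀ t₀
  obtain ⟨R, hRdef⟩ : ∃ R, R = (1 + runSup d x₀ t₀) * Real.exp (LH * T) := ⟨_, rfl⟩
  have hR0 : 0 ≤ R := by rw [hRdef]; positivity
  have hR : ∀ x ∈ Cadlag T d, (∀ t ∈ Icc 0 t₀, x t = x₀ t) → GrowthLip T d LH t₀ x →
      ∀ t ≤ T, runSup d x t ≤ R := by
    intro x hx hi hg t ht
    rw [hRdef, ← runSup_congr hi]
    exact (runSup_mono hx ht le_rfl).trans
      (hg.runSup_le_gronwall hL hx ht₀.1 ⟨ht₀.2.le, le_rfl⟩)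
  let b : E d → ℝ := fun w =>
    (|y₀| + (2 * R * ‖w‖ + (1 + (CH * (1 + R) + LH * (1 + R) * ‖w‖) + CH) * T)) * Real.exp (CH * T)
  have hb0 : ∀ w, 0 ≤ b w := fun w => by positivity
  let k₁ : E d → ℝ := fun w => LH * (1 + R) * ‖w‖ + (CH * (1 + R) + LH * (1 + R) * ‖w‖ + CH * b w)
  let k₂ : E d → ℝ := fun w => M LH * (1 + b w + ‖w‖) * (LH * (1 + R))
  have hk₁ : ∀ w, 0 ≤ k₁ w := fun w => by have := hb0 w; positivity
  have hk₂ : ∀ w, 0 ≤ k₂ w := fun w => by have := hb0 w; positivity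
  refine ⟨k₁ z + k₂ z + k₁ z' + k₂ z', by linarith [hk₁ z, hk₂ z, hk₁ z', hk₂ z'], ?_⟩
  rintro ε hε τ hτ τ' hτ' hK ⟨x, y, a, a', η, hx, hi, hg, hst, hz, hz'⟩
  obtain ⟨x', hx', hg', hxx, hst', heq⟩ :=
    exists_euler_path hH (v := y τ) (z := z) (z' := z') ht₀ hτ hτ' hx hg hst
  have hi' : ∀ t ∈ Icc 0 t₀, x' t = x₀ t := fun t ht => by
    rw [← hxx t ⟨ht.1, ht.2.trans hτ.1⟩, hi t ht]
  have hsub := sub_nonneg.2 hτ'.1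
  have hm1 := mul_nonneg (hk₁ z) hsub
  have hm2 := mul_nonneg (hk₂ z) hsub
  have hm3 := mul_nonneg (hk₁ z') hsub
  have hm4 := mul_nonneg (hk₂ z') hsub
  have ht₀' : t₀ ∈ Icc 0 T := ⟨ht₀.1, ht₀.2.le⟩
  refine ⟨x', fun t => y t + (⟪x' t - x t, z⟫_ℝ -
      ∫ s in τ..t, (Ioc τ τ').indicator (fun s => H s x (y τ) z) s), _, _, _, hx', hi', hg', hst',
    hz.step hH ht₀ hτ hτ' hx hx' hg hg' hxx hst hR0 (hR x hx hi hg) (hR x' hx' hi' hg')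
      (B := b z) (fun t ht => hz.bound hH hε ht₀' hx hg hR0 (hR x hx hi hg) ht)
      (fun t ht => by ring) (le_trans (by linarith) hK) (le_trans ?_ hK),
    hz'.step hH ht₀ hτ hτ' hx hx' hg hg' hxx hst hR0 (hR x hx hi hg) (hR x' hx' hi' hg')
      (B := b z') (fun t ht => hz'.bound hH hε ht₀' hx hg hR0 (hR x hx hi hg) ht)
      (fun t ht => by rw [heq t ht]; ring) (le_trans (by linarith) hK) (le_trans ?_ hK)⟩
  · calc _ = k₂ z * (τ' - τ) := by ring
      _ ≤ _ := by linarith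
  · calc _ = k₂ z' * (τ' - τ) := by ring
      _ ≤ _ := by linarith

theorem EulerState.exists (hH : HamHyp T d H LH CH M) {t₀ : ℝ} (ht₀ : t₀ ∈ Ico 0 T)
    {x₀ : Path d} (hx₀ : x₀ ∈ Cadlag T d) (y₀ : ℝ) (z z' : E d) {ε : ℝ} (hε : 0 < ε)
    (hε1 : ε ≤ 1) : EulerState T d H LH t₀ T x₀ y₀ z z' ε := by
  obtain ⟨K, hK, hstep⟩ := EulerState.exists_step hH ht₀ (x₀ := x₀) y₀ z z'
  obtain ⟨δ, hδ, hKδ⟩ : ∃ δ > 0, K * δ ≤ ε :=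
    ⟨ε / (K + 1), by positivity, by
      rw [← mul_div_assoc, div_le_iff₀ (by positivity)]
      nlinarith⟩
  have key : ∀ k : ℕ, EulerState T d H LH t₀ (min (t₀ + k * δ) T) x₀ y₀ z z' ε := by
    intro k
    induction k with
    | zero =>
      simpa [ht₀.2.le] using EulerState.refl hH.lipZ.1 t₀ hx₀ y₀ z z' ε
    | succ k ih =>
      have hkδ : 0 ≤ k * δ := by positivity
      have hle : t₀ + k * δ ≤ t₀ + (k + 1 : ℕ) * δ := by
        push_cast
        linarith
      refine hstep ε hε1 _ ⟨le_min (by linarith) ht₀.2.le, min_le_right _ _⟩ _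
        ⟨min_le_min_right _ hle, min_le_right _ _⟩ (le_trans ?_ hKδ) ih
      refine mul_le_mul_of_nonneg_left ?_ hK
      rcases le_total (t₀ + k * δ) T with h | h
      · rw [min_eq_left h]
        have := min_le_left (t₀ + (k + 1 : ℕ) * δ) T
        push_cast at this ⊢
        linarith
      · rw [min_eq_right h]
        linarith [min_le_right (t₀ + (k + 1 : ℕ) * δ) T]
  obtain ⟨k, hk⟩ := exists_nat_ge ((T - t₀) / δ)
  rw [div_le_iff₀ hδ] at hk
  have := key k
  rwa [min_eq_right (by linarith)] at this

theorem StoppedEq.approxEq {t₀ y₀ ε : ℝ} {z : E d} {x : Path d} {y a η : ℝ → ℝ}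
    (h : StoppedEq T d H t₀ T y₀ z x y a η ε) (hε : 0 ≤ ε) (hε1 : ε ≤ 1) :
    ApproxEq T d H t₀ y₀ z x y a η ε := ⟨hε, hε1, h.int, h.eq, h.ham⟩

theorem IsChar.congr {s₀ y₀ : ℝ} {x₀ x : Path d} {y y' : ℝ → ℝ} {z : E d}
    (h : IsChar T d H LH s₀ x₀ y₀ z x y) (hy : ∀ t ∈ Icc s₀ T, y' t = y t) :
    IsChar T d H LH s₀ x₀ y₀ z x y' := by
  refine ⟨h.cadlag, h.init, h.growth, h.cont.congr hy, fun t ht => ?_⟩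
  rw [hy t ht, h.eq t ht]
  congr 1
  refine intervalIntegral.integral_congr fun s hs => ?_
  rw [uIcc_of_le ht.1] at hs
  simp only [hy s ⟨hs.1, hs.2.trans ht.2⟩]

/-- The sets of characteristics for two different vectors `z`, `z'` intersect. -/
theorem exists_common_isChar (hH : HamHyp T d H LH CH M) {t₀ : ℝ} (ht₀ : t₀ ∈ Ico 0 T)
    {x₀ : Path d} (hx₀ : x₀ ∈ Cadlag T d) (y₀ : ℝ) (z z' : E d) :
    ∃ (x : Path d) (y : ℝ → ℝ), IsChar T d H LH t₀ x₀ y₀ z x y ∧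
      IsChar T d H LH t₀ x₀ y₀ z' x y := by
  have hε0 : ∀ n : ℕ, (0 : ℝ) < 1 / (n + 1) := fun n => Nat.one_div_pos_of_nat
  have hε1 : ∀ n : ℕ, (1 : ℝ) / (n + 1) ≤ 1 := fun n => by
    rw [div_le_one (by positivity)]
    linarith [n.cast_nonneg (α := ℝ)]
  have ht₀' : t₀ ∈ Icc 0 T := ⟨ht₀.1, ht₀.2.le⟩
  choose x y a a' η hx hi hg _ hz hz' using
    fun n : ℕ => EulerState.exists hH ht₀ hx₀ y₀ z z' (hε0 n) (hε1 n)
  have hd : ∀ n, dInf T d (t₀, x₀) (t₀, x n) = 0 := fun n => by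
    rw [dInf_congr_left ht₀' (fun r hr => (hi n r hr).symm), dInf_self]
  obtain ⟨X, φ, hφ, hXi, hconv⟩ := exists_pathConv hH.lipZ.1 ht₀' hx₀ (fun _ => ht₀') hx hg
    (by simp only [hd]; exact tendsto_const_nhds)
  have hlim := tendsto_one_div_add_atTop_nhds_zero_nat (𝕜 := ℝ)
  obtain ⟨Y, φ₁, hφ₁, hY, hYlim⟩ := hconv.exists_subseq_eq hH (r := fun _ => y₀)
    tendsto_const_nhds (hlim.comp hφ.tendsto_atTop)
    (fun n => (hz (φ n)).approxEq (hε0 _).le (hε1 _))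
  obtain ⟨Y', φ₂, hφ₂, hY', hYlim'⟩ := (hconv.comp hφ₁).exists_subseq_eq hH (r := fun _ => y₀)
    tendsto_const_nhds ((hlim.comp hφ.tendsto_atTop).comp hφ₁.tendsto_atTop)
    (fun n => (hz' (φ (φ₁ n))).approxEq (hε0 _).le (hε1 _))
  have hYY : ∀ τ ∈ Icc t₀ T, Y τ = Y' τ := by
    intro τ hτ
    have h1 := hYlim (fun _ => τ) τ hτ (Eventually.of_forall fun _ => hτ) tendsto_const_nhds
    have h2 := hYlim' (fun _ => τ) τ hτ (Eventually.of_forall fun _ => hτ) tendsto_const_nhds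
    exact tendsto_nhds_unique (h1.comp hφ₂.tendsto_atTop) h2
  have hinit : ∀ {w : E d} {Z : ℝ → ℝ}, IsChar T d H LH t₀ X y₀ w X Z →
      IsChar T d H LH t₀ x₀ y₀ w X Z := fun h =>
    ⟨h.cadlag, hXi, h.growth, h.cont, h.eq⟩
  exact ⟨X, Y, hinit hY, hinit (hY'.congr hYY)⟩

end

section

variable {T : ℝ} {d : ℕ} {H : Ham d} {LH CH : ℝ} {M : ℝ → ℝ}

/-! ### Perron's method -/

/-- The one-step viability property of non-continuous minimax supersolutions. -/
def StepSuper (T : ℝ) (d : ℕ) (H : Ham d) (LH : ℝ) (u : ℝ → Path d → EReal) : Prop :=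
  ∀ t₀ ∈ Ico (0 : ℝ) T, ∀ x₀ ∈ Cadlag T d, ∀ (z : E d) (y₀ : ℝ), u t₀ x₀ < (y₀ : EReal) →
    ∀ τ ∈ Ioc t₀ T, ∀ ε > (0 : ℝ), ∃ (x : Path d) (y : ℝ → ℝ),
      IsChar T d H LH t₀ x₀ y₀ z x y ∧ u τ x < ((y τ + ε : ℝ) : EReal)

/-- The one-step viability property of non-continuous minimax subsolutions. -/
def StepSub (T : ℝ) (d : ℕ) (H : Ham d) (LH : ℝ) (u : ℝ → Path d → EReal) : Prop :=
  ∀ t₀ ∈ Ico (0 : ℝ) T, ∀ x₀ ∈ Cadlag T d, ∀ (z : E d) (y₀ : ℝ), (y₀ : EReal) < u t₀ x₀ →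
    ∀ τ ∈ Ioc t₀ T, ∀ ε > (0 : ℝ), ∃ (x : Path d) (y : ℝ → ℝ),
      IsChar T d H LH t₀ x₀ y₀ z x y ∧ ((y τ - ε : ℝ) : EReal) < u τ x

theorem EReal_sub_coe_lt_coe {a : EReal} {b c : ℝ} :
    a - (b : EReal) < (c : EReal) ↔ a < ((b + c : ℝ) : EReal) := by
  induction a with
  | bot => simp [EReal.bot_lt_coe]
  | top => simp
  | coe a =>
    norm_cast
    exact sub_lt_iff_lt_add'

theorem ncSuper_iff (hH : HamHyp T d H LH CH M) {h : Path d → ℝ} {u : ℝ → Path d → EReal} :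
    NCSuper T d H h LH u ↔
      (∀ x ∈ Cadlag T d, u T x = ((h x : ℝ) : EReal)) ∧ StepSuper T d H LH u := by
  refine and_congr_right fun _ => ⟨fun hu => ?_, fun hu => ?_⟩
  · intro t₀ ht₀ x₀ hx₀ z y₀ hy₀ τ hτ ε hε
    have h1 := (hu t₀ ht₀ x₀ hx₀ z y₀ hy₀ τ hτ).trans_lt (EReal.coe_pos.2 hε)
    obtain ⟨_, ⟨p, hp, rfl⟩, hlt⟩ := sInf_lt_iff.1 h1
    exact ⟨p.1, p.2, (mem_YSet_iff hH ⟨ht₀.1, ht₀.2.le⟩).1 hp, EReal_sub_coe_lt_coe.1 hlt⟩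
  · intro t₀ ht₀ x₀ hx₀ z y₀ hy₀ τ hτ
    by_contra! hcon
    obtain ⟨ε, hε, hεlt⟩ := EReal.lt_iff_exists_real_btwn.1 hcon
    obtain ⟨x, y, hxy, hlt⟩ := hu t₀ ht₀ x₀ hx₀ z y₀ hy₀ τ hτ ε (EReal.coe_pos.1 hε)
    exact absurd hεlt (not_lt.2 ((sInf_le (mem_image_of_mem _
      ((mem_YSet_iff hH ⟨ht₀.1, ht₀.2.le⟩ (p := (x, y))).2 hxy))).trans
      (EReal_sub_coe_lt_coe.2 hlt).le))

theorem uZero_le {h : Path d → ℝ} {u : ℝ → Path d → EReal} (hu : NCSuper T d H h LH u) (t : ℝ)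
    (x : Path d) : uZero T d H h LH t x ≤ u t x :=
  sInf_le ⟨u, hu, rfl⟩

theorem uZero_terminal (h : Path d → ℝ) {x : Path d} (hx : x ∈ Cadlag T d) :
    uZero T d H h LH T x = ((h x : ℝ) : EReal) := by
  classical
  have htop : NCSuper T d H h LH (fun t x => if t = T then ((h x : ℝ) : EReal) else ⊤) :=
    ⟨fun x _ => by simp, fun t₀ ht₀ x₀ _ z y₀ hy₀ => by simp [ht₀.2.ne] at hy₀⟩
  refine le_antisymm ((uZero_le htop T x).trans (by simp)) (le_sInf ?_)
  rintro _ ⟨u, hu, rfl⟩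
  exact (hu.1 x hx).ge

theorem stepSuper_uZero (hH : HamHyp T d H LH CH M) (h : Path d → ℝ) :
    StepSuper T d H LH (uZero T d H h LH) := by
  intro t₀ ht₀ x₀ hx₀ z y₀ hy₀ τ hτ ε hε
  obtain ⟨_, ⟨u, hu, rfl⟩, hlt⟩ := sInf_lt_iff.1 hy₀
  obtain ⟨x, y, hxy, hle⟩ := ((ncSuper_iff hH).1 hu).2 t₀ ht₀ x₀ hx₀ z y₀ hlt τ hτ ε hε
  exact ⟨x, y, hxy, (uZero_le hu τ x).trans_lt hle⟩

/-- The values `r` from which some characteristic approximately stays below `u` at time `T₀`. -/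
def reachable (T : ℝ) (d : ℕ) (H : Ham d) (LH : ℝ) (u : ℝ → Path d → EReal) (z : E d) (T₀ t : ℝ)
    (x : Path d) : Set ℝ :=
  {r | ∀ ε > (0 : ℝ), ∃ (x' : Path d) (y : ℝ → ℝ), IsChar T d H LH t x r z x' y ∧
    ((y T₀ - ε : ℝ) : EReal) < u T₀ x'}

open Classical in
theorem ncSuper_reachable (hH : HamHyp T d H LH CH M) {h : Path d → ℝ} {u : ℝ → Path d → EReal}
    (hu : ∀ x ∈ Cadlag T d, u T x = ((h x : ℝ) : EReal)) (hstep : StepSuper T d H LH u) {T₀ : ℝ}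
    (hT₀ : T₀ ≤ T) (z : E d) :
    NCSuper T d H h LH (fun t x => if t < T₀ then
      sSup ((fun r : ℝ => (r : EReal)) '' reachable T d H LH u z T₀ t x) else u t x) := by
  refine (ncSuper_iff hH).2 ⟨fun x hx => by rw [if_neg (not_lt.2 hT₀), hu x hx], ?_⟩
  intro t₀ ht₀ x₀ hx₀ z' y₀ hy₀ τ hτ ε hε
  beta_reduce at hy₀ ⊢
  rcases le_or_gt T₀ t₀ with ht | ht
  · rw [if_neg (not_lt.2 ht)] at hy₀
    simp only [if_neg (not_lt.2 (ht.trans hτ.1.le))]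
    exact hstep t₀ ht₀ x₀ hx₀ z' y₀ hy₀ τ hτ ε hε
  rw [if_pos ht] at hy₀
  have hmem : y₀ ∉ reachable T d H LH u z T₀ t₀ x₀ := fun hm =>
    absurd hy₀ (not_lt.2 (le_sSup ⟨y₀, hm, rfl⟩))
  simp only [reachable, mem_ofPred_eq, not_forall, not_exists, not_and, not_lt] at hmem
  obtain ⟨ε₀, hε₀, hbelow⟩ := hmem
  obtain ⟨x, y, hz, hz'⟩ := exists_common_isChar hH ht₀ hx₀ y₀ z z'
  rcases lt_trichotomy τ T₀ with hlt | rfl | hlt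
  · refine ⟨x, y, hz', ?_⟩
    rw [if_pos hlt]
    refine lt_of_le_of_lt (sSup_le ?_) (EReal.coe_lt_coe_iff.2 (lt_add_of_pos_right (y τ) hε))
    rintro _ ⟨r, hr, rfl⟩
    rw [EReal.coe_le_coe_iff]
    by_contra! hcon
    obtain ⟨x', y', hxy', hup⟩ := hr ε₀ hε₀
    obtain ⟨y'', hxy'', hle⟩ := hxy'.exists_le hH ⟨ht₀.1.trans hτ.1.le, hτ.2⟩ hcon.le
    have h1 := hbelow x' _ (hz.concat hH ht₀ ⟨hτ.1.le, hτ.2⟩ hxy'')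
    rw [if_neg (not_le.2 hlt)] at h1
    refine absurd (hup.trans_le h1) (not_lt.2 (EReal.coe_le_coe_iff.2 ?_))
    linarith [hle T₀ ⟨hlt.le, hT₀⟩]
  · refine ⟨x, y, hz', ?_⟩
    rw [if_neg (lt_irrefl _)]
    refine (hbelow x y hz).trans_lt (EReal.coe_lt_coe_iff.2 ?_)
    linarith
  · have h1 : u T₀ x < (y T₀ : EReal) :=
      (hbelow x y hz).trans_lt (EReal.coe_lt_coe_iff.2 (by linarith))
    obtain ⟨x', y', hxy', hup⟩ := hstep T₀ ⟨ht₀.1.trans ht.le, hlt.trans_le hτ.2⟩ x hz.cadlag z'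
      (y T₀) h1 τ ⟨hlt, hτ.2⟩ ε hε
    refine ⟨x', _, hz'.concat hH ht₀ ⟨ht.le, hT₀⟩ hxy', ?_⟩
    rwa [if_neg (not_lt.2 hlt.le), if_neg (not_le.2 hlt)]

theorem stepSub_uZero (hH : HamHyp T d H LH CH M) (h : Path d → ℝ) :
    StepSub T d H LH (uZero T d H h LH) := by
  intro t₀ ht₀ x₀ hx₀ z y₀ hy₀ τ hτ ε hε
  have h1 := uZero_le (ncSuper_reachable hH (fun _ hx => uZero_terminal h hx)
    (stepSuper_uZero hH h) hτ.2 z) t₀ x₀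
  rw [if_pos hτ.1] at h1
  obtain ⟨_, ⟨r, hr, rfl⟩, hlt⟩ := lt_sSup_iff.1 (hy₀.trans_le h1)
  obtain ⟨x, y, hxy, hup⟩ := hr ε hε
  obtain ⟨y', hxy', hle⟩ := hxy.exists_le hH ⟨ht₀.1, ht₀.2.le⟩ (EReal.coe_lt_coe_iff.1 hlt).le
  refine ⟨x, y', hxy', lt_of_le_of_lt (EReal.coe_le_coe_iff.2 ?_) hup⟩
  linarith [hle τ ⟨hτ.1.le, hτ.2⟩]

end

section

variable {T : ℝ} {d : ℕ} {H : Ham d} {LH CH : ℝ} {M : ℝ → ℝ}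

/-! ### The lower semicontinuous envelope -/

section Envelope

variable {u : ℝ → Path d → EReal}

theorem lscEnv_le {t : ℝ} (ht : t ∈ Icc 0 T) {x : Path d} (hx : x ∈ Cadlag T d) :
    lscEnv T d u t x ≤ u t x :=
  iSup₂_le fun _ hδ => sInf_le ⟨t, ht, x, hx, by rwa [dInf_self], rfl⟩

theorem le_uscEnv {t : ℝ} (ht : t ∈ Icc 0 T) {x : Path d} (hx : x ∈ Cadlag T d) :
    u t x ≤ uscEnv T d u t x :=
  le_iInf₂ fun _ hδ => le_sSup ⟨t, ht, x, hx, by rwa [dInf_self], rfl⟩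

theorem exists_lt_of_lscEnv_lt {t₀ : ℝ} {x₀ : Path d} {c : EReal} (h : lscEnv T d u t₀ x₀ < c)
    {δ : ℝ} (hδ : 0 < δ) :
    ∃ t ∈ Icc 0 T, ∃ x ∈ Cadlag T d, dInf T d (t₀, x₀) (t, x) < δ ∧ u t x < c := by
  have h1 : sInf {v : EReal | ∃ t ∈ Icc (0 : ℝ) T, ∃ x ∈ Cadlag T d,
      dInf T d (t₀, x₀) (t, x) < δ ∧ v = u t x} < c := by
    refine lt_of_le_of_lt ?_ h
    exact le_iSup₂ (f := fun (δ : ℝ) (_ : δ ∈ Ioi (0 : ℝ)) =>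
      sInf {v : EReal | ∃ t ∈ Icc (0 : ℝ) T, ∃ x ∈ Cadlag T d,
        dInf T d (t₀, x₀) (t, x) < δ ∧ v = u t x}) δ hδ
  obtain ⟨_, ⟨t, ht, x, hx, hd, rfl⟩, hlt⟩ := sInf_lt_iff.1 h1
  exact ⟨t, ht, x, hx, hd, hlt⟩

theorem exists_forall_lt_lscEnv {t₀ : ℝ} (ht₀ : t₀ ∈ Icc 0 T) {x₀ : Path d}
    (hx₀ : x₀ ∈ Cadlag T d) {c : EReal} (h : c < lscEnv T d u t₀ x₀) :
    ∃ δ > (0 : ℝ), ∀ t ∈ Icc 0 T, ∀ x ∈ Cadlag T d, dInf T d (t₀, x₀) (t, x) < δ →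
      c < lscEnv T d u t x := by
  obtain ⟨δ, h1⟩ := lt_iSup_iff.1 h
  obtain ⟨hδ, hlt⟩ := lt_iSup_iff.1 h1
  have hδ' : (0 : ℝ) < δ / 2 := half_pos hδ
  refine ⟨δ / 2, hδ', fun t ht x hx hd => hlt.trans_le ?_⟩
  refine le_trans ?_ (le_iSup₂ (f := fun (δ : ℝ) (_ : δ ∈ Ioi (0 : ℝ)) =>
      sInf {v : EReal | ∃ s ∈ Icc (0 : ℝ) T, ∃ y ∈ Cadlag T d,
        dInf T d (t, x) (s, y) < δ ∧ v = u s y}) (δ / 2) hδ')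
  refine sInf_le_sInf ?_
  rintro _ ⟨s, hs, y, hy, hd', rfl⟩
  exact ⟨s, hs, y, hy, (dInf_triangle hx₀ hx hy ht₀ ht hs).trans_lt (by linarith), rfl⟩

theorem lscEnv_congr {t : ℝ} (ht : t ∈ Icc 0 T) {x x' : Path d} (h : ∀ s ∈ Icc 0 t, x s = x' s) :
    lscEnv T d u t x = lscEnv T d u t x' := by
  simp only [lscEnv, dInf_congr_left ht h]

theorem lscEnv_le_of_tendsto {t : ℝ} (ht : t ∈ Icc 0 T) {x : Path d} (hx : x ∈ Cadlag T d)
    {t' r : ℕ → ℝ} {x' : ℕ → Path d} {c : ℝ} (ht' : ∀ n, t' n ∈ Icc 0 T)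
    (hx' : ∀ n, x' n ∈ Cadlag T d)
    (hd : Tendsto (fun n => dInf T d (t, x) (t' n, x' n)) atTop (𝓝 0))
    (hr : Tendsto r atTop (𝓝 c)) (hle : ∀ n, lscEnv T d u (t' n) (x' n) ≤ (r n : EReal)) :
    lscEnv T d u t x ≤ (c : EReal) := by
  by_contra! hcon
  obtain ⟨b, hb, hb'⟩ := EReal.lt_iff_exists_real_btwn.1 hcon
  obtain ⟨δ, hδ, hlt⟩ := exists_forall_lt_lscEnv ht hx hb'
  have hev : ∀ᶠ n in atTop, b ≤ r n := by
    filter_upwards [hd.eventually (gt_mem_nhds hδ)] with n hn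
    exact EReal.coe_le_coe_iff.1 ((hlt _ (ht' n) _ (hx' n) hn).le.trans (hle n))
  exact absurd (ge_of_tendsto hr hev) (not_le.2 (EReal.coe_lt_coe_iff.1 hb))

end Envelope

/-! ### The lower envelope is a minimax supersolution -/

theorem abs_sub_le_dInf (t s : ℝ) (x y : Path d) : |t - s| ≤ dInf T d (t, x) (s, y) :=
  le_add_of_nonneg_right (stopDist_nonneg _ _ _ _)

theorem tendsto_one_div_succ : Tendsto (fun n : ℕ => (1 : ℝ) / (n + 1)) atTop (𝓝 0) :=
  tendsto_one_div_add_atTop_nhds_zero_nat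

theorem exists_isChar_lscEnv_le (hH : HamHyp T d H LH CH M) {u : ℝ → Path d → EReal}
    (hu : StepSuper T d H LH u) {t₀ : ℝ} (ht₀ : t₀ ∈ Ico 0 T) {x₀ : Path d}
    (hx₀ : x₀ ∈ Cadlag T d) (z : E d) {y₀ : ℝ} (hy₀ : lscEnv T d u t₀ x₀ ≤ (y₀ : EReal)) {τ : ℝ}
    (hτ : τ ∈ Ioc t₀ T) :
    ∃ (x : Path d) (y : ℝ → ℝ), IsChar T d H LH t₀ x₀ y₀ z x y ∧
      lscEnv T d u τ x ≤ (y τ : EReal) := by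
  have hε : ∀ n : ℕ, (0 : ℝ) < 1 / (n + 1) := fun n => Nat.one_div_pos_of_nat
  have hτ' : τ ∈ Icc 0 T := ⟨ht₀.1.trans hτ.1.le, hτ.2⟩
  choose t ht ξ hξ hd hlt using fun n : ℕ => exists_lt_of_lscEnv_lt
    (hy₀.trans_lt (EReal.coe_lt_coe_iff.2 (lt_add_of_pos_right y₀ (hε n))))
    (lt_min (hε n) (sub_pos.2 hτ.1))
  have htτ : ∀ n, t n < τ := fun n => by
    have h1 := (abs_sub_le_dInf t₀ (t n) x₀ (ξ n)).trans_lt ((hd n).trans_le (min_le_right _ _))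
    have h2 := (abs_lt.1 h1).1
    linarith
  have hlim : Tendsto (fun n => dInf T d (t₀, x₀) (t n, ξ n)) atTop (𝓝 0) :=
    squeeze_zero (fun _ => dInf_nonneg _ _) (fun n => ((hd n).trans_le (min_le_left _ _)).le)
      tendsto_one_div_succ
  choose x y hxy hup using fun n => hu (t n) ⟨(ht n).1, (htτ n).trans_le hτ.2⟩ (ξ n) (hξ n) z
    _ (hlt n) τ ⟨htτ n, hτ.2⟩ _ (hε n)
  obtain ⟨X, Y, φ, hφ, hXY, hconv⟩ := exists_subseq_isChar hH ⟨ht₀.1, ht₀.2.le⟩ hx₀ ht hxy hlim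
    (by simpa using tendsto_one_div_succ.const_add y₀)
  obtain ⟨h1, h2⟩ := hconv (fun _ => τ) τ ⟨hτ.1.le, hτ.2⟩
    (Eventually.of_forall fun n => ⟨(htτ _).le, hτ.2⟩) tendsto_const_nhds
  have h3 := h2.add (tendsto_one_div_succ.comp hφ.tendsto_atTop)
  rw [add_zero] at h3
  refine ⟨X, Y, hXY, lscEnv_le_of_tendsto hτ' hXY.cadlag (fun _ => hτ')
    (fun n => (hxy (φ n)).cadlag) h1 h3 fun n => ?_⟩
  exact (lscEnv_le hτ' (hxy (φ n)).cadlag).trans (hup (φ n)).le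

theorem IsChar.terminal {x : Path d} (hT : 0 ≤ T) (hx : x ∈ Cadlag T d) (y₀ : ℝ) (z : E d) :
    IsChar T d H LH T x y₀ z x (fun _ => y₀) where
  cadlag := hx
  init := fun _ _ => rfl
  growth := fun s t hs hst ht => by
    obtain rfl : s = T := le_antisymm (hst.trans ht) hs
    obtain rfl : t = s := le_antisymm ht hst
    simp
  cont := continuousOn_const
  eq := fun t ht => by
    obtain rfl : t = T := le_antisymm ht.2 ht.1
    simp

theorem TermCont.tendsto {h : Path d → ℝ} (hh : TermCont T d h) {X : Path d} (hX : X ∈ Cadlag T d)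
    {x : ℕ → Path d} (hx : ∀ n, x n ∈ Cadlag T d)
    (hd : Tendsto (fun n => supDist T d X (x n)) atTop (𝓝 0)) :
    Tendsto (fun n => h (x n)) atTop (𝓝 (h X)) := by
  rw [Metric.tendsto_nhds]
  intro ε hε
  obtain ⟨δ, hδ, hlt⟩ := hh X hX ε hε
  filter_upwards [hd.eventually (gt_mem_nhds hδ)] with n hn
  rw [Real.dist_eq]
  exact hlt _ (hx n) hn

theorem le_lscEnv_terminal (hH : HamHyp T d H LH CH M) {u : ℝ → Path d → EReal}
    {h : Path d → ℝ} (hh : TermCont T d h)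
    (huT : ∀ x ∈ Cadlag T d, u T x = ((h x : ℝ) : EReal)) (hu : StepSuper T d H LH u)
    {X : Path d} (hX : X ∈ Cadlag T d) : ((h X : ℝ) : EReal) ≤ lscEnv T d u T X := by
  by_contra! hcon
  obtain ⟨c, hc, hc'⟩ := EReal.lt_iff_exists_real_btwn.1 hcon
  have hT := hH.pos.le
  have hTm : T ∈ Icc 0 T := ⟨hT, le_rfl⟩
  have hε : ∀ n : ℕ, (0 : ℝ) < 1 / (n + 1) := fun n => Nat.one_div_pos_of_nat
  choose t ht ξ hξ hd hlt using fun n : ℕ => exists_lt_of_lscEnv_lt hc (hε n)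
  have hlim : Tendsto (fun n => dInf T d (T, X) (t n, ξ n)) atTop (𝓝 0) :=
    squeeze_zero (fun _ => dInf_nonneg _ _) (fun n => (hd n).le) tendsto_one_div_succ
  have hex : ∀ n, ∃ (x : Path d) (y : ℝ → ℝ), IsChar T d H LH (t n) (ξ n) c 0 x y ∧
      h x ≤ y T + 1 / (n + 1) := by
    intro n
    rcases (ht n).2.eq_or_lt with hn | hn
    · rw [hn]
      refine ⟨ξ n, _, IsChar.terminal hT (hξ n) c 0, ?_⟩
      have h1 := hlt n
      rw [hn, huT _ (hξ n), EReal.coe_lt_coe_iff] at h1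
      linarith [hε n]
    · obtain ⟨x, y, hxy, hup⟩ :=
        hu (t n) ⟨(ht n).1, hn⟩ (ξ n) (hξ n) 0 c (hlt n) T ⟨hn, le_rfl⟩ _ (hε n)
      rw [huT _ hxy.cadlag, EReal.coe_lt_coe_iff] at hup
      exact ⟨x, y, hxy, hup.le⟩
  choose x y hxy hup using hex
  obtain ⟨X', Y, φ, hφ, hXY, hconv⟩ := exists_subseq_isChar hH hTm hX ht hxy hlim
    tendsto_const_nhds
  obtain ⟨h1, h2⟩ := hconv (fun _ => T) T ⟨le_rfl, le_rfl⟩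
    (Eventually.of_forall fun n => ⟨(ht _).2, le_rfl⟩) tendsto_const_nhds
  rw [hXY.left le_rfl] at h2
  simp only [dInf_congr_left hTm hXY.init] at h1
  have hx : ∀ n, x (φ n) ∈ Cadlag T d := fun n => (hxy (φ n)).cadlag
  have h3 := hh.tendsto hX hx (squeeze_zero (fun _ => supDist_nonneg _ _)
    (fun n => supDist_le_dInf hX (hx n) hT) h1)
  have h4 : h X ≤ c + 0 := le_of_tendsto_of_tendsto' h3
    (h2.add (tendsto_one_div_succ.comp hφ.tendsto_atTop)) fun n => hup (φ n)
  rw [add_zero] at h4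
  exact absurd (EReal.coe_lt_coe_iff.1 hc') (not_lt.2 h4)

theorem IsChar.neg_le_of_terminal (hH : HamHyp T d H LH CH M) {t₀ y₀ R c : ℝ} {x₀ x : Path d}
    {y : ℝ → ℝ} {z : E d} (ht₀ : t₀ ∈ Icc 0 T) (h : IsChar T d H LH t₀ x₀ y₀ z x y) (hR0 : 0 ≤ R)
    (hR : ∀ t ≤ T, runSup d x t ≤ R) (hc : 0 ≤ c) (hyT : -c ≤ y T) :
    -((c + (2 * R * ‖z‖ + (1 + (CH * (1 + R) + LH * (1 + R) * ‖z‖) + CH) * T))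
      * Real.exp (CH * T)) ≤ y₀ := by
  have hL := hH.lipZ.1
  have hC := hH.bound.1
  have hT := hH.pos.le
  have happ := h.approxEq hH ht₀.1
  rcases le_or_gt 0 y₀ with hy0 | hy0
  · have : 0 ≤ (c + (2 * R * ‖z‖ + (1 + (CH * (1 + R) + LH * (1 + R) * ‖z‖) + CH) * T))
      * Real.exp (CH * T) := by positivity
    linarith
  obtain ⟨s, hs, hys⟩ : ∃ s ∈ Icc t₀ T, |y s| ≤ c := by
    rcases le_or_gt (y T) c with hTc | hTc
    · exact ⟨T, ⟨ht₀.2, le_rfl⟩, abs_le.2 ⟨hyT, hTc⟩⟩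
    · obtain ⟨s, hs, hsc⟩ := intermediate_value_Icc ht₀.2 h.cont
        ⟨by rw [h.left ht₀.2]; exact (hy0.trans_le hc).le, hTc.le⟩
      exact ⟨s, hs, by rw [hsc, abs_of_nonneg hc]⟩
  have := (abs_le_exp_of_increment_le (h.cont.mono (Icc_subset_Icc_right hs.2)) (T := T)
    (c := 2 * R * ‖z‖ + (1 + (CH * (1 + R) + LH * (1 + R) * ‖z‖) + CH) * T) (by positivity) hC
    (by linarith [ht₀.1, hs.2])
    (fun p q hp hpq hq => abs_increment_le (T := T)
      (fun r hr => (norm_le_runSup h.cadlag (ht₀.1.trans hr.1) (hr.2.trans hs.2) le_rfl).trans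
        (hR T le_rfl))
      (by linarith [ht₀.1, hs.2]) (by positivity) (h.cont.mono (Icc_subset_Icc_right hs.2))
      (happ.int.mono_set (Icc_subset_Icc_right hs.2))
      (ae_Ioo_mono (happ.abs_le hH ht₀ h.cadlag hR) le_rfl hs.2)
      (fun r hr => h.eq r ⟨hr.1, hr.2.trans hs.2⟩) hp hpq hq) (left_mem_Icc.2 hs.1)).2
  rw [h.left ht₀.2] at this
  have h2 : (|y s| + (2 * R * ‖z‖ + (1 + (CH * (1 + R) + LH * (1 + R) * ‖z‖) + CH) * T))
      * Real.exp (CH * T) ≤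
      (c + (2 * R * ‖z‖ + (1 + (CH * (1 + R) + LH * (1 + R) * ‖z‖) + CH) * T))
      * Real.exp (CH * T) := by gcongr
  linarith [neg_abs_le y₀]

theorem lscEnv_ne_bot (hH : HamHyp T d H LH CH M) {u : ℝ → Path d → EReal}
    {h : Path d → ℝ} (hh : TermCont T d h)
    (huT : ∀ x ∈ Cadlag T d, u T x = ((h x : ℝ) : EReal)) (hu : StepSuper T d H LH u)
    {t₀ : ℝ} (ht₀ : t₀ ∈ Icc 0 T) {x₀ : Path d} (hx₀ : x₀ ∈ Cadlag T d) :
    lscEnv T d u t₀ x₀ ≠ ⊥ := by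
  intro hbot
  have hT := hH.pos.le
  have hL := hH.lipZ.1
  rcases ht₀.2.eq_or_lt with rfl | hlt
  · have := le_lscEnv_terminal hH hh huT hu hx₀
    rw [hbot, le_bot_iff] at this
    exact EReal.coe_ne_bot _ this
  choose x y hxy hup using fun n : ℕ => exists_isChar_lscEnv_le hH hu ⟨ht₀.1, hlt⟩ hx₀ 0
    (y₀ := -(n : ℝ)) (by rw [hbot]; exact bot_le) (τ := T) ⟨hlt, le_rfl⟩
  have hhy : ∀ n, h (x n) ≤ y n T := fun n => EReal.coe_le_coe_iff.1
    ((le_lscEnv_terminal hH hh huT hu (hxy n).cadlag).trans (hup n))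
  have hd : ∀ n, dInf T d (t₀, x₀) (t₀, x n) = 0 := fun n => by
    rw [dInf_congr_left ht₀ (fun r hr => ((hxy n).init r hr).symm), dInf_self]
  obtain ⟨X, φ, hφ, -, hconv⟩ := exists_pathConv hL ht₀ hx₀ (fun _ => ht₀)
    (fun n => (hxy n).cadlag) (fun n => (hxy n).growth)
    (by simp only [hd]; exact tendsto_const_nhds)
  obtain ⟨c, hc⟩ := (hh.tendsto hconv.cadlag hconv.cadlag' hconv.tendsto_supDist).bddBelow_range
  obtain ⟨R, hR0, hR⟩ := hconv.exists_runSup_bound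
  have key : ∀ n, -((|c| + (2 * R * ‖(0 : E d)‖ +
      (1 + (CH * (1 + R) + LH * (1 + R) * ‖(0 : E d)‖) + CH) * T)) * Real.exp (CH * T)) ≤
      -((φ n : ℕ) : ℝ) := fun n =>
    (hxy (φ n)).neg_le_of_terminal hH ht₀ hR0 (hR n) (abs_nonneg c)
      ((neg_abs_le c).trans ((hc ⟨n, rfl⟩).trans (hhy (φ n))))
  obtain ⟨n, hn⟩ := exists_nat_gt ((|c| + (2 * R * ‖(0 : E d)‖ +
      (1 + (CH * (1 + R) + LH * (1 + R) * ‖(0 : E d)‖) + CH) * T)) * Real.exp (CH * T))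
  have h1 : (n : ℝ) ≤ φ n := Nat.cast_le.2 hφ.le_apply
  linarith [key n]

theorem exists_isChar_grid (hH : HamHyp T d H LH CH M) {u : ℝ → Path d → EReal}
    (hu : StepSuper T d H LH u) {t₀ : ℝ} (ht₀ : t₀ ∈ Ico 0 T) {x₀ : Path d}
    (hx₀ : x₀ ∈ Cadlag T d) (z : E d) {y₀ : ℝ} (hy₀ : lscEnv T d u t₀ x₀ ≤ (y₀ : EReal)) {δ : ℝ}
    (hδ : 0 < δ) (k : ℕ) :
    ∃ (x : Path d) (y : ℝ → ℝ), IsChar T d H LH t₀ x₀ y₀ z x y ∧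
      ∀ j ≤ k, lscEnv T d u (min (t₀ + j * δ) T) x ≤ (y (min (t₀ + j * δ) T) : EReal) := by
  have hmem : ∀ j : ℕ, min (t₀ + j * δ) T ∈ Icc t₀ T := fun j =>
    ⟨le_min (by have : 0 ≤ j * δ := by positivity
                linarith) ht₀.2.le, min_le_right _ _⟩
  have hmem0 : ∀ j : ℕ, min (t₀ + j * δ) T ∈ Icc 0 T := fun j =>
    ⟨ht₀.1.trans (hmem j).1, (hmem j).2⟩
  have hmono : ∀ {i j : ℕ}, i ≤ j → min (t₀ + i * δ) T ≤ min (t₀ + j * δ) T := fun hij => by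
    gcongr
  induction k with
  | zero =>
    obtain ⟨x, y, hxy, -⟩ := exists_common_isChar hH ht₀ hx₀ y₀ z z
    refine ⟨x, y, hxy, fun j hj => ?_⟩
    obtain rfl := Nat.le_zero.1 hj
    simp only [Nat.cast_zero, zero_mul, add_zero, min_eq_left ht₀.2.le, hxy.left ht₀.2.le]
    rwa [lscEnv_congr ⟨ht₀.1, ht₀.2.le⟩ hxy.init]
  | succ k ih =>
    obtain ⟨x, y, hxy, hle⟩ := ih
    rcases le_or_gt T (t₀ + k * δ) with hk | hk
    · refine ⟨x, y, hxy, fun j hj => ?_⟩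
      rcases hj.lt_or_eq with hj | rfl
      · exact hle j (Nat.lt_succ_iff.1 hj)
      · have h1 := hle k le_rfl
        have h2 : T ≤ t₀ + (k + 1 : ℕ) * δ := by
          push_cast
          linarith
        rw [min_eq_right hk] at h1
        rwa [min_eq_right h2]
    · have hlt : min (t₀ + k * δ) T < min (t₀ + (k + 1 : ℕ) * δ) T := by
        rw [min_eq_left hk.le]
        refine lt_min ?_ hk
        push_cast
        linarith
      obtain ⟨x', y', hxy', hle'⟩ := exists_isChar_lscEnv_le hH hu
        ⟨(hmem0 k).1, (min_le_left _ _).trans_lt hk⟩ hxy.cadlag z (hle k le_rfl)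
        ⟨hlt, (hmem _).2⟩
      refine ⟨x', _, hxy.concat hH ht₀ (hmem k) hxy', fun j hj => ?_⟩
      rcases hj.lt_or_eq with hj | rfl
      · have hjk := hmono (Nat.lt_succ_iff.1 hj)
        rw [if_pos hjk, lscEnv_congr (hmem0 j)
          fun s hs => hxy'.init s ⟨hs.1, hs.2.trans hjk⟩]
        exact hle j (Nat.lt_succ_iff.1 hj)
      · rwa [if_neg (not_le.2 hlt)]

theorem exists_isChar_dense (hH : HamHyp T d H LH CH M) {u : ℝ → Path d → EReal}
    (hu : StepSuper T d H LH u) {t₀ : ℝ} (ht₀ : t₀ ∈ Ico 0 T) {x₀ : Path d}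
    (hx₀ : x₀ ∈ Cadlag T d) (z : E d) {y₀ : ℝ} (hy₀ : lscEnv T d u t₀ x₀ ≤ (y₀ : EReal)) {δ : ℝ}
    (hδ : 0 < δ) :
    ∃ (x : Path d) (y : ℝ → ℝ), IsChar T d H LH t₀ x₀ y₀ z x y ∧
      ∀ t ∈ Icc t₀ T, ∃ s ∈ Icc t₀ t, t - s ≤ δ ∧ lscEnv T d u s x ≤ (y s : EReal) := by
  obtain ⟨k, hk⟩ := exists_nat_ge ((T - t₀) / δ)
  obtain ⟨x, y, hxy, hle⟩ := exists_isChar_grid hH hu ht₀ hx₀ z hy₀ hδ k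
  refine ⟨x, y, hxy, fun t ht => ?_⟩
  have h0 : 0 ≤ (t - t₀) / δ := div_nonneg (sub_nonneg.2 ht.1) hδ.le
  have h1 := (le_div_iff₀ hδ).1 (Nat.floor_le h0)
  have h2 := (div_lt_iff₀ hδ).1 (Nat.lt_floor_add_one ((t - t₀) / δ))
  have hjk : ⌊(t - t₀) / δ⌋₊ ≤ k := Nat.floor_le_of_le
    ((div_le_div_of_nonneg_right (sub_le_sub_right ht.2 t₀) hδ.le).trans hk)
  have h3 := hle _ hjk
  rw [min_eq_left (by linarith [ht.2])] at h3
  have : 0 ≤ ⌊(t - t₀) / δ⌋₊ * δ := by positivity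
  exact ⟨_, ⟨by linarith, by linarith⟩, by linarith, h3⟩

theorem exists_isChar_forall_lscEnv_le (hH : HamHyp T d H LH CH M) {u : ℝ → Path d → EReal}
    (hu : StepSuper T d H LH u) {t₀ : ℝ} (ht₀ : t₀ ∈ Ico 0 T) {x₀ : Path d}
    (hx₀ : x₀ ∈ Cadlag T d) (z : E d) {y₀ : ℝ} (hy₀ : lscEnv T d u t₀ x₀ ≤ (y₀ : EReal)) :
    ∃ (x : Path d) (y : ℝ → ℝ), IsChar T d H LH t₀ x₀ y₀ z x y ∧
      ∀ t ∈ Icc t₀ T, lscEnv T d u t x ≤ (y t : EReal) := by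
  have hε : ∀ n : ℕ, (0 : ℝ) < 1 / (n + 1) := fun n => Nat.one_div_pos_of_nat
  have ht₀' : t₀ ∈ Icc 0 T := ⟨ht₀.1, ht₀.2.le⟩
  choose x y hxy hex using fun n : ℕ => exists_isChar_dense hH hu ht₀ hx₀ z hy₀ (hε n)
  obtain ⟨X, Y, φ, hφ, hXY, hconv⟩ := exists_subseq_isChar hH ht₀' hx₀ (fun _ => ht₀') hxy
    (by simp only [dInf_self]; exact tendsto_const_nhds) tendsto_const_nhds
  refine ⟨X, Y, hXY, fun t ht => ?_⟩
  choose σ hσ hσt hle using fun n => hex (φ n) t ht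
  have hσ' : ∀ n, σ n ∈ Icc t₀ T := fun n => ⟨(hσ n).1, (hσ n).2.trans ht.2⟩
  have hlim : Tendsto σ atTop (𝓝 t) := by
    refine tendsto_of_tendsto_of_tendsto_of_le_of_le (g := fun n => t - 1 / ((φ n : ℕ) + 1))
      (h := fun _ => t) ?_ tendsto_const_nhds (fun n => by have := hσt n; simp only; linarith)
      (fun n => (hσ n).2)
    simpa using (tendsto_one_div_succ.comp hφ.tendsto_atTop).const_sub t
  obtain ⟨h1, h2⟩ := hconv σ t ht (Eventually.of_forall hσ') hlim
  exact lscEnv_le_of_tendsto ⟨ht₀.1.trans ht.1, ht.2⟩ hXY.cadlag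
    (fun n => ⟨ht₀.1.trans (hσ' n).1, (hσ' n).2⟩) (fun n => (hxy (φ n)).cadlag) h1 h2 hle

theorem minimaxSuper_lscEnv (hH : HamHyp T d H LH CH M) {u : ℝ → Path d → EReal}
    {h : Path d → ℝ} (hh : TermCont T d h)
    (huT : ∀ x ∈ Cadlag T d, u T x = ((h x : ℝ) : EReal)) (hu : StepSuper T d H LH u)
    (htop : ∀ t ∈ Icc 0 T, ∀ x ∈ Cadlag T d, lscEnv T d u t x ≠ ⊤) :
    MinimaxSuper T d H h LH fun t x => (lscEnv T d u t x).toReal := by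
  have hco : ∀ t ∈ Icc 0 T, ∀ x ∈ Cadlag T d,
      ((lscEnv T d u t x).toReal : EReal) = lscEnv T d u t x := fun t ht x hx =>
    EReal.coe_toReal (htop t ht x hx) (lscEnv_ne_bot hH hh huT hu ht hx)
  refine ⟨fun t₀ ht₀ x₀ hx₀ c hc => ?_, fun x hx => ?_, fun s₀ hs₀ x₀ hx₀ z y₀ hy₀ => ?_⟩
  · rw [← EReal.coe_lt_coe_iff, hco t₀ ht₀ x₀ hx₀] at hc
    obtain ⟨δ, hδ, hlt⟩ := exists_forall_lt_lscEnv ht₀ hx₀ hc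
    refine ⟨δ, hδ, fun t ht x hx hd => ?_⟩
    rw [← EReal.coe_lt_coe_iff, hco t ht x hx]
    exact hlt t ht x hx hd
  · rw [← EReal.coe_le_coe_iff, hco T ⟨hH.pos.le, le_rfl⟩ x hx]
    exact le_lscEnv_terminal hH hh huT hu hx
  · have hs₀' : s₀ ∈ Icc 0 T := ⟨hs₀.1, hs₀.2.le⟩
    rw [← EReal.coe_le_coe_iff, hco s₀ hs₀' x₀ hx₀] at hy₀
    obtain ⟨x, y, hxy, hle⟩ := exists_isChar_forall_lscEnv_le hH hu hs₀ hx₀ z hy₀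
    refine ⟨(x, y), (mem_YSet_iff hH hs₀').2 hxy, fun t ht => ?_⟩
    have ht' : t ∈ Icc 0 T := ⟨hs₀.1.trans ht.1, ht.2⟩
    rw [← EReal.coe_le_coe_iff, hco t ht' x hxy.cadlag]
    exact hle t ht

end

section

variable {T : ℝ} {d : ℕ} {H : Ham d} {LH CH : ℝ} {M : ℝ → ℝ}

/-! ### Duality between sub- and supersolutions -/

/-- The Hamiltonian of the equation solved by `-u`. -/
def dualHam (H : Ham d) : Ham d := fun t x y z => -H t x (-y) (-z)

@[simp]
theorem dualHam_dualHam (H : Ham d) : dualHam (dualHam H) = H := by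
  funext t x y z
  simp [dualHam]

theorem abs_neg_sub_neg' (a b : ℝ) : |-a - -b| = |a - b| := by
  rw [neg_sub_neg, abs_sub_comm]

theorem HamHyp.dual (hH : HamHyp T d H LH CH M) : HamHyp T d (dualHam H) LH CH M where
  pos := hH.pos
  cont := by
    filter_upwards [hH.cont] with t ht x hx y z ε hε
    obtain ⟨δ, hδ, h⟩ := ht x hx (-y) (-z) ε hε
    refine ⟨δ, hδ, fun x' hx' y' z' h1 h2 h3 => ?_⟩
    rw [dualHam, dualHam, abs_neg_sub_neg']
    refine h x' hx' _ _ h1 ?_ ?_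
    · rwa [abs_neg_sub_neg']
    · rwa [neg_sub_neg, norm_sub_rev]
  meas := fun x y z => (hH.meas x (-y) (-z)).neg
  lipZ := by
    refine ⟨hH.lipZ.1, ?_⟩
    filter_upwards [hH.lipZ.2] with t ht x hx y z z'
    rw [dualHam, dualHam, abs_neg_sub_neg']
    refine (ht x hx (-y) (-z) (-z')).trans_eq ?_
    rw [neg_sub_neg, norm_sub_rev]
  lipX := fun L hL => by
    refine ⟨(hH.lipX L hL).1, fun t₀ ht₀ x₀ hx₀ x hx x' hx' y z => ?_⟩
    filter_upwards [(hH.lipX L hL).2 t₀ ht₀ x₀ hx₀ x hx x' hx' (-y) (-z)] with t ht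
    rwa [dualHam, dualHam, abs_neg_sub_neg', ← abs_neg y, ← norm_neg z]
  mono := by
    filter_upwards [hH.mono] with t ht x hx z y y' hy
    exact neg_le_neg (ht x hx (-z) _ _ (neg_le_neg hy))
  bound := by
    refine ⟨hH.bound.1, ?_⟩
    filter_upwards [hH.bound.2] with t ht x hx y
    simpa [dualHam] using ht x hx (-y)

theorem IsChar.dual {s₀ y₀ : ℝ} {x₀ x : Path d} {z : E d} {y : ℝ → ℝ}
    (h : IsChar T d H LH s₀ x₀ y₀ z x y) :
    IsChar T d (dualHam H) LH s₀ x₀ (-y₀) (-z) x (-y) where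
  cadlag := h.cadlag
  init := h.init
  growth := h.growth
  cont := h.cont.neg
  eq := fun t ht => by
    simp only [dualHam, Pi.neg_apply, neg_neg, inner_neg_right, intervalIntegral.integral_neg]
    rw [h.eq t ht]
    ring

theorem IsChar.of_dual {s₀ y₀ : ℝ} {x₀ x : Path d} {z : E d} {y : ℝ → ℝ}
    (h : IsChar T d (dualHam H) LH s₀ x₀ y₀ z x y) :
    IsChar T d H LH s₀ x₀ (-y₀) (-z) x (-y) := by
  simpa using h.dual

theorem StepSub.neg {u : ℝ → Path d → EReal} (hu : StepSub T d H LH u) :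
    StepSuper T d (dualHam H) LH fun t x => -u t x := by
  intro t₀ ht₀ x₀ hx₀ z y₀ hlt τ hτ ε hε
  obtain ⟨x, y, hxy, hy⟩ := hu t₀ ht₀ x₀ hx₀ (-z) (-y₀)
    (by rw [EReal.coe_neg]; exact EReal.neg_lt_comm.1 hlt) τ hτ ε hε
  refine ⟨x, -y, by simpa using hxy.dual, EReal.neg_lt_comm.1 ?_⟩
  rw [← EReal.coe_neg]
  convert hy using 2
  simp only [Pi.neg_apply]
  ring

theorem lscEnv_neg (u : ℝ → Path d → EReal) (t : ℝ) (x : Path d) :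
    lscEnv T d (fun s y => -u s y) t x = -uscEnv T d u t x := by
  have hneg : ∀ δ : ℝ, sInf {v : EReal | ∃ s ∈ Icc (0 : ℝ) T, ∃ y ∈ Cadlag T d,
      dInf T d (t, x) (s, y) < δ ∧ v = -u s y} =
      -sSup {v : EReal | ∃ s ∈ Icc (0 : ℝ) T, ∃ y ∈ Cadlag T d,
        dInf T d (t, x) (s, y) < δ ∧ v = u s y} := by
    refine fun δ => le_antisymm (EReal.le_neg_of_le_neg (sSup_le ?_)) (le_sInf ?_)
    · rintro _ ⟨s, hs, y, hy, hd, rfl⟩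
      exact EReal.le_neg_of_le_neg (sInf_le ⟨s, hs, y, hy, hd, rfl⟩)
    · rintro _ ⟨s, hs, y, hy, hd, rfl⟩
      exact EReal.neg_le_neg_iff.2 (le_sSup ⟨s, hs, y, hy, hd, rfl⟩)
  simp only [lscEnv, uscEnv, hneg]
  refine le_antisymm (iSup₂_le fun δ hδ => EReal.neg_le_neg_iff.2 (iInf₂_le δ hδ)) ?_
  refine EReal.neg_le_of_neg_le (le_iInf₂ fun δ hδ => EReal.neg_le_of_neg_le ?_)
  exact le_iSup₂ (f := fun (δ : ℝ) (_ : δ ∈ Ioi (0 : ℝ)) =>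
    -sSup {v : EReal | ∃ s ∈ Icc (0 : ℝ) T, ∃ y ∈ Cadlag T d,
      dInf T d (t, x) (s, y) < δ ∧ v = u s y}) δ hδ

theorem TermCont.neg {h : Path d → ℝ} (hh : TermCont T d h) : TermCont T d fun x => -h x := by
  intro x hx ε hε
  obtain ⟨δ, hδ, hlt⟩ := hh x hx ε hε
  exact ⟨δ, hδ, fun x' hx' hd => by rw [abs_neg_sub_neg']; exact hlt x' hx' hd⟩

theorem MinimaxSuper.neg (hH : HamHyp T d H LH CH M) {h : Path d → ℝ} {u : ℝ → Path d → ℝ}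
    (hu : MinimaxSuper T d (dualHam H) (fun x => -h x) LH fun t x => -u t x) :
    MinimaxSub T d H h LH u := by
  obtain ⟨h1, h2, h3⟩ := hu
  refine ⟨fun t₀ ht₀ x₀ hx₀ c hc => ?_, fun x hx => neg_le_neg_iff.1 (h2 x hx),
    fun s₀ hs₀ x₀ hx₀ z y₀ hy₀ => ?_⟩
  · obtain ⟨δ, hδ, hlt⟩ := h1 t₀ ht₀ x₀ hx₀ (-c) (neg_lt_neg hc)
    exact ⟨δ, hδ, fun t ht x hx hd => neg_lt_neg_iff.1 (hlt t ht x hx hd)⟩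
  · have hs₀' : s₀ ∈ Icc 0 T := ⟨hs₀.1, hs₀.2.le⟩
    obtain ⟨⟨x, y⟩, hp, hle⟩ := h3 s₀ hs₀ x₀ hx₀ (-z) (-y₀) (neg_le_neg hy₀)
    refine ⟨(x, -y), (mem_YSet_iff hH hs₀').2 ?_, fun t ht => neg_le.1 (hle t ht)⟩
    simpa using ((mem_YSet_iff hH.dual hs₀').1 hp).of_dual

theorem uscEnv_ne_top (hH : HamHyp T d H LH CH M) {u : ℝ → Path d → EReal}
    {h : Path d → ℝ} (hh : TermCont T d h)
    (huT : ∀ x ∈ Cadlag T d, u T x = ((h x : ℝ) : EReal)) (hu : StepSub T d H LH u)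
    {t : ℝ} (ht : t ∈ Icc 0 T) {x : Path d} (hx : x ∈ Cadlag T d) :
    uscEnv T d u t x ≠ ⊤ := by
  have h1 := lscEnv_ne_bot hH.dual hh.neg (u := fun t x => -u t x)
    (fun x hx => by rw [huT x hx, EReal.coe_neg]) hu.neg ht hx
  rw [lscEnv_neg] at h1
  rintro h2
  simp [h2] at h1

theorem minimaxSub_uscEnv (hH : HamHyp T d H LH CH M) {u : ℝ → Path d → EReal}
    {h : Path d → ℝ} (hh : TermCont T d h)
    (huT : ∀ x ∈ Cadlag T d, u T x = ((h x : ℝ) : EReal)) (hu : StepSub T d H LH u)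
    (hbot : ∀ t ∈ Icc 0 T, ∀ x ∈ Cadlag T d, uscEnv T d u t x ≠ ⊥) :
    MinimaxSub T d H h LH fun t x => (uscEnv T d u t x).toReal := by
  have h1 := minimaxSuper_lscEnv hH.dual hh.neg (u := fun t x => -u t x)
    (fun x hx => by rw [huT x hx, EReal.coe_neg]) hu.neg fun t ht x hx => by
      simpa [lscEnv_neg] using hbot t ht x hx
  simp only [lscEnv_neg, EReal.toReal_neg_eq] at h1
  exact h1.neg hH

end

/-- The semicontinuous envelopes of `u₀` are real-valued, the upper
envelope `(u₀)^*` is a minimax `L_H`-subsolution and the lower envelope `(u₀)_*` is a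
minimax `L_H`-supersolution of (TVP). -/
theorem uZero_envelopes (T : ℝ) (hT : 0 < T) (d : ℕ) (hd : 1 ≤ d)
    (H : Ham d) (LH CH : ℝ) (M : ℝ → ℝ)
    (hH1 : HamCont T d H) (hH2 : HamMeas d H) (hH3 : HamLipZ T d H LH)
    (hH4 : HamLipX T d H M) (hH5 : HamMono T d H) (hH6 : HamBound T d H CH)
    (h : Path d → ℝ) (hh : TermCont T d h) :
    (∀ t ∈ Icc (0 : ℝ) T, ∀ x ∈ Cadlag T d,
      uscEnv T d (uZero T d H h LH) t x ≠ ⊤ ∧ uscEnv T d (uZero T d H h LH) t x ≠ ⊥ ∧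
      lscEnv T d (uZero T d H h LH) t x ≠ ⊤ ∧ lscEnv T d (uZero T d H h LH) t x ≠ ⊥) ∧
    MinimaxSub T d H h LH (fun t x => (uscEnv T d (uZero T d H h LH) t x).toReal) ∧
    MinimaxSuper T d H h LH (fun t x => (lscEnv T d (uZero T d H h LH) t x).toReal) := by
  have hH : HamHyp T d H LH CH M := ⟨hT, hH1, hH2, hH3, hH4, hH5, hH6⟩
  have huT : ∀ x ∈ Cadlag T d, uZero T d H h LH T x = ((h x : ℝ) : EReal) := fun _ hx =>
    uZero_terminal h hx
  have hsub : StepSub T d H LH (uZero T d H h LH) := stepSub_uZero hH h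
  have hsup : StepSuper T d H LH (uZero T d H h LH) := stepSuper_uZero hH h
  have htop : ∀ t ∈ Icc 0 T, ∀ x ∈ Cadlag T d, uscEnv T d (uZero T d H h LH) t x ≠ ⊤ :=
    fun _ ht _ hx => uscEnv_ne_top hH hh huT hsub ht hx
  have hbot : ∀ t ∈ Icc 0 T, ∀ x ∈ Cadlag T d, lscEnv T d (uZero T d H h LH) t x ≠ ⊥ :=
    fun _ ht _ hx => lscEnv_ne_bot hH hh huT hsup ht hx
  have hle : ∀ t ∈ Icc 0 T, ∀ x ∈ Cadlag T d,
      lscEnv T d (uZero T d H h LH) t x ≤ uscEnv T d (uZero T d H h LH) t x :=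
    fun _ ht _ hx => (lscEnv_le ht hx).trans (le_uscEnv ht hx)
  have hbot' : ∀ t ∈ Icc 0 T, ∀ x ∈ Cadlag T d, uscEnv T d (uZero T d H h LH) t x ≠ ⊥ :=
    fun t ht x hx => ne_bot_of_le_ne_bot (hbot t ht x hx) (hle t ht x hx)
  have htop' : ∀ t ∈ Icc 0 T, ∀ x ∈ Cadlag T d, lscEnv T d (uZero T d H h LH) t x ≠ ⊤ :=
    fun t ht x hx => ne_top_of_le_ne_top (htop t ht x hx) (hle t ht x hx)
  exact ⟨fun t ht x hx => ⟨htop t ht x hx, hbot' t ht x hx, htop' t ht x hx, hbot t ht x hx⟩,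
    minimaxSub_uscEnv hH hh huT hsub hbot', minimaxSuper_lscEnv hH hh huT hsup htop'⟩

end PHJ
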